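/- Main theorem: For every bipartite quantum state ρ^{AB} on finite-dimensional systems A and B and every classical communication rate R ≥ 0, the 1-way distillable local purity equals κ_→(ρ^{AB}, R) = κ*_→(ρ^{AB}, R), where κ*_→(ρ^{AB},R) = κ(ρ^A) + κ(ρ^B) + P_→(ρ^{AB},R). -/

import Mathlib

noncomputable section
namespace LPD

open Matrix Kronecker BigOperators Filter Finset
open scoped ComplexOrder

/-- The positive semidefinite square root of a positive semidefinite matrix
(the definition of the older Mathlib, which has since been removed). -/
def _root_.Matrix.PosSemidef.sqrt {n 𝕜 : Type*} [Fintype n] [RCLike 𝕜] [DecidableEq n]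
    {A : Matrix n n 𝕜} (hA : A.PosSemidef) : Matrix n n 𝕜 :=
  hA.1.eigenvectorUnitary.1 * diagonal ((↑) ∘ Real.sqrt ∘ hA.1.eigenvalues) *
    (star hA.1.eigenvectorUnitary : Matrix n n 𝕜)

/-- The trace norm `‖ω‖₁ = Tr √(ωᴴ ω)` of a matrix. -/
def traceNorm {ι : Type*} [Fintype ι] [DecidableEq ι] (ω : Matrix ι ι ℂ) : ℝ :=
  ((Matrix.posSemidef_conjTranspose_mul_self ω).sqrt).trace.re

/-- A density operator: positive semidefinite with trace one. -/
def IsDensity {ι : Type*} [Fintype ι] (ρ : Matrix ι ι ℂ) : Prop :=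
  ρ.PosSemidef ∧ ρ.trace = 1

/-- The von Neumann entropy `H(ρ) = -Tr(ρ log ρ)`, expressed via eigenvalues
(with the convention `0 log 0 = 0`, and junk value `0` on non-Hermitian input). -/
def entropy {ι : Type*} [Fintype ι] [DecidableEq ι] (ρ : Matrix ι ι ℂ) : ℝ :=
  letI := Classical.dec ρ.IsHermitian
  if h : ρ.IsHermitian then -∑ i, h.eigenvalues i * Real.log (h.eigenvalues i) else 0

/-- Partial trace over the first (left) tensor factor. -/
def ptraceLeft {α β : Type*} [Fintype α] (ρ : Matrix (α × β) (α × β) ℂ) : Matrix β β ℂ :=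
  fun b b' => ∑ a, ρ (a, b) (a, b')

/-- Partial trace over the second (right) tensor factor. -/
def ptraceRight {α β : Type*} [Fintype β] (ρ : Matrix (α × β) (α × β) ℂ) : Matrix α α ℂ :=
  fun a a' => ∑ b, ρ (a, b) (a', b)

/-- Quantum mutual information `I(A;B) = H(A) + H(B) - H(AB)` of a bipartite state. -/
def mutualInfo {α β : Type*} [Fintype α] [DecidableEq α] [Fintype β] [DecidableEq β]
    (ρ : Matrix (α × β) (α × β) ℂ) : ℝ :=
  entropy (ptraceRight ρ) + entropy (ptraceLeft ρ) - entropy ρ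

/-- Conditional entropy `H(B|A) = H(AB) - H(A)` (second system conditioned on the first). -/
def condEntropySnd {α β : Type*} [Fintype α] [DecidableEq α] [Fintype β] [DecidableEq β]
    (ρ : Matrix (α × β) (α × β) ℂ) : ℝ :=
  entropy ρ - entropy (ptraceRight ρ)

/-- Conditional entropy `H(A|B) = H(AB) - H(B)` (first system conditioned on the second). -/
def condEntropyFst {α β : Type*} [Fintype α] [DecidableEq α] [Fintype β] [DecidableEq β]
    (ρ : Matrix (α × β) (α × β) ℂ) : ℝ :=
  entropy ρ - entropy (ptraceLeft ρ)

/-- `n`-fold tensor power of a matrix. -/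
def tpow {ι : Type*} (ρ : Matrix ι ι ℂ) (n : ℕ) : Matrix (Fin n → ι) (Fin n → ι) ℂ :=
  fun x y => ∏ k, ρ (x k) (y k)

/-- `n`-fold tensor power of a bipartite state, with the `A` and `B` factors collected. -/
def tpowAB {α β : Type*} (ρ : Matrix (α × β) (α × β) ℂ) (n : ℕ) :
    Matrix ((Fin n → α) × (Fin n → β)) ((Fin n → α) × (Fin n → β)) ℂ :=
  Matrix.reindex (Equiv.arrowProdEquivProdArrow (Fin n) (fun _ => α) (fun _ => β))
    (Equiv.arrowProdEquivProdArrow (Fin n) (fun _ => α) (fun _ => β)) (tpow ρ n)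

/-- A POVM on the system `ι` with outcome set `κ`. -/
structure POVM (ι κ : Type*) [Fintype ι] [DecidableEq ι] [Fintype κ] where
  elem : κ → Matrix ι ι ℂ
  pos : ∀ y, (elem y).PosSemidef
  sum_eq : ∑ y, elem y = 1

/-- Apply a POVM to the first factor of a bipartite state, recording the outcome in a
classical register: `ρ^{AΓ} ↦ Σ_y |y⟩⟨y| ⊗ Tr_A((Λ_y ⊗ 1)ρ)`. -/
def measureLeft {ι κ γ : Type*} [Fintype ι] [DecidableEq ι] [Fintype κ] [DecidableEq κ]
    (Λ : POVM ι κ) (ρ : Matrix (ι × γ) (ι × γ) ℂ) : Matrix (κ × γ) (κ × γ) ℂ :=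
  fun p q => if p.1 = q.1 then ∑ a, ∑ a', (Λ.elem p.1) a a' * ρ (a', p.2) (a, q.2) else 0

/-- The canonical purification of a density operator `ρ` on `ι`, a pure state on `ι × ι`
(junk value `0` for non-positive-semidefinite input). -/
def canonicalPurification {ι : Type*} [Fintype ι] [DecidableEq ι] (ρ : Matrix ι ι ℂ) :
    Matrix (ι × ι) (ι × ι) ℂ :=
  letI := Classical.dec ρ.PosSemidef
  if h : ρ.PosSemidef then
    vecMulVec (fun p => h.sqrt p.1 p.2) (star fun p => h.sqrt p.1 p.2)
  else 0

/-- The purity `κ(ρ) = log d - H(ρ)`. -/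
def kappa {ι : Type*} [Fintype ι] [DecidableEq ι] (ρ : Matrix ι ι ℂ) : ℝ :=
  Real.log (Fintype.card ι) - entropy ρ

/-- The pure state `|0⟩⟨0|` on a `d`-dimensional system. -/
def pureZero (d : ℕ) : Matrix (Fin d) (Fin d) ℂ :=
  fun i j => if i.val = 0 ∧ j.val = 0 then 1 else 0

/-! ### Index bookkeeping equivalences -/

/-- `(a × b) × c ≃ (a × c) × b`. -/
def swapE (a b c : Type*) : (a × b) × c ≃ (a × c) × b where
  toFun x := ((x.1.1, x.2), x.1.2)
  invFun x := ((x.1.1, x.2), x.1.2)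
  left_inv _ := rfl
  right_inv _ := rfl

/-- Pull the `Y` register to the front: `((a × y) × g) × b ≃ y × ((a × g) × b)`. -/
def pullY (a y g b : Type*) : ((a × y) × g) × b ≃ y × ((a × g) × b) where
  toFun x := (x.1.1.2, ((x.1.1.1, x.1.2), x.2))
  invFun x := (((x.2.1.1, x.1), x.2.1.2), x.2.2)
  left_inv _ := rfl
  right_inv _ := rfl

/-- Rearrange for Bob's unitary: `((a × y) × g) × b ≃ (b × y) × (a × g)`. -/
def pullBY (a y g b : Type*) : ((a × y) × g) × b ≃ (b × y) × (a × g) where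
  toFun x := ((x.2, x.1.1.2), (x.1.1.1, x.1.2))
  invFun x := (((x.2.1, x.1.2), x.2.2), x.1.1)
  left_inv _ := rfl
  right_inv _ := rfl

/-- Collect `Y` and `B` together: `((a × y) × g) × b ≃ (y × b) × (a × g)`. -/
def pullYB (a y g b : Type*) : ((a × y) × g) × b ≃ (y × b) × (a × g) where
  toFun x := ((x.1.1.2, x.2), (x.1.1.1, x.1.2))
  invFun x := (((x.2.1, x.1.1), x.2.2), x.1.2)
  left_inv _ := rfl
  right_inv _ := rfl

/-- Sort output registers: `(bp × bg) × (ap × ag) ≃ (ap × bp) × (ag × bg)`. -/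
def sortOut (bp bg ap ag : Type*) : (bp × bg) × (ap × ag) ≃ (ap × bp) × (ag × bg) where
  toFun x := ((x.2.1, x.1.1), (x.2.2, x.1.2))
  invFun x := ((x.1.2, x.2.2), (x.1.1, x.2.1))
  left_inv _ := rfl
  right_inv _ := rfl

/-- `y × (x × w) ≃ (y × w) × x`. -/
def exYW (y x w : Type*) : y × (x × w) ≃ (y × w) × x where
  toFun a := ((a.1, a.2.2), a.2.1)
  invFun a := (a.1.1, (a.2, a.1.2))
  left_inv _ := rfl
  right_inv _ := rfl

/-- `y × (x × w) ≃ (y × x) × w`. -/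
def exYX (y x w : Type*) : y × (x × w) ≃ (y × x) × w where
  toFun a := ((a.1, a.2.1), a.2.2)
  invFun a := (a.1.1, (a.1.2, a.2))
  left_inv _ := rfl
  right_inv _ := rfl

/-- `y × (x × (b × e)) ≃ (y × b) × (x × e)`. -/
def exYB (y x b e : Type*) : y × (x × (b × e)) ≃ (y × b) × (x × e) where
  toFun a := ((a.1, a.2.2.1), (a.2.1, a.2.2.2))
  invFun a := (a.1.1, (a.2.1, (a.1.2, a.2.2)))
  left_inv _ := rfl
  right_inv _ := rfl

/-! ### The state `σ^{YBE}` obtained by measuring Alice's share of a purification -/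

/-- The canonical purification of a bipartite state `ρ^{AB}`, with indices arranged as
`A × (B × E)` where `E = A × B`. -/
def purifyAssoc {α β : Type*} [Fintype α] [DecidableEq α] [Fintype β] [DecidableEq β]
    (ρ : Matrix (α × β) (α × β) ℂ) :
    Matrix (α × (β × (α × β))) (α × (β × (α × β))) ℂ :=
  Matrix.reindex (Equiv.prodAssoc α β (α × β)) (Equiv.prodAssoc α β (α × β))
    (canonicalPurification ρ)

/-- `σ^{YBE} = (Λ ⊗ 1^{BE})(Ψ^{ABE})` for the canonical purification `Ψ` of `ρ^{AB}`. -/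
def sigmaOf {α β κ : Type*} [Fintype α] [DecidableEq α] [Fintype β] [DecidableEq β]
    [Fintype κ] [DecidableEq κ] (ρ : Matrix (α × β) (α × β) ℂ) (Λ : POVM α κ) :
    Matrix (κ × (β × (α × β))) (κ × (β × (α × β))) ℂ :=
  measureLeft Λ (purifyAssoc ρ)

/-- `I(Y;B)` evaluated on a state of the form `σ^{Y(BE)}`: trace out `E`, then take the
mutual information. -/
def IYB {κ β ε : Type*} [Fintype κ] [DecidableEq κ] [Fintype β] [DecidableEq β] [Fintype ε]
    (σ : Matrix (κ × (β × ε)) (κ × (β × ε)) ℂ) : ℝ :=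
  mutualInfo (ptraceRight (Matrix.reindex (Equiv.prodAssoc κ β ε).symm
    (Equiv.prodAssoc κ β ε).symm σ))

/-- `I(Y;BE)` evaluated on a state of the form `σ^{Y(BE)}`. -/
def IYBE {κ β ε : Type*} [Fintype κ] [DecidableEq κ] [Fintype β] [DecidableEq β] [Fintype ε]
    [DecidableEq ε] (σ : Matrix (κ × (β × ε)) (κ × (β × ε)) ℂ) : ℝ :=
  mutualInfo σ

/-- `P^{(1)}_→(ρ^{AB}, R) = max_Λ { I(Y;B)_σ : I(Y;BE)_σ ≤ R }`, the maximum over all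
POVMs on Alice's system. -/
def P1 {α β : Type*} [Fintype α] [DecidableEq α] [Fintype β] [DecidableEq β]
    (ρ : Matrix (α × β) (α × β) ℂ) (R : ℝ) : ℝ :=
  sSup { v : ℝ | ∃ (m : ℕ) (Λ : POVM α (Fin m)),
    IYBE (sigmaOf ρ Λ) ≤ R ∧ v = IYB (sigmaOf ρ Λ) }

/-! ### Local purity distillation protocols -/

/-- An `(n, ·, ·, ·)` local purity distillation protocol: Alice's unitary
`U_A : H_{A^n} ⊗ H_C → H_{A_p} ⊗ H_Y ⊗ H_{A_g}`, a dephasing channel on `Y`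
(applied below), and Bob's unitary `U_B : H_{B^n} ⊗ H_Y → H_{B_p} ⊗ H_{B_g}`. -/
structure Protocol (α β : Type*) [Fintype α] [DecidableEq α] [Fintype β] [DecidableEq β]
    (n : ℕ) where
  dC : ℕ
  dAp : ℕ
  dY : ℕ
  dAg : ℕ
  dBp : ℕ
  dBg : ℕ
  dC_pos : 0 < dC
  dAp_pos : 0 < dAp
  dY_pos : 0 < dY
  dAg_pos : 0 < dAg
  dBp_pos : 0 < dBp
  dBg_pos : 0 < dBg
  UA : Matrix ((Fin dAp × Fin dY) × Fin dAg) ((Fin n → α) × Fin dC) ℂ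
  UA_unitary : UAᴴ * UA = 1 ∧ UA * UAᴴ = 1
  UB : Matrix (Fin dBp × Fin dBg) ((Fin n → β) × Fin dY) ℂ
  UB_unitary : UBᴴ * UB = 1 ∧ UB * UBᴴ = 1

variable {α β : Type*} [Fintype α] [DecidableEq α] [Fintype β] [DecidableEq β]

/-- The input state `(ρ^{AB})^{⊗n} ⊗ |0⟩⟨0|^C`, arranged as `(A^n × C) × B^n`. -/
def inputState (ρ : Matrix (α × β) (α × β) ℂ) {n : ℕ} (Pr : Protocol α β n) :
    Matrix (((Fin n → α) × Fin Pr.dC) × (Fin n → β))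
      (((Fin n → α) × Fin Pr.dC) × (Fin n → β)) ℂ :=
  Matrix.reindex (swapE (Fin n → α) (Fin n → β) (Fin Pr.dC))
    (swapE (Fin n → α) (Fin n → β) (Fin Pr.dC)) (tpowAB ρ n ⊗ₖ pureZero Pr.dC)

/-- The state `U_A((ρ^{AB})^{⊗n} ⊗ |0⟩⟨0|^C)` (before dephasing), on
`((A_p × Y) × A_g) × B^n`. -/
def stateAfterUA (ρ : Matrix (α × β) (α × β) ℂ) {n : ℕ} (Pr : Protocol α β n) :
    Matrix (((Fin Pr.dAp × Fin Pr.dY) × Fin Pr.dAg) × (Fin n → β))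
      (((Fin Pr.dAp × Fin Pr.dY) × Fin Pr.dAg) × (Fin n → β)) ℂ :=
  (Pr.UA ⊗ₖ (1 : Matrix (Fin n → β) (Fin n → β) ℂ)) * inputState ρ Pr *
    (Pr.UA ⊗ₖ (1 : Matrix (Fin n → β) (Fin n → β) ℂ))ᴴ

/-- Dephase the first tensor factor in a fixed basis. -/
def dephaseFst {κ γ : Type*} [DecidableEq κ] (ρ : Matrix (κ × γ) (κ × γ) ℂ) :
    Matrix (κ × γ) (κ × γ) ℂ :=
  fun p q => if p.1 = q.1 then ρ p q else 0

/-- The state after Alice's unitary and the dephasing channel on `Y`. -/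
def stateAfterDephasing (ρ : Matrix (α × β) (α × β) ℂ) {n : ℕ} (Pr : Protocol α β n) :
    Matrix (((Fin Pr.dAp × Fin Pr.dY) × Fin Pr.dAg) × (Fin n → β))
      (((Fin Pr.dAp × Fin Pr.dY) × Fin Pr.dAg) × (Fin n → β)) ℂ :=
  Matrix.reindex (pullY (Fin Pr.dAp) (Fin Pr.dY) (Fin Pr.dAg) (Fin n → β)).symm
    (pullY (Fin Pr.dAp) (Fin Pr.dY) (Fin Pr.dAg) (Fin n → β)).symm
    (dephaseFst (Matrix.reindex (pullY (Fin Pr.dAp) (Fin Pr.dY) (Fin Pr.dAg) (Fin n → β))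
      (pullY (Fin Pr.dAp) (Fin Pr.dY) (Fin Pr.dAg) (Fin n → β)) (stateAfterUA ρ Pr)))

/-- The final state `Υ`, after Bob's unitary, on `(B_p × B_g) × (A_p × A_g)`. -/
def stateAfterUB (ρ : Matrix (α × β) (α × β) ℂ) {n : ℕ} (Pr : Protocol α β n) :
    Matrix ((Fin Pr.dBp × Fin Pr.dBg) × (Fin Pr.dAp × Fin Pr.dAg))
      ((Fin Pr.dBp × Fin Pr.dBg) × (Fin Pr.dAp × Fin Pr.dAg)) ℂ :=
  (Pr.UB ⊗ₖ (1 : Matrix (Fin Pr.dAp × Fin Pr.dAg) (Fin Pr.dAp × Fin Pr.dAg) ℂ)) *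
    Matrix.reindex (pullBY (Fin Pr.dAp) (Fin Pr.dY) (Fin Pr.dAg) (Fin n → β))
      (pullBY (Fin Pr.dAp) (Fin Pr.dY) (Fin Pr.dAg) (Fin n → β)) (stateAfterDephasing ρ Pr) *
    (Pr.UB ⊗ₖ (1 : Matrix (Fin Pr.dAp × Fin Pr.dAg) (Fin Pr.dAp × Fin Pr.dAg) ℂ))ᴴ

/-- The reduced output state `Υ^{A_p B_p}`. -/
def outputReduced (ρ : Matrix (α × β) (α × β) ℂ) {n : ℕ} (Pr : Protocol α β n) :
    Matrix (Fin Pr.dAp × Fin Pr.dBp) (Fin Pr.dAp × Fin Pr.dBp) ℂ :=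
  ptraceRight (Matrix.reindex
    (sortOut (Fin Pr.dBp) (Fin Pr.dBg) (Fin Pr.dAp) (Fin Pr.dAg))
    (sortOut (Fin Pr.dBp) (Fin Pr.dBg) (Fin Pr.dAp) (Fin Pr.dAg)) (stateAfterUB ρ Pr))

/-- The error of a protocol: trace distance of `Υ^{A_p B_p}` from `|0⟩⟨0| ⊗ |0⟩⟨0|`. -/
def protocolError (ρ : Matrix (α × β) (α × β) ℂ) {n : ℕ} (Pr : Protocol α β n) : ℝ :=
  traceNorm (outputReduced ρ Pr - pureZero Pr.dAp ⊗ₖ pureZero Pr.dBp)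

/-- The classical communication rate `(1/n) log d_Y` of a protocol. -/
def commRate {n : ℕ} (Pr : Protocol α β n) : ℝ := Real.log Pr.dY / n

/-- The purity rate `(1/n)(log d_{A_p}d_{B_p} - log d_C)` of a protocol. -/
def purityRate {n : ℕ} (Pr : Protocol α β n) : ℝ :=
  (Real.log (Pr.dAp * Pr.dBp) - Real.log Pr.dC) / n

/-- Achievability of a rate pair `(P, R)`: for all `ε, δ > 0` and all sufficiently large `n`
there is an `(n, R+δ, P-δ, ε)` protocol. -/
def Achievable (ρ : Matrix (α × β) (α × β) ℂ) (P R : ℝ) : Prop :=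
  ∀ ε > (0 : ℝ), ∀ δ > (0 : ℝ), ∃ N : ℕ, ∀ n ≥ N, ∃ Pr : Protocol α β n,
    commRate Pr ≤ R + δ ∧ P - δ ≤ purityRate Pr ∧ protocolError ρ Pr ≤ ε

/-- The 1-way distillable local purity `κ_→(ρ^{AB}, R)`. -/
def kappaArrow (ρ : Matrix (α × β) (α × β) ℂ) (R : ℝ) : ℝ :=
  sSup { P : ℝ | Achievable ρ P R }

/-- `I(Y;B^n)` on the pre-dephasing state `U_A((ρ^{AB})^{⊗n} ⊗ |0⟩⟨0|^C)`. -/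
def preDephIYB (ρ : Matrix (α × β) (α × β) ℂ) {n : ℕ} (Pr : Protocol α β n) : ℝ :=
  mutualInfo (ptraceRight (Matrix.reindex
    (pullYB (Fin Pr.dAp) (Fin Pr.dY) (Fin Pr.dAg) (Fin n → β))
    (pullYB (Fin Pr.dAp) (Fin Pr.dY) (Fin Pr.dAg) (Fin n → β)) (stateAfterUA ρ Pr)))

/-- The pre-dephasing state together with the purifying environment `E^n`:
`(U_A ⊗ 1^{B^nE^n})((Ψ^{ABE})^{⊗n} ⊗ |0⟩⟨0|^C)`, where `Ψ` is the canonical purification. -/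
def preDephWithEnv (ρ : Matrix (α × β) (α × β) ℂ) {n : ℕ} (Pr : Protocol α β n) :
    Matrix (((Fin Pr.dAp × Fin Pr.dY) × Fin Pr.dAg) × (Fin n → β × (α × β)))
      (((Fin Pr.dAp × Fin Pr.dY) × Fin Pr.dAg) × (Fin n → β × (α × β))) ℂ :=
  (Pr.UA ⊗ₖ (1 : Matrix (Fin n → β × (α × β)) (Fin n → β × (α × β)) ℂ)) *
    Matrix.reindex (swapE (Fin n → α) (Fin n → β × (α × β)) (Fin Pr.dC))
      (swapE (Fin n → α) (Fin n → β × (α × β)) (Fin Pr.dC))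
      (tpowAB (purifyAssoc ρ) n ⊗ₖ pureZero Pr.dC) *
    (Pr.UA ⊗ₖ (1 : Matrix (Fin n → β × (α × β)) (Fin n → β × (α × β)) ℂ))ᴴ

/-- `I(Y;B^nE^n)` on the pre-dephasing state, including the purifying environment. -/
def preDephIYBE (ρ : Matrix (α × β) (α × β) ℂ) {n : ℕ} (Pr : Protocol α β n) : ℝ :=
  mutualInfo (ptraceRight (Matrix.reindex
    (pullYB (Fin Pr.dAp) (Fin Pr.dY) (Fin Pr.dAg) (Fin n → β × (α × β)))
    (pullYB (Fin Pr.dAp) (Fin Pr.dY) (Fin Pr.dAg) (Fin n → β × (α × β)))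
    (preDephWithEnv ρ Pr)))

/-- `H(Y)` on the pre-dephasing state. -/
def preDephHY (ρ : Matrix (α × β) (α × β) ℂ) {n : ℕ} (Pr : Protocol α β n) : ℝ :=
  entropy (ptraceRight (Matrix.reindex
    (pullY (Fin Pr.dAp) (Fin Pr.dY) (Fin Pr.dAg) (Fin n → β))
    (pullY (Fin Pr.dAp) (Fin Pr.dY) (Fin Pr.dAg) (Fin n → β)) (stateAfterUA ρ Pr)))

/-! ### Single-party purity concentration -/

/-- An `(n, ·, ·)` purity concentration protocol: a unitary
`U : H_{A^n} → H_{A_p} ⊗ H_{A_g}`. -/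
structure ConcProtocol (α : Type*) [Fintype α] [DecidableEq α] (n : ℕ) where
  dAp : ℕ
  dAg : ℕ
  dAp_pos : 0 < dAp
  dAg_pos : 0 < dAg
  U : Matrix (Fin dAp × Fin dAg) (Fin n → α) ℂ
  U_unitary : Uᴴ * U = 1 ∧ U * Uᴴ = 1

/-- The reduced state `Υ^{A_p}` of `U ρ^{⊗n} U†`. -/
def concOutput {α : Type*} [Fintype α] [DecidableEq α] (ρ : Matrix α α ℂ) {n : ℕ}
    (Pr : ConcProtocol α n) : Matrix (Fin Pr.dAp) (Fin Pr.dAp) ℂ :=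
  ptraceRight (Pr.U * tpow ρ n * Pr.Uᴴ)

/-- Achievability of a purity-concentration rate `P`. -/
def ConcAchievable {α : Type*} [Fintype α] [DecidableEq α] (ρ : Matrix α α ℂ) (P : ℝ) :
    Prop :=
  ∀ ε > (0 : ℝ), ∀ δ > (0 : ℝ), ∃ N : ℕ, ∀ n ≥ N, ∃ Pr : ConcProtocol α n,
    P - δ ≤ Real.log Pr.dAp / n ∧ traceNorm (concOutput ρ Pr - pureZero Pr.dAp) ≤ ε

/-- The purity `κ(ρ)`: the supremum of all achievable concentration rates. -/
def kappaConc {α : Type*} [Fintype α] [DecidableEq α] (ρ : Matrix α α ℂ) : ℝ :=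
  sSup { P : ℝ | ConcAchievable ρ P }

/-! ### Measurement compression -/

/-- The averaged compressed-measurement map
`σ ↦ (1/|L|) Σ_l Σ_m Tr(Λ̃^{(l)}_m σ) |f(m,l)⟩⟨f(m,l)|`, applied to the first factor. -/
def mcMap {A Ω γ' : Type*} [Fintype A] [DecidableEq A] [Fintype Ω] [DecidableEq Ω]
    (L M : ℕ) (Λt : Fin L → POVM A (Fin M)) (f : Fin M → Fin L → Ω)
    (ρ : Matrix (A × γ') (A × γ') ℂ) : Matrix (Ω × γ') (Ω × γ') ℂ :=
  fun p q => (L : ℂ)⁻¹ * ∑ l, ∑ m, (if f m l = p.1 ∧ f m l = q.1 then 1 else 0) *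
    ∑ a, ∑ a', ((Λt l).elem m) a a' * ρ (a', p.2) (a, q.2)

/-! ### Classical-quantum states and classical channels -/

/-- The classical-quantum state `Σ_x p(x) |x⟩⟨x| ⊗ ρ_x`. -/
def cqState {𝒳 B : Type*} [DecidableEq 𝒳] (p : 𝒳 → ℝ) (ρx : 𝒳 → Matrix B B ℂ) :
    Matrix (𝒳 × B) (𝒳 × B) ℂ :=
  fun P Q => if P.1 = Q.1 then (p P.1 : ℂ) * ρx P.1 P.2 Q.2 else 0

/-- The state on `Y × (X × W)` obtained from a purification vector `ψ` of a cq state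
(with classical system `X` and the rest `W`) by applying a classical channel `q(y|x)`
to the classical system: `Σ_{x,y} q(y|x) |y⟩⟨y| ⊗ |x⟩⟨x|-block of p(x)·(BE state given x)`. -/
def chanState {𝒳 W 𝒴 : Type*} [DecidableEq 𝒳] [DecidableEq 𝒴]
    (ψ : 𝒳 × W → ℂ) (q : 𝒳 → 𝒴 → ℝ) :
    Matrix (𝒴 × (𝒳 × W)) (𝒴 × (𝒳 × W)) ℂ :=
  fun P Q => if P.1 = Q.1 ∧ P.2.1 = Q.2.1
    then (q P.2.1 P.1 : ℂ) * ψ P.2 * star (ψ Q.2) else 0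

/-- The `n`-fold tensor power of a purification vector of a cq state, with the
classical, `B` and `E` registers collected. -/
def vecPowBE {𝒳 B E : Type*} (ψ : 𝒳 × (B × E) → ℂ) (n : ℕ) :
    (Fin n → 𝒳) × ((Fin n → B) × (Fin n → E)) → ℂ :=
  fun xw => ∏ k, ψ (xw.1 k, (xw.2.1 k, xw.2.2 k))

variable {𝒴' 𝒳 B E : Type*} [Fintype 𝒴'] [DecidableEq 𝒴'] [Fintype 𝒳] [DecidableEq 𝒳]
  [Fintype B] [DecidableEq B] [Fintype E] [DecidableEq E]

/-- `I(Y;B)` on a state of the form `τ^{Y(X(BE))}`. -/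
def miYB (τ : Matrix (𝒴' × (𝒳 × (B × E))) (𝒴' × (𝒳 × (B × E))) ℂ) : ℝ :=
  mutualInfo (ptraceRight (Matrix.reindex (exYB 𝒴' 𝒳 B E) (exYB 𝒴' 𝒳 B E) τ))

/-- `I(Y;BE)` on a state of the form `τ^{Y(X(BE))}`. -/
def miYBE (τ : Matrix (𝒴' × (𝒳 × (B × E))) (𝒴' × (𝒳 × (B × E))) ℂ) : ℝ :=
  mutualInfo (ptraceRight (Matrix.reindex (exYW 𝒴' 𝒳 (B × E)) (exYW 𝒴' 𝒳 (B × E)) τ))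

/-- `I(Y;X)` on a state of the form `τ^{Y(X(BE))}`. -/
def miYX (τ : Matrix (𝒴' × (𝒳 × (B × E))) (𝒴' × (𝒳 × (B × E))) ℂ) : ℝ :=
  mutualInfo (ptraceRight (Matrix.reindex (exYX 𝒴' 𝒳 (B × E)) (exYX 𝒴' 𝒳 (B × E)) τ))

/-- A classical channel: entrywise nonnegative with rows summing to one. -/
def IsChannel {X Y : Type*} [Fintype Y] (q : X → Y → ℝ) : Prop :=
  (∀ x y, 0 ≤ q x y) ∧ ∀ x, ∑ y, q x y = 1

/-- `P_n(R) = max_{Y|X^n} { (1/n) I(Y;B^n) : (1/n) I(Y;B^nE^n) ≤ R }` for a cq state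
with purification vector `ψ`. -/
def Pn (ψ : 𝒳 × (B × E) → ℂ) (n : ℕ) (R : ℝ) : ℝ :=
  sSup { v : ℝ | ∃ (m : ℕ) (q : (Fin n → 𝒳) → Fin m → ℝ), IsChannel q ∧
    (1 / n : ℝ) * miYBE (chanState (vecPowBE ψ n) q) ≤ R ∧
    v = (1 / n : ℝ) * miYB (chanState (vecPowBE ψ n) q) }

/-- `D_n(R) = max_{Y|X^n} { (1/n) I(Y;B^n) : (1/n)(I(Y;X^n) - I(Y;B^n)) ≤ R }` for a cq
state with purification vector `ψ`. -/
def Dn (ψ : 𝒳 × (B × E) → ℂ) (n : ℕ) (R : ℝ) : ℝ :=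
  sSup { v : ℝ | ∃ (m : ℕ) (q : (Fin n → 𝒳) → Fin m → ℝ), IsChannel q ∧
    (1 / n : ℝ) * (miYX (chanState (vecPowBE ψ n) q)
      - miYB (chanState (vecPowBE ψ n) q)) ≤ R ∧
    v = (1 / n : ℝ) * miYB (chanState (vecPowBE ψ n) q) }

/-! ### Quantum channels -/

/-- A completely positive trace-preserving map between matrix algebras. -/
structure CPTP (ι κ : Type*) [Fintype ι] [DecidableEq ι] [Fintype κ] [DecidableEq κ] where
  map : Matrix ι ι ℂ →ₗ[ℂ] Matrix κ κ ℂ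
  trace_preserving : ∀ ρ, (map ρ).trace = ρ.trace
  completely_positive : ∀ (n : ℕ) (ρ : Matrix (ι × Fin n) (ι × Fin n) ℂ), ρ.PosSemidef →
    (Matrix.of fun p q : κ × Fin n =>
      map (Matrix.of fun i i' => ρ (i, p.2) (i', q.2)) p.1 q.1).PosSemidef

lemma entropy_eq_sum {ι : Type*} [Fintype ι] [DecidableEq ι] {M : Matrix ι ι ℂ}
    (h : M.IsHermitian) : entropy M = ∑ i, Real.negMulLog (h.eigenvalues i) := by
  unfold entropy
  rw [dif_pos h, ← sum_neg_distrib]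
  exact sum_congr rfl fun i _ => by rw [Real.negMulLog]; ring

lemma entropy_eq_roots {ι : Type*} [Fintype ι] [DecidableEq ι] {M : Matrix ι ι ℂ}
    (h : M.IsHermitian) :
    entropy M = (M.charpoly.roots.map (fun z => Real.negMulLog z.re)).sum := by
  rw [entropy_eq_sum h, h.roots_charpoly_eq_eigenvalues]
  rw [Multiset.map_map]
  rfl

lemma entropy_of_charpoly {ι κ : Type*} [Fintype ι] [DecidableEq ι] [Fintype κ] [DecidableEq κ]
    {M : Matrix ι ι ℂ} {N : Matrix κ κ ℂ} (hM : M.IsHermitian) (hN : N.IsHermitian) (a b : ℕ)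
    (h : Polynomial.X ^ a * M.charpoly = Polynomial.X ^ b * N.charpoly) :
    entropy M = entropy N := by
  rw [entropy_eq_roots hM, entropy_eq_roots hN]
  have key : ∀ (p : Polynomial ℂ) (k : ℕ), p ≠ 0 →
      (((Polynomial.X ^ k * p).roots).map (fun z : ℂ => Real.negMulLog z.re)).sum
        = (p.roots.map (fun z => Real.negMulLog z.re)).sum := by
    intro p k hp
    rw [Polynomial.roots_mul (mul_ne_zero (pow_ne_zero _ Polynomial.X_ne_zero) hp)]
    simp [Polynomial.roots_pow, Multiset.map_nsmul, Multiset.sum_nsmul]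
  rw [← key M.charpoly a (charpoly_monic M).ne_zero, h, key N.charpoly b (charpoly_monic N).ne_zero]

lemma entropy_mul_comm {ι κ : Type*} [Fintype ι] [DecidableEq ι] [Fintype κ] [DecidableEq κ]
    (C : Matrix ι κ ℂ) (D : Matrix κ ι ℂ) (h1 : (C * D).IsHermitian) (h2 : (D * C).IsHermitian) :
    entropy (C * D) = entropy (D * C) :=
  entropy_of_charpoly h1 h2 _ _ (charpoly_mul_comm' C D)

lemma entropy_conj_comm {ι κ : Type*} [Fintype ι] [DecidableEq ι] [Fintype κ] [DecidableEq κ]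
    (C : Matrix ι κ ℂ) : entropy (Cᴴ * C) = entropy (C * Cᴴ) :=
  entropy_mul_comm _ _ (isHermitian_conjTranspose_mul_self C) (isHermitian_mul_conjTranspose_self C)

lemma entropy_transpose {ι : Type*} [Fintype ι] [DecidableEq ι] {M : Matrix ι ι ℂ}
    (h : M.IsHermitian) : entropy Mᵀ = entropy M :=
  entropy_of_charpoly h.transpose h 0 0 (by rw [charpoly_transpose])

lemma entropy_reindex {ι κ : Type*} [Fintype ι] [DecidableEq ι] [Fintype κ] [DecidableEq κ]
    (e : ι ≃ κ) {M : Matrix ι ι ℂ} (h : M.IsHermitian) :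
    entropy (Matrix.reindex e e M) = entropy M :=
  entropy_of_charpoly (by simpa using h.submatrix e.symm) h 0 0 (by rw [charpoly_reindex])

lemma entropy_submatrix {ι κ : Type*} [Fintype ι] [DecidableEq ι] [Fintype κ] [DecidableEq κ]
    (e : κ ≃ ι) {M : Matrix ι ι ℂ} (h : M.IsHermitian) :
    entropy (M.submatrix e e) = entropy M := by
  have := entropy_reindex e.symm h
  simpa using this

lemma rdiag_herm {ι : Type*} [DecidableEq ι] (d : ι → ℝ) :
    (diagonal (fun i => (d i : ℂ))).IsHermitian := by
  rw [Matrix.IsHermitian, diagonal_conjTranspose]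
  congr 1; ext i; simp

lemma entropy_diagonal {ι : Type*} [Fintype ι] [DecidableEq ι] (d : ι → ℝ) :
    entropy (diagonal (fun i => (d i : ℂ))) = ∑ i, Real.negMulLog (d i) := by
  rw [entropy_eq_roots (rdiag_herm d), charpoly_diagonal, Polynomial.roots_prod _ _
    (prod_ne_zero_iff.mpr fun i _ => Polynomial.X_sub_C_ne_zero _)]
  simp

lemma entropy_diag {ι κ : Type*} [Fintype ι] [DecidableEq ι] [Fintype κ] [DecidableEq κ]
    (U : Matrix κ ι ℂ) (hU : Uᴴ * U = 1) (d : ι → ℝ) :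
    entropy (U * diagonal (fun i => (d i : ℂ)) * Uᴴ) = ∑ i, Real.negMulLog (d i) := by
  rw [← entropy_diagonal, Matrix.mul_assoc, entropy_mul_comm]
  · rw [Matrix.mul_assoc, hU, Matrix.mul_one]
  · rw [← Matrix.mul_assoc]; exact isHermitian_mul_mul_conjTranspose U (rdiag_herm d)
  · rw [Matrix.mul_assoc, hU, Matrix.mul_one]; exact rdiag_herm d

lemma psd_diag {ι : Type*} [Fintype ι] [DecidableEq ι] {M : Matrix ι ι ℂ} (h : M.PosSemidef) :
    ∃ (U : Matrix ι ι ℂ) (d : ι → ℝ), Uᴴ * U = 1 ∧ U * Uᴴ = 1 ∧ (∀ i, 0 ≤ d i) ∧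
      M = U * diagonal (fun i => (d i : ℂ)) * Uᴴ := by
  refine ⟨h.1.eigenvectorUnitary, h.1.eigenvalues, ?_, ?_, h.eigenvalues_nonneg, ?_⟩
  · exact Unitary.coe_star_mul_self _
  · exact Unitary.coe_mul_star_self _
  · exact h.1.spectral_theorem

lemma herm_diag {ι : Type*} [Fintype ι] [DecidableEq ι] {M : Matrix ι ι ℂ} (h : M.IsHermitian) :
    ∃ (U : Matrix ι ι ℂ) (d : ι → ℝ), Uᴴ * U = 1 ∧ U * Uᴴ = 1 ∧
      M = U * diagonal (fun i => (d i : ℂ)) * Uᴴ := by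
  refine ⟨h.eigenvectorUnitary, h.eigenvalues, ?_, ?_, ?_⟩
  · exact Unitary.coe_star_mul_self _
  · exact Unitary.coe_mul_star_self _
  · exact h.spectral_theorem

lemma sum_negMulLog_le {ι : Type*} [Fintype ι] (d : ι → ℝ) (hd : ∀ i, 0 ≤ d i) :
    ∑ i, Real.negMulLog (d i) ≤ (∑ i, d i) * Real.log (Fintype.card ι)
      + Real.negMulLog (∑ i, d i) := by
  rcases isEmpty_or_nonempty ι with h | h
  · simp
  · have hn : (0 : ℝ) < Fintype.card ι := by exact_mod_cast Fintype.card_pos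
    have := Real.concaveOn_negMulLog.le_map_sum (t := univ)
      (w := fun _ : ι => (Fintype.card ι : ℝ)⁻¹) (p := d) (fun i _ => by positivity)
      (by simp [hn.ne']) (fun i _ => hd i)
    simp only [smul_eq_mul, ← mul_sum] at this
    rw [inv_mul_le_iff₀ hn] at this
    refine this.trans (le_of_eq ?_)
    rcases eq_or_ne (∑ i, d i) 0 with h0 | h0
    · simp [h0]
    · rw [Real.negMulLog, Real.negMulLog, Real.log_mul (by positivity) h0, Real.log_inv]
      field_simp
      ring

lemma le_sum_negMulLog {ι : Type*} [Fintype ι] (d : ι → ℝ) (hd : ∀ i, 0 ≤ d i) :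
    Real.negMulLog (∑ i, d i) ≤ ∑ i, Real.negMulLog (d i) := by
  rw [Real.negMulLog, ← sum_neg_distrib, sum_mul]
  refine sum_le_sum fun i _ => ?_
  rw [Real.negMulLog]
  rcases (hd i).eq_or_lt with h | h
  · rw [← h]; simp
  · have : d i ≤ ∑ i, d i := single_le_sum (fun i _ => hd i) (mem_univ i)
    have := Real.log_le_log h this
    nlinarith

lemma diag_conj {ι κ : Type*} [Fintype ι] [DecidableEq ι] (U : Matrix κ ι ℂ) (d : ι → ℝ) (i j : κ) :
    (U * diagonal (fun i => (d i : ℂ)) * Uᴴ) i j = ∑ k, (d k : ℂ) * (U i k * star (U j k)) := by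
  rw [Matrix.mul_apply]
  refine sum_congr rfl fun k _ => ?_
  rw [Matrix.mul_diagonal, conjTranspose_apply]; ring

lemma diag_conj_re {ι κ : Type*} [Fintype ι] [DecidableEq ι] (U : Matrix κ ι ℂ) (d : ι → ℝ) (i : κ) :
    ((U * diagonal (fun i => (d i : ℂ)) * Uᴴ) i i).re = ∑ k, Complex.normSq (U i k) * d k := by
  rw [diag_conj, Complex.re_sum]
  refine sum_congr rfl fun k _ => ?_
  rw [Complex.star_def, Complex.mul_conj]
  rw [← Complex.ofReal_mul, Complex.ofReal_re]; ring

lemma unitary_row {ι κ : Type*} [Fintype ι] [DecidableEq κ] {U : Matrix κ ι ℂ} (h : U * Uᴴ = 1) (i : κ) :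
    ∑ k, Complex.normSq (U i k) = 1 := by
  have := congrFun (congrFun h i) i
  rw [Matrix.mul_apply, one_apply_eq] at this
  have h2 := congrArg Complex.re this
  rw [Complex.re_sum, Complex.one_re] at h2
  rw [← h2]
  refine sum_congr rfl fun k _ => ?_
  rw [conjTranspose_apply, Complex.star_def, Complex.mul_conj, Complex.ofReal_re]

lemma unitary_col {ι κ : Type*} [Fintype κ] [DecidableEq ι] {U : Matrix κ ι ℂ} (h : Uᴴ * U = 1) (i : ι) :
    ∑ k, Complex.normSq (U k i) = 1 := by
  have := unitary_row (U := Uᴴ) (by rwa [conjTranspose_conjTranspose]) i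
  rw [← this]
  refine sum_congr rfl fun k _ => ?_
  rw [conjTranspose_apply, Complex.star_def, Complex.normSq_conj]

lemma entropy_le_diag {ι : Type*} [Fintype ι] [DecidableEq ι] {M : Matrix ι ι ℂ}
    (h : M.PosSemidef) : entropy M ≤ ∑ i, Real.negMulLog (M i i).re := by
  obtain ⟨U, d, h1, h2, h3, rfl⟩ := psd_diag h
  rw [entropy_diag U h1]
  simp_rw [diag_conj_re]
  have key : ∀ i, ∑ k, Complex.normSq (U i k) * Real.negMulLog (d k) ≤
      Real.negMulLog (∑ k, Complex.normSq (U i k) * d k) := by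
    intro i
    have := Real.concaveOn_negMulLog.le_map_sum (t := univ)
      (w := fun k => Complex.normSq (U i k)) (p := d) (fun i _ => Complex.normSq_nonneg _)
      (unitary_row h2 i) (fun i _ => h3 i)
    simpa using this
  refine le_trans (le_of_eq ?_) (sum_le_sum fun i _ => key i)
  rw [sum_comm]
  refine sum_congr rfl fun k _ => ?_
  rw [← sum_mul, unitary_col h1, one_mul]

lemma trace_diag {ι κ : Type*} [Fintype ι] [DecidableEq ι] [Fintype κ]
    (U : Matrix κ ι ℂ) (hU : Uᴴ * U = 1) (d : ι → ℝ) :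
    (U * diagonal (fun i => (d i : ℂ)) * Uᴴ).trace.re = ∑ i, d i := by
  rw [Matrix.mul_assoc, Matrix.trace_mul_comm, Matrix.mul_assoc, hU, Matrix.mul_one, trace_diagonal]
  simp

lemma entropy_le_log {ι : Type*} [Fintype ι] [DecidableEq ι] {M : Matrix ι ι ℂ}
    (h : M.PosSemidef) : entropy M ≤ M.trace.re * Real.log (Fintype.card ι)
      + Real.negMulLog M.trace.re := by
  obtain ⟨U, d, h1, h2, h3, rfl⟩ := psd_diag h
  rw [entropy_diag U h1, trace_diag U h1]
  exact sum_negMulLog_le d h3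

lemma le_entropy {ι : Type*} [Fintype ι] [DecidableEq ι] {M : Matrix ι ι ℂ}
    (h : M.PosSemidef) : Real.negMulLog M.trace.re ≤ entropy M := by
  obtain ⟨U, d, h1, h2, h3, rfl⟩ := psd_diag h
  rw [entropy_diag U h1, trace_diag U h1]
  exact le_sum_negMulLog d h3

def blk {κ γ : Type*} [DecidableEq κ] (M : κ → Matrix γ γ ℂ) : Matrix (κ × γ) (κ × γ) ℂ :=
  fun p q => if p.1 = q.1 then M p.1 p.2 q.2 else 0

lemma blk_mul {κ γ : Type*} [DecidableEq κ] [Fintype κ] [Fintype γ] (M N : κ → Matrix γ γ ℂ) :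
    blk M * blk N = blk (fun x => M x * N x) := by
  ext ⟨x, i⟩ ⟨y, j⟩
  simp only [Matrix.mul_apply, blk, Fintype.sum_prod_type]
  by_cases h : x = y
  · subst h; simp
  · simp [h]

lemma blk_conjTranspose {κ γ : Type*} [DecidableEq κ] (M : κ → Matrix γ γ ℂ) :
    (blk M)ᴴ = blk (fun x => (M x)ᴴ) := by
  ext ⟨x, i⟩ ⟨y, j⟩
  simp only [conjTranspose_apply, blk]
  by_cases h : x = y
  · subst h; simp
  · simp [h, Ne.symm h]

lemma blk_one {κ γ : Type*} [DecidableEq κ] [DecidableEq γ] :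
    blk (fun _ : κ => (1 : Matrix γ γ ℂ)) = 1 := by
  ext ⟨x, i⟩ ⟨y, j⟩
  simp only [blk, Matrix.one_apply, Prod.mk.injEq]
  by_cases h : x = y <;> simp [h]

lemma blk_diagonal {κ γ : Type*} [DecidableEq κ] [DecidableEq γ] (d : κ → γ → ℂ) :
    blk (fun x => diagonal (d x)) = diagonal (fun p => d p.1 p.2) := by
  ext ⟨x, i⟩ ⟨y, j⟩
  simp only [blk, Matrix.diagonal_apply, Prod.mk.injEq]
  by_cases h : x = y <;> simp [h]

lemma entropy_blk {κ γ : Type*} [DecidableEq κ] [DecidableEq γ] [Fintype κ] [Fintype γ]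
    {M : κ → Matrix γ γ ℂ} (h : ∀ x, (M x).IsHermitian) :
    entropy (blk M) = ∑ x, entropy (M x) := by
  choose U d h1 h2 h3 using fun x => herm_diag (h x)
  have : blk M = blk U * diagonal (fun p : κ × γ => ((d p.1 p.2 : ℝ) : ℂ)) * (blk U)ᴴ := by
    rw [← blk_diagonal (fun x i => (d x i : ℂ)), blk_conjTranspose, blk_mul, blk_mul]
    congr 1; ext1 x; exact h3 x
  rw [this, entropy_diag _ (by rw [blk_conjTranspose, blk_mul]; simp_rw [h1]; exact blk_one)
    (fun p : κ × γ => d p.1 p.2), Fintype.sum_prod_type]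
  refine sum_congr rfl fun x _ => ?_
  rw [h3 x, entropy_diag _ (h1 x)]

lemma entropy_sum_le {κ γ : Type*} [DecidableEq κ] [DecidableEq γ] [Fintype κ] [Fintype γ]
    {M : κ → Matrix γ γ ℂ} (h : ∀ x, (M x).PosSemidef) :
    entropy (∑ x, M x) ≤ ∑ x, entropy (M x) := by
  choose U d h1 h2 h3 h4 using fun x => psd_diag (h x)
  let C : Matrix (κ × γ) γ ℂ := fun p j => (Real.sqrt (d p.1 p.2) : ℂ) * star (U p.1 j p.2)
  have hC : Cᴴ * C = ∑ x, M x := by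
    ext i j
    rw [Matrix.mul_apply, Fintype.sum_prod_type, Matrix.sum_apply]
    refine sum_congr rfl fun x _ => ?_
    rw [h4 x, diag_conj]
    refine sum_congr rfl fun k _ => ?_
    have : (d x k : ℂ) = (Real.sqrt (d x k) : ℂ) * (Real.sqrt (d x k) : ℂ) := by
      rw [← Complex.ofReal_mul, Real.mul_self_sqrt (h3 x k)]
    rw [conjTranspose_apply, this]
    simp only [C, star_mul', Complex.star_def, Complex.conj_ofReal, Complex.conj_conj]
    ring
  rw [← hC, entropy_conj_comm]
  refine (entropy_le_diag (posSemidef_self_mul_conjTranspose C)).trans (le_of_eq ?_)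
  rw [Fintype.sum_prod_type]
  refine sum_congr rfl fun x _ => ?_
  rw [h4 x, entropy_diag _ (h1 x)]
  refine sum_congr rfl fun k _ => ?_
  congr 1
  rw [Matrix.mul_apply, Complex.re_sum]
  have : ∀ j, (C (x, k) j * Cᴴ j (x, k)).re = d x k * Complex.normSq (U x j k) := by
    intro j
    rw [conjTranspose_apply, Complex.star_def, Complex.mul_conj, Complex.ofReal_re]
    simp only [C, Complex.normSq_mul, Complex.normSq_ofReal, Complex.star_def, Complex.normSq_conj]
    rw [Real.mul_self_sqrt (h3 x k)]
  simp_rw [this]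
  rw [← mul_sum, unitary_col (h1 x), mul_one]

lemma entropy_add_le {γ : Type*} [DecidableEq γ] [Fintype γ]
    {M N : Matrix γ γ ℂ} (hM : M.PosSemidef) (hN : N.PosSemidef) :
    entropy (M + N) ≤ entropy M + entropy N := by
  have := entropy_sum_le (M := fun b : Bool => if b then M else N)
    (by intro b; cases b <;> simpa)
  simpa using this

lemma entropy_kron {ι κ : Type*} [DecidableEq κ] [DecidableEq ι] [Fintype κ] [Fintype ι]
    {M : Matrix ι ι ℂ} {N : Matrix κ κ ℂ} (hM : M.PosSemidef) (hN : N.PosSemidef) :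
    entropy (M ⊗ₖ N) = N.trace.re * entropy M + M.trace.re * entropy N := by
  obtain ⟨U, d, h1, h2, h3, rfl⟩ := psd_diag hM
  obtain ⟨V, e, g1, g2, g3, rfl⟩ := psd_diag hN
  rw [entropy_diag U h1, entropy_diag V g1, trace_diag U h1, trace_diag V g1]
  have : (U * diagonal (fun i => (d i : ℂ)) * Uᴴ) ⊗ₖ (V * diagonal (fun i => (e i : ℂ)) * Vᴴ)
     = (U ⊗ₖ V) * diagonal (fun p : ι × κ => ((d p.1 * e p.2 : ℝ) : ℂ)) * (U ⊗ₖ V)ᴴ := by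
    rw [mul_kronecker_mul, mul_kronecker_mul, conjTranspose_kronecker, diagonal_kronecker_diagonal]
    simp
  rw [this, entropy_diag _ (by rw [conjTranspose_kronecker, ← mul_kronecker_mul, h1, g1, one_kronecker_one])
    (fun p : ι × κ => d p.1 * e p.2), Fintype.sum_prod_type]
  simp_rw [Real.negMulLog_mul, sum_add_distrib, ← mul_sum, ← sum_mul]
  ring_nf
  rw [← mul_sum]

def condB {a b : Type*} [Fintype a] (ρ : Matrix (a × b) (a × b) ℂ) (L : Matrix a a ℂ) :
    Matrix b b ℂ := fun i j => ∑ x, ∑ x', L x x' * ρ (x', i) (x, j)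

lemma condB_sum {a b κ : Type*} [Fintype a] [Fintype κ] (ρ : Matrix (a × b) (a × b) ℂ)
    (L : κ → Matrix a a ℂ) : condB ρ (∑ k, L k) = ∑ k, condB ρ (L k) := by
  ext i j
  simp only [condB, Matrix.sum_apply, sum_mul]
  conv_rhs => rw [sum_comm]
  refine sum_congr rfl fun x _ => ?_
  rw [sum_comm]

lemma condB_one {a b : Type*} [Fintype a] [DecidableEq a] (ρ : Matrix (a × b) (a × b) ℂ) :
    condB ρ 1 = ptraceLeft ρ := by
  ext i j
  simp [condB, ptraceLeft, Matrix.one_apply]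

lemma condB_trace {a b : Type*} [Fintype a] [Fintype b] (ρ : Matrix (a × b) (a × b) ℂ)
    (L : Matrix a a ℂ) : (condB ρ L).trace = (L * ptraceRight ρ).trace := by
  simp only [Matrix.trace, Matrix.diag, condB, Matrix.mul_apply, ptraceRight, mul_sum]
  rw [sum_comm]
  refine sum_congr rfl fun x _ => ?_
  rw [sum_comm]

lemma exists_factor {ι : Type*} [Fintype ι] [DecidableEq ι] {M : Matrix ι ι ℂ}
    (h : M.PosSemidef) : ∃ C : Matrix ι ι ℂ, M = Cᴴ * C := by
  obtain ⟨U, d, h1, h2, h3, rfl⟩ := psd_diag h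
  refine ⟨diagonal (fun i => (Real.sqrt (d i) : ℂ)) * Uᴴ, ?_⟩
  rw [conjTranspose_mul, conjTranspose_conjTranspose, (rdiag_herm _).eq, Matrix.mul_assoc,
    Matrix.mul_assoc, ← Matrix.mul_assoc (diagonal _) (diagonal _), diagonal_mul_diagonal]
  simp_rw [← Complex.ofReal_mul, Real.mul_self_sqrt (h3 _)]

lemma condB_psd {a b : Type*} [Fintype a] [DecidableEq a] [Fintype b] [DecidableEq b]
    {ρ : Matrix (a × b) (a × b) ℂ} (hρ : ρ.PosSemidef)
    {L : Matrix a a ℂ} (hL : L.PosSemidef) : (condB ρ L).PosSemidef := by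
  obtain ⟨C, rfl⟩ := exists_factor hL
  let W : a → Matrix b (a × b) ℂ := fun c => Matrix.of fun i p => if p.2 = i then C c p.1 else 0
  have hW : ∀ c i p, W c i p = if p.2 = i then C c p.1 else 0 := fun _ _ _ => rfl
  have : condB ρ (Cᴴ * C) = ∑ c, W c * ρ * (W c)ᴴ := by
    ext i j
    rw [Matrix.sum_apply]
    simp only [condB, Matrix.mul_apply, hW, conjTranspose_apply, Fintype.sum_prod_type, sum_mul]
    simp only [apply_ite star, star_zero, ite_mul, mul_ite, zero_mul, mul_zero]
    have e1 : ∀ x : a, ∑ x', ∑ c, star (C c x) * C c x' * ρ (x', i) (x, j)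
        = ∑ c, ∑ x', C c x' * ρ (x', i) (x, j) * star (C c x) := by
      intro x
      rw [sum_comm]
      exact sum_congr rfl fun c _ => sum_congr rfl fun x' _ => by ring
    rw [sum_congr rfl fun x _ => e1 x, sum_comm]
    refine sum_congr rfl fun y _ => sum_congr rfl fun x _ => ?_
    rw [sum_eq_single j (fun k _ hk => by simp [hk]) (by simp)]
    simp
  rw [this]
  exact posSemidef_sum _ fun c _ => hρ.mul_mul_conjTranspose_same _

lemma ptraceLeft_psd {a b : Type*} [Fintype a] [DecidableEq a] [Fintype b] [DecidableEq b]
    {ρ : Matrix (a × b) (a × b) ℂ} (hρ : ρ.PosSemidef) : (ptraceLeft ρ).PosSemidef := by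
  rw [← condB_one]; exact condB_psd hρ PosSemidef.one

lemma ptraceRight_psd {a b : Type*} [Fintype a] [DecidableEq a] [Fintype b] [DecidableEq b]
    {ρ : Matrix (a × b) (a × b) ℂ} (hρ : ρ.PosSemidef) : (ptraceRight ρ).PosSemidef := by
  have := ptraceLeft_psd (hρ.submatrix (Prod.swap : b × a → a × b))
  exact this

lemma ptraceRight_trace {a b : Type*} [Fintype a] [Fintype b]
    (ρ : Matrix (a × b) (a × b) ℂ) : (ptraceRight ρ).trace = ρ.trace := by
  simp only [Matrix.trace, Matrix.diag, ptraceRight, Fintype.sum_prod_type]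

lemma ptraceLeft_trace {a b : Type*} [Fintype a] [Fintype b]
    (ρ : Matrix (a × b) (a × b) ℂ) : (ptraceLeft ρ).trace = ρ.trace := by
  simp only [Matrix.trace, Matrix.diag, ptraceLeft, Fintype.sum_prod_type]
  rw [sum_comm]

def JB {a b κ : Type*} [Fintype a] [Fintype b] [DecidableEq b] [Fintype κ]
    (ρ : Matrix (a × b) (a × b) ℂ) (Λ : κ → Matrix a a ℂ) : ℝ :=
  entropy (ptraceLeft ρ) + ∑ x, Real.negMulLog (condB ρ (Λ x)).trace.re
    - ∑ x, entropy (condB ρ (Λ x))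

def JE {a b d κ : Type*} [Fintype a] [DecidableEq a] [Fintype b] [Fintype d]
    [DecidableEq d] [Fintype κ]
    (ρ : Matrix (a × b) (a × b) ℂ) (D : Matrix a d ℂ) (Λ : κ → Matrix a a ℂ) : ℝ :=
  entropy (ptraceRight ρ) + ∑ x, Real.negMulLog (condB ρ (Λ x)).trace.re
    - ∑ x, entropy (Dᴴ * Λ x * D)

lemma mutualInfo_blk {κ γ : Type*} [DecidableEq κ] [DecidableEq γ] [Fintype κ] [Fintype γ]
    {M : κ → Matrix γ γ ℂ} (h : ∀ x, (M x).PosSemidef) :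
    mutualInfo (blk M) = ∑ x, Real.negMulLog (M x).trace.re + entropy (∑ x, M x)
      - ∑ x, entropy (M x) := by
  unfold mutualInfo
  have e1 : ptraceRight (blk M) = diagonal (fun x => (((M x).trace.re : ℝ) : ℂ)) := by
    ext x y
    by_cases hxy : x = y
    · subst hxy
      simp only [ptraceRight, blk, if_true, diagonal_apply_eq]
      have : 0 ≤ (M x).trace := (h x).trace_nonneg
      rw [Complex.nonneg_iff] at this
      apply Complex.ext
      · simp [Matrix.trace]
      · rw [Complex.ofReal_im, this.2]; rfl
    · simp [ptraceRight, blk, hxy]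
  have e2 : ptraceLeft (blk M) = ∑ x, M x := by
    ext i j
    simp [ptraceLeft, blk, Matrix.sum_apply]
  rw [e1, e2, entropy_diagonal, entropy_blk fun x => (h x).1]

lemma sqrt_herm {ι : Type*} [Fintype ι] [DecidableEq ι] {M : Matrix ι ι ℂ} (h : M.PosSemidef) :
    h.sqrtᴴ = h.sqrt := by
  have : h.sqrt = (h.1.eigenvectorUnitary : Matrix ι ι ℂ) *
    diagonal (fun i => (Real.sqrt (h.1.eigenvalues i) : ℂ)) *
      (h.1.eigenvectorUnitary : Matrix ι ι ℂ)ᴴ := rfl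
  rw [this]
  exact isHermitian_mul_mul_conjTranspose _ (rdiag_herm _)

lemma sqrt_psd {ι : Type*} [Fintype ι] [DecidableEq ι] {M : Matrix ι ι ℂ} (h : M.PosSemidef) :
    h.sqrt.PosSemidef := by
  have : h.sqrt = (h.1.eigenvectorUnitary : Matrix ι ι ℂ) *
    diagonal (fun i => (Real.sqrt (h.1.eigenvalues i) : ℂ)) *
      (h.1.eigenvectorUnitary : Matrix ι ι ℂ)ᴴ := rfl
  rw [this]
  refine PosSemidef.mul_mul_conjTranspose_same (PosSemidef.diagonal fun i => ?_) _
  simp [Real.sqrt_nonneg]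

lemma sqrt_mul_self' {ι : Type*} [Fintype ι] [DecidableEq ι] {M : Matrix ι ι ℂ}
    (h : M.PosSemidef) : h.sqrt * h.sqrt = M := by
  have e : h.sqrt = (h.1.eigenvectorUnitary : Matrix ι ι ℂ) *
    diagonal (fun i => (Real.sqrt (h.1.eigenvalues i) : ℂ)) *
      (h.1.eigenvectorUnitary : Matrix ι ι ℂ)ᴴ := rfl
  have hu : (h.1.eigenvectorUnitary : Matrix ι ι ℂ)ᴴ * (h.1.eigenvectorUnitary : Matrix ι ι ℂ) = 1 :=
    Unitary.coe_star_mul_self _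
  have hM : M = (h.1.eigenvectorUnitary : Matrix ι ι ℂ) *
    diagonal (fun i => ((h.1.eigenvalues i : ℝ) : ℂ)) *
      (h.1.eigenvectorUnitary : Matrix ι ι ℂ)ᴴ := h.1.spectral_theorem
  conv_rhs => rw [hM]
  rw [e]
  set U := (h.1.eigenvectorUnitary : Matrix ι ι ℂ)
  calc U * diagonal (fun i => (Real.sqrt (h.1.eigenvalues i) : ℂ)) * Uᴴ *
        (U * diagonal (fun i => (Real.sqrt (h.1.eigenvalues i) : ℂ)) * Uᴴ)
      = U * (diagonal (fun i => (Real.sqrt (h.1.eigenvalues i) : ℂ)) * (Uᴴ * U) *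
         diagonal (fun i => (Real.sqrt (h.1.eigenvalues i) : ℂ))) * Uᴴ := by
        simp only [Matrix.mul_assoc]
    _ = _ := by
        rw [hu, Matrix.mul_one, diagonal_mul_diagonal]
        simp_rw [← Complex.ofReal_mul, Real.mul_self_sqrt (h.eigenvalues_nonneg _)]

lemma entropy_factor {a d d' : Type*} [Fintype a] [DecidableEq a] [Fintype d] [DecidableEq d]
    [Fintype d'] [DecidableEq d'] {D : Matrix a d ℂ} {D' : Matrix a d' ℂ} (h : D * Dᴴ = D' * D'ᴴ)
    {L : Matrix a a ℂ} (hL : L.PosSemidef) : entropy (Dᴴ * L * D) = entropy (D'ᴴ * L * D') := by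
  obtain ⟨C, rfl⟩ := exists_factor hL
  have key : ∀ {d : Type _} [Fintype d] [DecidableEq d] (D : Matrix a d ℂ),
      entropy (Dᴴ * (Cᴴ * C) * D) = entropy (C * (D * Dᴴ) * Cᴴ) := by
    intro d _ _ D
    have e1 : Dᴴ * (Cᴴ * C) * D = (C * D)ᴴ * (C * D) := by
      rw [conjTranspose_mul]; simp only [Matrix.mul_assoc]
    rw [e1, entropy_conj_comm, conjTranspose_mul]
    simp only [Matrix.mul_assoc]
  rw [key D, h]
  have e1 : D'ᴴ * (Cᴴ * C) * D' = (C * D')ᴴ * (C * D') := by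
    rw [conjTranspose_mul]; simp only [Matrix.mul_assoc]
  rw [e1, entropy_conj_comm, conjTranspose_mul]
  simp only [Matrix.mul_assoc]

lemma sigmaOf_eq_blk {a b κ : Type*} [Fintype a] [DecidableEq a] [Fintype b] [DecidableEq b]
    [Fintype κ] [DecidableEq κ] (ρ : Matrix (a × b) (a × b) ℂ) (Λ : POVM a κ) :
    sigmaOf ρ Λ = blk (fun x => condB (purifyAssoc ρ) (Λ.elem x)) := rfl

lemma purify_apply {a b : Type*} [Fintype a] [DecidableEq a] [Fintype b] [DecidableEq b]
    {ρ : Matrix (a × b) (a × b) ℂ} (h : ρ.PosSemidef) (x y : a) (u v : b) (e f : a × b) :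
    purifyAssoc ρ (x, (u, e)) (y, (v, f)) = h.sqrt (x, u) e * star (h.sqrt (y, v) f) := by
  simp only [purifyAssoc, canonicalPurification, dif_pos h]
  rfl

lemma purify_psd {a b : Type*} [Fintype a] [DecidableEq a] [Fintype b] [DecidableEq b]
    {ρ : Matrix (a × b) (a × b) ℂ} (h : ρ.PosSemidef) : (purifyAssoc ρ).PosSemidef := by
  simp only [purifyAssoc, canonicalPurification, dif_pos h]
  exact (posSemidef_vecMulVec_self_star _).submatrix _

lemma purify_trE {a b : Type*} [Fintype a] [DecidableEq a] [Fintype b] [DecidableEq b]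
    {ρ : Matrix (a × b) (a × b) ℂ} (h : ρ.PosSemidef) (x y : a) (u v : b) :
    ∑ e, purifyAssoc ρ (x, (u, e)) (y, (v, e)) = ρ (x, u) (y, v) := by
  simp_rw [purify_apply h]
  conv_rhs => rw [← sqrt_mul_self' h]
  rw [Matrix.mul_apply]
  refine sum_congr rfl fun e _ => ?_
  congr 1
  rw [← conjTranspose_apply, sqrt_herm h]

lemma IYB_eq {a b κ : Type*} [Fintype a] [DecidableEq a] [Fintype b] [DecidableEq b]
    [Fintype κ] [DecidableEq κ] {ρ : Matrix (a × b) (a × b) ℂ} (h : ρ.PosSemidef) (Λ : POVM a κ) :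
    IYB (sigmaOf ρ Λ) = JB ρ Λ.elem := by
  have e : ptraceRight (Matrix.reindex (Equiv.prodAssoc κ b (a × b)).symm
    (Equiv.prodAssoc κ b (a × b)).symm (sigmaOf ρ Λ)) = blk (fun x => condB ρ (Λ.elem x)) := by
    rw [sigmaOf_eq_blk]
    ext ⟨x, i⟩ ⟨y, j⟩
    simp only [ptraceRight, reindex_apply, submatrix_apply, Equiv.symm_symm, Equiv.prodAssoc_apply,
      blk]
    split_ifs with hxy
    · simp only [condB]
      rw [sum_comm]
      refine sum_congr rfl fun u _ => ?_
      rw [sum_comm]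
      refine sum_congr rfl fun v _ => ?_
      rw [← mul_sum, purify_trE h]
    · simp
  rw [IYB, e, mutualInfo_blk fun x => condB_psd h (Λ.pos x), ← condB_sum, Λ.sum_eq, condB_one, JB]
  ring

lemma IYBE_eq {a b κ d : Type*} [Fintype a] [DecidableEq a] [Fintype b] [DecidableEq b]
    [Fintype κ] [DecidableEq κ] [Fintype d] [DecidableEq d]
    {ρ : Matrix (a × b) (a × b) ℂ} (h : ρ.PosSemidef) (Λ : POVM a κ)
    (D : Matrix a d ℂ) (hD : D * Dᴴ = ptraceRight ρ) :
    IYBE (sigmaOf ρ Λ) = JE ρ D Λ.elem := by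
  have hp := purify_psd h
  obtain ⟨T, hT⟩ : ∃ T : Matrix a (b × (a × b)) ℂ, ∀ x w, T x w = h.sqrt (x, w.1) w.2 :=
    ⟨Matrix.of fun x w => h.sqrt (x, w.1) w.2, fun _ _ => rfl⟩
  have hTT : T * Tᴴ = ptraceRight ρ := by
    ext x y
    simp only [Matrix.mul_apply, hT, conjTranspose_apply, Fintype.sum_prod_type, ptraceRight]
    refine sum_congr rfl fun u _ => ?_
    rw [← purify_trE h, Fintype.sum_prod_type]
    simp_rw [purify_apply h]
  have hc : ∀ L, condB (purifyAssoc ρ) L = (Tᴴ * L * T)ᵀ := by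
    intro L
    ext ⟨i, e⟩ ⟨j, f⟩
    simp only [condB, purify_apply h, transpose_apply, Matrix.mul_apply, hT, conjTranspose_apply,
      sum_mul]
    rw [sum_comm]
    refine sum_congr rfl fun x _ => sum_congr rfl fun y _ => ?_
    ring
  have hherm : ∀ L : Matrix a a ℂ, L.PosSemidef → (Tᴴ * L * T).IsHermitian :=
    fun L hL => (hL.conjTranspose_mul_mul_same T).1
  rw [IYBE, sigmaOf_eq_blk, mutualInfo_blk fun x => condB_psd hp (Λ.pos x), ← condB_sum, Λ.sum_eq,
    hc 1, entropy_transpose (hherm _ PosSemidef.one), JE]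
  have e1 : entropy (Tᴴ * (1 : Matrix a a ℂ) * T) = entropy (ptraceRight ρ) := by
    rw [Matrix.mul_one, entropy_conj_comm, hTT]
  have e2 : ∀ x, entropy (condB (purifyAssoc ρ) (Λ.elem x)) = entropy (Dᴴ * Λ.elem x * D) := by
    intro x
    rw [hc, entropy_transpose (hherm _ (Λ.pos x))]
    exact entropy_factor (hTT.trans hD.symm) (Λ.pos x)
  have e3 : ∀ x, (condB (purifyAssoc ρ) (Λ.elem x)).trace = (condB ρ (Λ.elem x)).trace := by
    intro x
    rw [hc, trace_transpose, Matrix.trace_mul_comm, ← Matrix.mul_assoc, hTT, condB_trace,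
      Matrix.trace_mul_comm]
  simp_rw [e1, e2, e3]
  ring

def tp {n : ℕ} {ι κ : Type*} (f : Fin n → Matrix ι κ ℂ) : Matrix (Fin n → ι) (Fin n → κ) ℂ :=
  Matrix.of fun x y => ∏ k, f k (x k) (y k)

lemma tp_apply {n : ℕ} {ι κ : Type*} (f : Fin n → Matrix ι κ ℂ) (x : Fin n → ι) (y : Fin n → κ) :
    tp f x y = ∏ k, f k (x k) (y k) := rfl

lemma sum_prod_pi {n : ℕ} {ι : Type*} [Fintype ι] {S : Type*} [CommSemiring S]
    (f : Fin n → ι → S) :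
    ∑ x : Fin n → ι, ∏ k, f k (x k) = ∏ k, ∑ i, f k i := by
  classical
  rw [prod_univ_sum, Fintype.piFinset_univ]

lemma tp_mul {n : ℕ} {ι κ γ : Type*} [Fintype κ] (f : Fin n → Matrix ι κ ℂ)
    (g : Fin n → Matrix κ γ ℂ) : tp f * tp g = tp (fun k => f k * g k) := by
  ext x y
  simp only [Matrix.mul_apply, tp_apply, ← prod_mul_distrib]
  exact sum_prod_pi (fun k z => f k (x k) z * g k z (y k))

lemma tp_conjTranspose {n : ℕ} {ι κ : Type*} (f : Fin n → Matrix ι κ ℂ) :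
    (tp f)ᴴ = tp (fun k => (f k)ᴴ) := by
  ext x y
  simp [tp_apply, conjTranspose_apply]

lemma tp_diagonal {n : ℕ} {ι : Type*} [DecidableEq ι] (d : Fin n → ι → ℂ) :
    tp (fun k => diagonal (d k)) = diagonal (fun x => ∏ k, d k (x k)) := by
  ext x y
  rw [tp_apply]
  by_cases h : x = y
  · subst h; simp
  · rw [diagonal_apply_ne _ h]
    obtain ⟨k, hk⟩ := Function.ne_iff.mp h
    exact prod_eq_zero (mem_univ k) (diagonal_apply_ne _ hk)

lemma tp_one {n : ℕ} {ι : Type*} [DecidableEq ι] :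
    tp (fun _ : Fin n => (1 : Matrix ι ι ℂ)) = 1 := by
  have := tp_diagonal (n := n) (ι := ι) (fun _ _ => 1)
  simpa using this

lemma tp_trace {n : ℕ} {ι : Type*} [Fintype ι] (f : Fin n → Matrix ι ι ℂ) :
    (tp f).trace = ∏ k, (f k).trace := by
  simp only [Matrix.trace, Matrix.diag, tp_apply]
  exact sum_prod_pi (fun k z => f k z z)

lemma tp_sum {n : ℕ} {ι κ X : Type*} [Fintype X] (f : X → Matrix ι κ ℂ) :
    ∑ x : Fin n → X, tp (fun k => f (x k)) = tp (fun _ : Fin n => ∑ x, f x) := by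
  ext i j
  simp only [Matrix.sum_apply, tp_apply]
  exact sum_prod_pi (fun k z => f z (i k) (j k))

lemma tp_psd {n : ℕ} {ι : Type*} [Fintype ι] [DecidableEq ι] {f : Fin n → Matrix ι ι ℂ}
    (h : ∀ k, (f k).PosSemidef) : (tp f).PosSemidef := by
  choose C hC using fun k => exists_factor (h k)
  have : tp f = (tp C)ᴴ * tp C := by
    rw [tp_conjTranspose, tp_mul]; congr 1; ext1 k; exact hC k
  rw [this]; exact posSemidef_conjTranspose_mul_self _

lemma tpowAB_apply {a b : Type*} (ρ : Matrix (a × b) (a × b) ℂ) (n : ℕ) (x y : Fin n → a)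
    (i j : Fin n → b) : tpowAB ρ n (x, i) (y, j) = ∏ k, ρ (x k, i k) (y k, j k) := rfl

lemma tpowAB_density {a b : Type*} [Fintype a] [DecidableEq a] [Fintype b] [DecidableEq b]
    {ρ : Matrix (a × b) (a × b) ℂ} (h : IsDensity ρ) (n : ℕ) : IsDensity (tpowAB ρ n) := by
  constructor
  · have : (tp (fun _ : Fin n => ρ)).PosSemidef := tp_psd fun _ => h.1
    exact this.submatrix _
  · have := tp_trace (fun _ : Fin n => ρ)
    simp only [h.2, prod_const_one] at this
    rw [← this]
    simp only [Matrix.trace, Matrix.diag]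
    exact Equiv.sum_comp (Equiv.arrowProdEquivProdArrow (Fin n) (fun _ => a) (fun _ => b)).symm
      (fun x => tp (fun _ : Fin n => ρ) x x)

lemma ptraceRight_tpowAB {a b : Type*} [Fintype b]
    (ρ : Matrix (a × b) (a × b) ℂ) (n : ℕ) :
    ptraceRight (tpowAB ρ n) = tp (fun _ => ptraceRight ρ) := by
  ext x y
  simp only [ptraceRight, tpowAB_apply, tp_apply]
  exact sum_prod_pi (fun k z => ρ (x k, z) (y k, z))

lemma ptraceLeft_tpowAB {a b : Type*} [Fintype a]
    (ρ : Matrix (a × b) (a × b) ℂ) (n : ℕ) :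
    ptraceLeft (tpowAB ρ n) = tp (fun _ => ptraceLeft ρ) := by
  ext x y
  simp only [ptraceLeft, tpowAB_apply, tp_apply]
  exact sum_prod_pi (fun k z => ρ (z, x k) (z, y k))

lemma entropy_tp_const {ι : Type*} [Fintype ι] [DecidableEq ι] {M : Matrix ι ι ℂ}
    (h : IsDensity M) (n : ℕ) : entropy (tp (fun _ : Fin n => M)) = n * entropy M := by
  induction n with
  | zero =>
    have e : tp (fun _ : Fin 0 => M) = diagonal (fun _ => ((1 : ℝ) : ℂ)) := by
      ext x y
      rw [Subsingleton.elim x y]; simp [tp_apply]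
    rw [e, entropy_diagonal]; simp
  | succ n ih =>
    have hp : (tp (fun _ : Fin n => M)).PosSemidef := tp_psd fun _ => h.1
    have e : tp (fun _ : Fin (n+1) => M) =
        (M ⊗ₖ tp (fun _ : Fin n => M)).submatrix (Fin.consEquiv (fun _ : Fin (n+1) => ι)).symm
          (Fin.consEquiv (fun _ : Fin (n+1) => ι)).symm := by
      ext x y
      simp only [tp_apply, submatrix_apply, kroneckerMap_apply, Fin.prod_univ_succ]
      rfl
    rw [e, entropy_submatrix _ (h.1.kronecker hp).1, entropy_kron h.1 hp, ih, h.2, tp_trace, h.2]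
    simp; ring

lemma IsDensity.left {a b : Type*} [Fintype a] [DecidableEq a] [Fintype b] [DecidableEq b]
    {ρ : Matrix (a × b) (a × b) ℂ} (h : IsDensity ρ) : IsDensity (ptraceLeft ρ) :=
  ⟨ptraceLeft_psd h.1, by rw [ptraceLeft_trace, h.2]⟩

lemma IsDensity.right {a b : Type*} [Fintype a] [DecidableEq a] [Fintype b] [DecidableEq b]
    {ρ : Matrix (a × b) (a × b) ℂ} (h : IsDensity ρ) : IsDensity (ptraceRight ρ) :=
  ⟨ptraceRight_psd h.1, by rw [ptraceRight_trace, h.2]⟩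

lemma JB_le {a b κ : Type*} [Fintype a] [DecidableEq a] [Fintype b] [DecidableEq b] [Fintype κ]
    {ρ : Matrix (a × b) (a × b) ℂ} (h : ρ.PosSemidef) (Λ : POVM a κ) :
    JB ρ Λ.elem ≤ entropy (ptraceLeft ρ) := by
  have : ∑ x, Real.negMulLog (condB ρ (Λ.elem x)).trace.re ≤ ∑ x, entropy (condB ρ (Λ.elem x)) :=
    sum_le_sum fun x _ => le_entropy (condB_psd h (Λ.pos x))
  unfold JB; linarith

def POVM.relabel {ι κ κ' : Type*} [Fintype ι] [DecidableEq ι] [Fintype κ] [Fintype κ']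
    (Λ : POVM ι κ) (e : κ' ≃ κ) : POVM ι κ' where
  elem y := Λ.elem (e y)
  pos y := Λ.pos _
  sum_eq := by rw [← Λ.sum_eq]; exact Equiv.sum_comp e _

lemma P1_ge {a b κ d : Type*} [Fintype a] [DecidableEq a] [Fintype b] [DecidableEq b] [Fintype κ]
    [Fintype d] [DecidableEq d]
    {ρ : Matrix (a × b) (a × b) ℂ} (h : ρ.PosSemidef) (Λ : POVM a κ) (D : Matrix a d ℂ)
    (hD : D * Dᴴ = ptraceRight ρ) {R : ℝ} (hR : JE ρ D Λ.elem ≤ R) : JB ρ Λ.elem ≤ P1 ρ R := by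
  refine le_csSup ⟨entropy (ptraceLeft ρ), ?_⟩ ⟨Fintype.card κ, Λ.relabel (Fintype.equivFin κ).symm, ?_, ?_⟩
  · rintro v ⟨m, Λ, -, rfl⟩
    rw [IYB_eq h]; exact JB_le h Λ
  · rw [IYBE_eq h _ D hD]
    refine le_of_eq_of_le ?_ hR
    unfold JE POVM.relabel
    congr 1
    · congr 1
      exact Equiv.sum_comp (Fintype.equivFin κ).symm
        (fun x => Real.negMulLog (condB ρ (Λ.elem x)).trace.re)
    · exact Equiv.sum_comp (Fintype.equivFin κ).symm (fun x => entropy (Dᴴ * Λ.elem x * D))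
  · rw [IYB_eq h]
    unfold JB POVM.relabel
    congr 1
    · congr 1
      exact (Equiv.sum_comp (Fintype.equivFin κ).symm
        (fun x => Real.negMulLog (condB ρ (Λ.elem x)).trace.re)).symm
    · exact (Equiv.sum_comp (Fintype.equivFin κ).symm (fun x => entropy (condB ρ (Λ.elem x)))).symm

def trivPOVM (ι : Type*) [Fintype ι] [DecidableEq ι] : POVM ι (Fin 1) where
  elem _ := 1
  pos _ := PosSemidef.one
  sum_eq := by simp

lemma JB_triv {a b : Type*} [Fintype a] [DecidableEq a] [Fintype b] [DecidableEq b]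
    {ρ : Matrix (a × b) (a × b) ℂ} (h : IsDensity ρ) : JB ρ (trivPOVM a).elem = 0 := by
  simp [JB, trivPOVM, condB_one, ptraceLeft_trace, h.2]

lemma JE_triv {a b d : Type*} [Fintype a] [DecidableEq a] [Fintype b] [DecidableEq b]
    [Fintype d] [DecidableEq d]
    {ρ : Matrix (a × b) (a × b) ℂ} (h : IsDensity ρ) (D : Matrix a d ℂ)
    (hD : D * Dᴴ = ptraceRight ρ) : JE ρ D (trivPOVM a).elem = 0 := by
  simp [JE, trivPOVM, condB_one, ptraceLeft_trace, h.2, entropy_conj_comm, hD]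

lemma exists_D {a b : Type*} [Fintype a] [DecidableEq a] [Fintype b] [DecidableEq b]
    {ρ : Matrix (a × b) (a × b) ℂ} (h : ρ.PosSemidef) :
    ∃ D : Matrix a a ℂ, D * Dᴴ = ptraceRight ρ := by
  obtain ⟨C, hC⟩ := exists_factor (ptraceRight_psd h)
  exact ⟨Cᴴ, by rw [conjTranspose_conjTranspose, hC]⟩

lemma P1_nonneg {a b : Type*} [Fintype a] [DecidableEq a] [Fintype b] [DecidableEq b]
    {ρ : Matrix (a × b) (a × b) ℂ} (h : IsDensity ρ) {R : ℝ} (hR : 0 ≤ R) : 0 ≤ P1 ρ R := by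
  obtain ⟨D, hD⟩ := exists_D h.1
  have := P1_ge h.1 (trivPOVM a) D hD (R := R) (by rwa [JE_triv h D hD])
  rwa [JB_triv h] at this

lemma P1_lt {a b : Type*} [Fintype a] [DecidableEq a] [Fintype b] [DecidableEq b]
    {ρ : Matrix (a × b) (a × b) ℂ} (h : IsDensity ρ) (D : Matrix a a ℂ)
    (hD : D * Dᴴ = ptraceRight ρ) {R : ℝ} (hR : 0 ≤ R) {c : ℝ}
    (hc : c < P1 ρ R) : ∃ (m : ℕ) (Λ : POVM a (Fin m)), JE ρ D Λ.elem ≤ R ∧ c < JB ρ Λ.elem := by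
  obtain ⟨v, ⟨m, Λ, h1, rfl⟩, h2⟩ := exists_lt_of_lt_csSup
    (s := { v : ℝ | ∃ (m : ℕ) (Λ : POVM a (Fin m)),
    IYBE (sigmaOf ρ Λ) ≤ R ∧ v = IYB (sigmaOf ρ Λ) })
    ⟨_, 1, trivPOVM a, by rwa [IYBE_eq h.1 _ D hD, JE_triv h D hD], rfl⟩ hc
  exact ⟨m, Λ, by rwa [← IYBE_eq h.1 _ D hD], by rwa [← IYB_eq h.1]⟩

lemma P1_le {a b : Type*} [Fintype a] [DecidableEq a] [Fintype b] [DecidableEq b]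
    {ρ : Matrix (a × b) (a × b) ℂ} (h : IsDensity ρ) {R : ℝ} (hR : 0 ≤ R) :
    P1 ρ R ≤ entropy (ptraceLeft ρ) := by
  obtain ⟨D, hD⟩ := exists_D h.1
  refine csSup_le ⟨_, 1, trivPOVM a, by rwa [IYBE_eq h.1 _ D hD, JE_triv h D hD], rfl⟩ ?_
  rintro v ⟨m, Λ, -, rfl⟩
  rw [IYB_eq h.1]; exact JB_le h.1 Λ

section product
variable {a b a1 b1 a2 b2 : Type*} [Fintype a] [DecidableEq a] [Fintype b] [DecidableEq b]
  [Fintype a1] [DecidableEq a1] [Fintype b1] [DecidableEq b1]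
  [Fintype a2] [DecidableEq a2] [Fintype b2] [DecidableEq b2]

def IsProd (ρ : Matrix (a × b) (a × b) ℂ) (ρ1 : Matrix (a1 × b1) (a1 × b1) ℂ)
    (ρ2 : Matrix (a2 × b2) (a2 × b2) ℂ) (ea : a ≃ a1 × a2) (eb : b ≃ b1 × b2) : Prop :=
  ∀ x y i j, ρ (x, i) (y, j) =
    ρ1 ((ea x).1, (eb i).1) ((ea y).1, (eb j).1) * ρ2 ((ea x).2, (eb i).2) ((ea y).2, (eb j).2)

variable {ρ : Matrix (a × b) (a × b) ℂ} {ρ1 : Matrix (a1 × b1) (a1 × b1) ℂ}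
    {ρ2 : Matrix (a2 × b2) (a2 × b2) ℂ} {ea : a ≃ a1 × a2} {eb : b ≃ b1 × b2}

lemma IsProd.condB_kron (h : IsProd ρ ρ1 ρ2 ea eb) (L1 : Matrix a1 a1 ℂ) (L2 : Matrix a2 a2 ℂ) :
    condB ρ ((L1 ⊗ₖ L2).submatrix ea ea) = (condB ρ1 L1 ⊗ₖ condB ρ2 L2).submatrix eb eb := by
  ext i j
  simp only [condB, submatrix_apply, kroneckerMap_apply]
  rw [← Equiv.sum_comp ea.symm]
  simp_rw [← Equiv.sum_comp ea.symm (fun x' => (L1 (ea (ea.symm _)).1 (ea x').1 * L2 _ (ea x').2) * ρ (x', i) _)]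
  simp only [h _ _ _ _, Equiv.apply_symm_apply, Fintype.sum_prod_type]
  rw [sum_mul_sum]
  refine sum_congr rfl fun x1 _ => sum_congr rfl fun x2 _ => ?_
  rw [sum_mul_sum]
  refine sum_congr rfl fun x1 _ => sum_congr rfl fun x2 _ => ?_
  ring

lemma IsProd.ptraceLeft (h : IsProd ρ ρ1 ρ2 ea eb) :
    ptraceLeft ρ = (LPD.ptraceLeft ρ1 ⊗ₖ LPD.ptraceLeft ρ2).submatrix eb eb := by
  have := h.condB_kron 1 1
  rw [one_kronecker_one, submatrix_one_equiv, condB_one, condB_one, condB_one] at this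
  exact this

lemma IsProd.ptraceRight (h : IsProd ρ ρ1 ρ2 ea eb) :
    ptraceRight ρ = (LPD.ptraceRight ρ1 ⊗ₖ LPD.ptraceRight ρ2).submatrix ea ea := by
  ext x y
  simp only [LPD.ptraceRight, submatrix_apply, kroneckerMap_apply]
  rw [← Equiv.sum_comp eb.symm]
  simp only [h _ _ _ _, Equiv.apply_symm_apply, Fintype.sum_prod_type, sum_mul_sum]

def POVM.prod {κ1 κ2 : Type*} [Fintype κ1] [Fintype κ2] (Λ1 : POVM a1 κ1) (Λ2 : POVM a2 κ2)
    (ea : a ≃ a1 × a2) : POVM a (κ1 × κ2) where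
  elem y := (Λ1.elem y.1 ⊗ₖ Λ2.elem y.2).submatrix ea ea
  pos y := ((Λ1.pos y.1).kronecker (Λ2.pos y.2)).submatrix _
  sum_eq := by
    have : ∑ y : κ1 × κ2, (Λ1.elem y.1 ⊗ₖ Λ2.elem y.2) = 1 := by
      rw [← one_kronecker_one, ← Λ1.sum_eq, ← Λ2.sum_eq]
      ext x y
      simp only [Matrix.sum_apply, kroneckerMap_apply, Fintype.sum_prod_type, sum_mul_sum]
    have h2 := congrArg (fun M : Matrix (a1 × a2) (a1 × a2) ℂ => M.submatrix ea ea) this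
    simp only [submatrix_one_equiv] at h2
    rw [← h2]
    ext x y
    simp [Matrix.sum_apply]

lemma povm_sum_p {κ : Type*} [Fintype κ] (h : IsDensity ρ) (Λ : POVM a κ) :
    ∑ x, (condB ρ (Λ.elem x)).trace.re = 1 := by
  rw [← Complex.re_sum, ← Matrix.trace_sum, ← condB_sum, Λ.sum_eq, condB_one, ptraceLeft_trace, h.2]
  rfl

lemma trace_re_kron {M : Matrix a1 a1 ℂ} {N : Matrix a2 a2 ℂ} (hM : M.PosSemidef)
    (hN : N.PosSemidef) : (M ⊗ₖ N).trace.re = M.trace.re * N.trace.re := by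
  rw [trace_kronecker]
  have h1 := Complex.nonneg_iff.mp hM.trace_nonneg
  rw [Complex.mul_re, ← h1.2]; simp

lemma trace_submatrix_equiv {e f : Type*} [Fintype e] [Fintype f] (u : e ≃ f) (M : Matrix f f ℂ) :
    (M.submatrix u u).trace = M.trace :=
  Equiv.sum_comp u (fun x => M x x)

lemma prod_sum_aux {κ1 κ2 : Type*} [Fintype κ1] [Fintype κ2] (p1 s1 : κ1 → ℝ) (p2 s2 : κ2 → ℝ)
    (h1 : ∑ x, p1 x = 1) (h2 : ∑ x, p2 x = 1) :
    ∑ y : κ1 × κ2, (p2 y.2 * s1 y.1 + p1 y.1 * s2 y.2) = ∑ x, s1 x + ∑ x, s2 x := by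
  rw [sum_add_distrib]
  simp only [Fintype.sum_prod_type, ← mul_sum, ← sum_mul, h1, h2, one_mul]

lemma IsProd.JB (h : IsProd ρ ρ1 ρ2 ea eb) (h1 : IsDensity ρ1) (h2 : IsDensity ρ2)
    {κ1 κ2 : Type*} [Fintype κ1] [Fintype κ2] (Λ1 : POVM a1 κ1) (Λ2 : POVM a2 κ2) :
    JB ρ (Λ1.prod Λ2 ea).elem = LPD.JB ρ1 Λ1.elem + LPD.JB ρ2 Λ2.elem := by
  have c1 := fun x => condB_psd h1.1 (Λ1.pos x)
  have c2 := fun x => condB_psd h2.1 (Λ2.pos x)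
  unfold LPD.JB
  rw [h.ptraceLeft, entropy_submatrix _ (h1.left.1.kronecker h2.left.1).1,
    entropy_kron h1.left.1 h2.left.1, h1.left.2, h2.left.2]
  have e : ∀ y : κ1 × κ2, condB ρ ((Λ1.prod Λ2 ea).elem y) = _ := fun y => h.condB_kron (Λ1.elem y.1) (Λ2.elem y.2)
  simp_rw [e, trace_submatrix_equiv, trace_re_kron (c1 _) (c2 _),
    entropy_submatrix _ ((c1 _).kronecker (c2 _)).1, entropy_kron (c1 _) (c2 _), Real.negMulLog_mul]
  have k1 := prod_sum_aux _ (fun x => Real.negMulLog (condB ρ1 (Λ1.elem x)).trace.re) _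
    (fun x => Real.negMulLog (condB ρ2 (Λ2.elem x)).trace.re) (povm_sum_p h1 Λ1) (povm_sum_p h2 Λ2)
  have k2 := prod_sum_aux _ (fun x => entropy (condB ρ1 (Λ1.elem x))) _
    (fun x => entropy (condB ρ2 (Λ2.elem x))) (povm_sum_p h1 Λ1) (povm_sum_p h2 Λ2)
  rw [k1, k2]
  simp only [Complex.one_re]
  ring

lemma IsProd.JE (h : IsProd ρ ρ1 ρ2 ea eb) (h1 : IsDensity ρ1) (h2 : IsDensity ρ2)
    {κ1 κ2 d1 d2 : Type*} [Fintype κ1] [Fintype κ2] [Fintype d1] [Fintype d2] [DecidableEq d1]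
    [DecidableEq d2] (Λ1 : POVM a1 κ1) (Λ2 : POVM a2 κ2)
    {D1 : Matrix a1 d1 ℂ} {D2 : Matrix a2 d2 ℂ} (hD1 : D1 * D1ᴴ = LPD.ptraceRight ρ1)
    (hD2 : D2 * D2ᴴ = LPD.ptraceRight ρ2) :
    JE ρ ((D1 ⊗ₖ D2).submatrix ea id) (Λ1.prod Λ2 ea).elem
      = LPD.JE ρ1 D1 Λ1.elem + LPD.JE ρ2 D2 Λ2.elem := by
  have c1 := fun x => condB_psd h1.1 (Λ1.pos x)
  have c2 := fun x => condB_psd h2.1 (Λ2.pos x)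
  have g1 := fun x => (Λ1.pos x).conjTranspose_mul_mul_same D1
  have g2 := fun x => (Λ2.pos x).conjTranspose_mul_mul_same D2
  have t1 : ∀ x, (D1ᴴ * Λ1.elem x * D1).trace = (condB ρ1 (Λ1.elem x)).trace := by
    intro x
    rw [Matrix.trace_mul_comm, ← Matrix.mul_assoc, hD1, condB_trace, Matrix.trace_mul_comm]
  have t2 : ∀ x, (D2ᴴ * Λ2.elem x * D2).trace = (condB ρ2 (Λ2.elem x)).trace := by
    intro x
    rw [Matrix.trace_mul_comm, ← Matrix.mul_assoc, hD2, condB_trace, Matrix.trace_mul_comm]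
  unfold LPD.JE
  rw [h.ptraceRight, entropy_submatrix _ (h1.right.1.kronecker h2.right.1).1,
    entropy_kron h1.right.1 h2.right.1, h1.right.2, h2.right.2]
  have e : ∀ y : κ1 × κ2, condB ρ ((Λ1.prod Λ2 ea).elem y) = _ := fun y => h.condB_kron (Λ1.elem y.1) (Λ2.elem y.2)
  have e' : ∀ y : κ1 × κ2, ((D1 ⊗ₖ D2).submatrix ea id)ᴴ * (Λ1.prod Λ2 ea).elem y *
      ((D1 ⊗ₖ D2).submatrix ea id) =
      (D1ᴴ * Λ1.elem y.1 * D1) ⊗ₖ (D2ᴴ * Λ2.elem y.2 * D2) := by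
    intro y
    rw [mul_kronecker_mul, mul_kronecker_mul, ← conjTranspose_kronecker]
    rw [conjTranspose_submatrix]
    unfold POVM.prod
    simp only
    rw [submatrix_mul_equiv, submatrix_mul_equiv, submatrix_id_id]
  simp_rw [e, e', trace_submatrix_equiv, trace_re_kron (c1 _) (c2 _),
    entropy_kron (g1 _) (g2 _), Real.negMulLog_mul, t1, t2]
  have k1 := prod_sum_aux _ (fun x => Real.negMulLog (condB ρ1 (Λ1.elem x)).trace.re) _
    (fun x => Real.negMulLog (condB ρ2 (Λ2.elem x)).trace.re) (povm_sum_p h1 Λ1) (povm_sum_p h2 Λ2)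
  have k2 := prod_sum_aux _ (fun x => entropy (D1ᴴ * Λ1.elem x * D1)) _
    (fun x => entropy (D2ᴴ * Λ2.elem x * D2)) (povm_sum_p h1 Λ1) (povm_sum_p h2 Λ2)
  rw [k1, k2]
  simp only [Complex.one_re]
  ring

lemma IsProd.D (h : IsProd ρ ρ1 ρ2 ea eb)
    {d1 d2 : Type*} [Fintype d1] [Fintype d2] [DecidableEq d1] [DecidableEq d2]
    {D1 : Matrix a1 d1 ℂ} {D2 : Matrix a2 d2 ℂ} (hD1 : D1 * D1ᴴ = LPD.ptraceRight ρ1)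
    (hD2 : D2 * D2ᴴ = LPD.ptraceRight ρ2) :
    ((D1 ⊗ₖ D2).submatrix ea id) * ((D1 ⊗ₖ D2).submatrix ea id)ᴴ = LPD.ptraceRight ρ := by
  rw [h.ptraceRight, ← hD1, ← hD2, mul_kronecker_mul, ← conjTranspose_kronecker,
    conjTranspose_submatrix]
  have := submatrix_mul_equiv (D1 ⊗ₖ D2) (D1 ⊗ₖ D2)ᴴ ea (Equiv.refl _) ea
  exact this

lemma IsProd.P1_super (h : IsProd ρ ρ1 ρ2 ea eb) (h0 : IsDensity ρ)
    (h1 : IsDensity ρ1) (h2 : IsDensity ρ2)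
    {R1 R2 : ℝ} (hR1 : 0 ≤ R1) (hR2 : 0 ≤ R2) : P1 ρ1 R1 + P1 ρ2 R2 ≤ P1 ρ (R1 + R2) := by
  obtain ⟨D1, hD1⟩ := exists_D h1.1
  obtain ⟨D2, hD2⟩ := exists_D h2.1
  refine le_of_forall_pos_lt_add fun ε hε => ?_
  obtain ⟨m1, Λ1, u1, v1⟩ := P1_lt h1 D1 hD1 hR1 (c := P1 ρ1 R1 - ε / 2) (by linarith)
  obtain ⟨m2, Λ2, u2, v2⟩ := P1_lt h2 D2 hD2 hR2 (c := P1 ρ2 R2 - ε / 2) (by linarith)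
  have := P1_ge h0.1 (Λ1.prod Λ2 ea) _ (h.D hD1 hD2) (R := R1 + R2)
    (by rw [h.JE h1 h2 _ _ hD1 hD2]; linarith)
  rw [h.JB h1 h2] at this
  linarith

end product

lemma isProd_tpowAB {a b : Type*} [Fintype a] [DecidableEq a] [Fintype b] [DecidableEq b]
    (ρ : Matrix (a × b) (a × b) ℂ) (m n : ℕ) :
    IsProd (tpowAB ρ (m + n)) (tpowAB ρ m) (tpowAB ρ n) (Fin.appendEquiv m n).symm
      (Fin.appendEquiv m n).symm := by
  intro x y i j
  simp only [tpowAB_apply, Fin.prod_univ_add]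
  rfl

section limit
variable {a b : Type*} [Fintype a] [DecidableEq a] [Fintype b] [DecidableEq b]
  {ρ : Matrix (a × b) (a × b) ℂ}

lemma P1_tpow_super (h : IsDensity ρ) (m n : ℕ) {R1 R2 : ℝ} (hR1 : 0 ≤ R1) (hR2 : 0 ≤ R2) :
    P1 (tpowAB ρ m) R1 + P1 (tpowAB ρ n) R2 ≤ P1 (tpowAB ρ (m + n)) (R1 + R2) :=
  (isProd_tpowAB ρ m n).P1_super (tpowAB_density h _) (tpowAB_density h _) (tpowAB_density h _)
    hR1 hR2

lemma P1_tpow_le (h : IsDensity ρ) (n : ℕ) {R : ℝ} (hR : 0 ≤ R) :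
    P1 (tpowAB ρ n) R ≤ n * entropy (ptraceLeft ρ) := by
  rw [← entropy_tp_const h.left, ← ptraceLeft_tpowAB]
  exact P1_le (tpowAB_density h n) hR

lemma exists_limit (h : IsDensity ρ) {R : ℝ} (hR : 0 ≤ R) :
    ∃ Pinf : ℝ, Filter.Tendsto (fun n : ℕ => P1 (tpowAB ρ n) (n * R) / n) Filter.atTop (nhds Pinf) ∧
      0 ≤ Pinf ∧ ∀ n : ℕ, P1 (tpowAB ρ n) (n * R) ≤ n * Pinf := by
  have hnR : ∀ n : ℕ, 0 ≤ (n : ℝ) * R := fun n => by positivity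
  have hsub : Subadditive (fun n : ℕ => - P1 (tpowAB ρ n) (n * R)) := by
    intro m n
    have := P1_tpow_super h m n (hnR m) (hnR n)
    push_cast
    rw [add_mul]; linarith
  have hbdd : BddBelow (Set.range fun n : ℕ => (- P1 (tpowAB ρ n) (n * R)) / n) := by
    refine ⟨- entropy (ptraceLeft ρ) - |entropy (ptraceLeft ρ)|, ?_⟩
    rintro _ ⟨n, rfl⟩
    rcases Nat.eq_zero_or_pos n with rfl | hn
    · simp; linarith [neg_abs_le (entropy (ptraceLeft ρ))]
    · have hn' : (0 : ℝ) < n := by exact_mod_cast hn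
      simp only
      rw [le_div_iff₀ hn']
      have := P1_tpow_le h n (hnR n)
      have := abs_nonneg (entropy (ptraceLeft ρ))
      nlinarith
  have ht := hsub.tendsto_lim hbdd
  have hle : ∀ n : ℕ, P1 (tpowAB ρ n) (n * R) ≤ n * (-hsub.lim) := by
    intro n
    rcases Nat.eq_zero_or_pos n with rfl | hn
    · have := P1_tpow_le h 0 (hnR 0)
      simpa using this
    · have hn' : (0 : ℝ) < n := by exact_mod_cast hn
      have := hsub.lim_le_div hbdd hn.ne'
      rw [le_div_iff₀ hn'] at this
      linarith
  refine ⟨-hsub.lim, ?_, ?_, hle⟩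
  · have := ht.neg
    simpa [neg_div] using this
  · have := hle 1
    have h0 := P1_nonneg (tpowAB_density h 1) (hnR 1)
    simp at this h0
    simp; linarith

end limit

lemma card_eq_of_unitary {ι κ : Type*} [Fintype ι] [DecidableEq ι] [Fintype κ] [DecidableEq κ]
    {U : Matrix ι κ ℂ} (h1 : Uᴴ * U = 1) (h2 : U * Uᴴ = 1) : Fintype.card ι = Fintype.card κ := by
  have := Matrix.trace_mul_comm U Uᴴ
  rw [h1, h2, trace_one, trace_one] at this
  exact_mod_cast this

lemma traceNorm_eq {ι : Type*} [Fintype ι] [DecidableEq ι] (X : Matrix ι ι ℂ) :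
    traceNorm X = ∑ i, Real.sqrt ((posSemidef_conjTranspose_mul_self X).1.eigenvalues i) := by
  set h := posSemidef_conjTranspose_mul_self X
  have e : h.sqrt = (h.1.eigenvectorUnitary : Matrix ι ι ℂ) *
    diagonal (fun i => (Real.sqrt (h.1.eigenvalues i) : ℂ)) *
      (h.1.eigenvectorUnitary : Matrix ι ι ℂ)ᴴ := rfl
  have hu : (h.1.eigenvectorUnitary : Matrix ι ι ℂ)ᴴ * (h.1.eigenvectorUnitary : Matrix ι ι ℂ) = 1 :=
    Unitary.coe_star_mul_self _
  rw [traceNorm, e, trace_diag _ hu]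

lemma traceNorm_nonneg {ι : Type*} [Fintype ι] [DecidableEq ι] (X : Matrix ι ι ℂ) :
    0 ≤ traceNorm X := by
  rw [traceNorm_eq]; exact sum_nonneg fun i _ => Real.sqrt_nonneg _

lemma entry_le_traceNorm {ι : Type*} [Fintype ι] [DecidableEq ι] (X : Matrix ι ι ℂ) (i j : ι) :
    ‖X i j‖ ≤ traceNorm X := by
  refine le_of_sq_le_sq ?_ (traceNorm_nonneg X)
  set h := posSemidef_conjTranspose_mul_self X
  have h1 : (Xᴴ * X).trace.re = ∑ i, h.1.eigenvalues i := by
    have hu : (h.1.eigenvectorUnitary : Matrix ι ι ℂ)ᴴ * (h.1.eigenvectorUnitary : Matrix ι ι ℂ) = 1 :=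
      Unitary.coe_star_mul_self _
    have hM : Xᴴ * X = (h.1.eigenvectorUnitary : Matrix ι ι ℂ) *
      diagonal (fun i => ((h.1.eigenvalues i : ℝ) : ℂ)) *
      (h.1.eigenvectorUnitary : Matrix ι ι ℂ)ᴴ := h.1.spectral_theorem
    rw [← trace_diag _ hu, ← hM]
  have h2 : ‖X i j‖ ^ 2 ≤ (Xᴴ * X).trace.re := by
    have : (Xᴴ * X).trace.re = ∑ j, ∑ i, ‖X i j‖ ^ 2 := by
      simp only [Matrix.trace, Matrix.diag, Matrix.mul_apply, conjTranspose_apply, Complex.re_sum]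
      refine sum_congr rfl fun j _ => sum_congr rfl fun i _ => ?_
      rw [mul_comm, Complex.star_def, Complex.mul_conj, Complex.normSq_eq_norm_sq, Complex.ofReal_re]
    rw [this]
    refine le_trans ?_ (single_le_sum (f := fun j => ∑ i, ‖X i j‖ ^ 2)
      (fun j _ => sum_nonneg fun i _ => sq_nonneg _) (mem_univ j))
    exact single_le_sum (f := fun i => ‖X i j‖ ^ 2)
      (fun i _ => sq_nonneg _) (mem_univ i)
  refine h2.trans ?_
  rw [h1, traceNorm_eq]
  have := sum_sq_le_sq_sum_of_nonneg (s := univ) (f := fun i => Real.sqrt (h.1.eigenvalues i))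
    (fun i _ => Real.sqrt_nonneg _)
  refine le_trans (le_of_eq ?_) this
  exact sum_congr rfl fun i _ => (Real.sq_sqrt (h.eigenvalues_nonneg i)).symm

lemma dephase_psd {κ γ : Type*} [DecidableEq κ] [Fintype κ] [Fintype γ] [DecidableEq γ]
    {M : Matrix (κ × γ) (κ × γ) ℂ} (h : M.PosSemidef) : (dephaseFst M).PosSemidef := by
  have : dephaseFst M = ∑ y : κ, diagonal (fun p : κ × γ => if p.1 = y then (1 : ℂ) else 0) * M *
      (diagonal (fun p : κ × γ => if p.1 = y then (1 : ℂ) else 0))ᴴ := by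
    ext p q
    simp only [dephaseFst, Matrix.sum_apply, diagonal_conjTranspose, Matrix.mul_diagonal,
      Matrix.diagonal_mul, Pi.star_apply, apply_ite star, star_one, star_zero]
    simp only [ite_mul, one_mul, zero_mul, mul_ite, mul_one, mul_zero]
    by_cases hpq : p.1 = q.1
    · simp [hpq]
    · simp only [hpq, if_false]
      refine (sum_eq_zero fun y _ => ?_).symm
      split_ifs with h1 h2
      · exact absurd (h2.trans h1.symm) hpq
      · rfl
      · rfl
  rw [this]
  exact posSemidef_sum _ fun y _ => h.mul_mul_conjTranspose_same _

lemma kron_conj_apply {p q c : Type*} [Fintype q] [Fintype c] [DecidableEq c] (U : Matrix p q ℂ)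
    (N : Matrix (q × c) (q × c) ℂ) (i j : p) (u v : c) :
    ((U ⊗ₖ (1 : Matrix c c ℂ)) * N * (U ⊗ₖ (1 : Matrix c c ℂ))ᴴ) (i, u) (j, v) =
      ∑ x, ∑ x', U i x * N (x, u) (x', v) * star (U j x') := by
  have h1 : ∀ w, ((U ⊗ₖ (1 : Matrix c c ℂ)) * N) (i, u) w = ∑ x, U i x * N (x, u) w := by
    intro w
    rw [Matrix.mul_apply, Fintype.sum_prod_type]
    refine sum_congr rfl fun x _ => ?_
    simp [kroneckerMap_apply, one_apply]
  rw [Matrix.mul_apply, Fintype.sum_prod_type, sum_comm]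
  rw [sum_eq_single v]
  · conv_rhs => rw [sum_comm]
    refine sum_congr rfl fun x _ => ?_
    rw [h1, sum_mul]
    simp [conjTranspose_apply, kroneckerMap_apply]
  · intro w _ hw
    refine sum_eq_zero fun x _ => ?_
    simp [conjTranspose_apply, kroneckerMap_apply, one_apply, Ne.symm hw]
  · simp

section proto
variable {a b : Type*} [Fintype a] [DecidableEq a] [Fintype b] [DecidableEq b]
  {ρ : Matrix (a × b) (a × b) ℂ} {n : ℕ} (Pr : Protocol a b n)

def isoA : Matrix ((Fin Pr.dAp × Fin Pr.dY) × Fin Pr.dAg) (Fin n → a) ℂ :=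
  Pr.UA.submatrix id (fun x => (x, ⟨0, Pr.dC_pos⟩))

lemma isoA_iso : (isoA Pr)ᴴ * isoA Pr = 1 := by
  have := congrArg (fun M : Matrix ((Fin n → a) × Fin Pr.dC) ((Fin n → a) × Fin Pr.dC) ℂ =>
    M.submatrix (fun x : Fin n → a => (x, ⟨0, Pr.dC_pos⟩))
      (fun x : Fin n → a => (x, ⟨0, Pr.dC_pos⟩))) Pr.UA_unitary.1
  ext x y
  have h2 := congrFun (congrFun this x) y
  simp only [submatrix_apply, one_apply, Prod.mk.injEq, and_true] at h2
  rw [one_apply, ← h2]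
  rfl

lemma pureZero_apply {d : ℕ} (hd : 0 < d) (i j : Fin d) :
    pureZero d i j = if i = ⟨0, hd⟩ ∧ j = ⟨0, hd⟩ then 1 else 0 := by
  simp [pureZero, Fin.ext_iff]

lemma inputState_apply (x x' : Fin n → a) (c c' : Fin Pr.dC) (u u' : Fin n → b) :
    inputState ρ Pr ((x, c), u) ((x', c'), u') = tpowAB ρ n (x, u) (x', u') * pureZero Pr.dC c c' :=
  rfl

lemma stateA_apply (p p' : (Fin Pr.dAp × Fin Pr.dY) × Fin Pr.dAg) (u u' : Fin n → b) :
    stateAfterUA ρ Pr (p, u) (p', u') =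
      ∑ x, ∑ x', isoA Pr p x * tpowAB ρ n (x, u) (x', u') * star (isoA Pr p' x') := by
  unfold stateAfterUA
  rw [kron_conj_apply, Fintype.sum_prod_type]
  refine sum_congr rfl fun x _ => ?_
  rw [sum_eq_single (⟨0, Pr.dC_pos⟩ : Fin Pr.dC), Fintype.sum_prod_type]
  · refine sum_congr rfl fun x' _ => ?_
    rw [sum_eq_single (⟨0, Pr.dC_pos⟩ : Fin Pr.dC)]
    · rw [inputState_apply, pureZero_apply Pr.dC_pos]; simp [isoA]
    · intro c _ hc
      rw [inputState_apply, pureZero_apply Pr.dC_pos]; simp [hc]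
    · simp
  · intro c _ hc
    refine sum_eq_zero fun q _ => ?_
    rw [inputState_apply, pureZero_apply Pr.dC_pos]; simp [hc]
  · simp

def dblk (ρ : Matrix (a × b) (a × b) ℂ) (i i' : Fin Pr.dAp) (g g' : Fin Pr.dAg) :
    Matrix ((Fin n → b) × Fin Pr.dY) ((Fin n → b) × Fin Pr.dY) ℂ :=
  Matrix.of fun w w' => if w.2 = w'.2 then
    stateAfterUA ρ Pr (((i, w.2), g), w.1) (((i', w'.2), g'), w'.1) else 0

lemma stateB_apply (k k' : Fin Pr.dBp × Fin Pr.dBg) (i i' : Fin Pr.dAp) (g g' : Fin Pr.dAg) :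
    stateAfterUB ρ Pr (k, (i, g)) (k', (i', g')) =
      (Pr.UB * dblk Pr ρ i i' g g' * Pr.UBᴴ) k k' := by
  unfold stateAfterUB
  rw [kron_conj_apply]
  simp only [Matrix.mul_apply, sum_mul]
  rw [sum_comm]
  rfl

lemma out_apply (i i' : Fin Pr.dAp) (k k' : Fin Pr.dBp) :
    outputReduced ρ Pr (i, k) (i', k') =
      ∑ g, ∑ h, (Pr.UB * dblk Pr ρ i i' g g * Pr.UBᴴ) (k, h) (k', h) := by
  unfold outputReduced ptraceRight
  rw [Fintype.sum_prod_type]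
  refine sum_congr rfl fun g _ => sum_congr rfl fun h _ => ?_
  rw [← stateB_apply]
  rfl

lemma tpowAB_psd (h : ρ.PosSemidef) (n : ℕ) : (tpowAB ρ n).PosSemidef := by
  have : (tp (fun _ : Fin n => ρ)).PosSemidef := tp_psd fun _ => h
  exact this.submatrix _

lemma pureZero_psd (d : ℕ) : (pureZero d).PosSemidef := by
  have : pureZero d = vecMulVec (fun i : Fin d => if i.val = 0 then (1 : ℂ) else 0)
    (star fun i : Fin d => if i.val = 0 then (1 : ℂ) else 0) := by
    ext i j
    simp only [pureZero, vecMulVec_apply, Pi.star_apply]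
    by_cases hi : i.val = 0 <;> by_cases hj : j.val = 0 <;> simp [hi, hj]
  rw [this]
  exact posSemidef_vecMulVec_self_star (n := Fin d) _

lemma stateA_psd (h : ρ.PosSemidef) : (stateAfterUA ρ Pr).PosSemidef := by
  refine PosSemidef.mul_mul_conjTranspose_same ?_ _
  exact ((tpowAB_psd h n).kronecker (pureZero_psd Pr.dC)).submatrix _

lemma out_psd (h : ρ.PosSemidef) : (outputReduced ρ Pr).PosSemidef := by
  refine ptraceRight_psd (PosSemidef.submatrix ?_ _)
  refine PosSemidef.mul_mul_conjTranspose_same (PosSemidef.submatrix ?_ _) _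
  exact PosSemidef.submatrix (dephase_psd (PosSemidef.submatrix (stateA_psd Pr h) _)) _

lemma trace_unitary_conj {ι κ : Type*} [Fintype ι] [Fintype κ] [DecidableEq κ] {U : Matrix ι κ ℂ}
    (hU : Uᴴ * U = 1) (M : Matrix κ κ ℂ) : (U * M * Uᴴ).trace = M.trace := by
  rw [Matrix.mul_assoc, Matrix.trace_mul_comm, Matrix.mul_assoc, hU, Matrix.mul_one]

lemma out_sumB (i i' : Fin Pr.dAp) :
    ∑ k, outputReduced ρ Pr (i, k) (i', k) =
      ∑ y, ∑ g, ∑ u, stateAfterUA ρ Pr (((i, y), g), u) (((i', y), g), u) := by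
  simp_rw [out_apply]
  rw [sum_comm]
  rw [sum_comm (s := (univ : Finset (Fin Pr.dY)))]
  refine sum_congr rfl fun g _ => ?_
  have := trace_unitary_conj Pr.UB_unitary.1 (dblk Pr ρ i i' g g)
  simp only [Matrix.trace, Matrix.diag, Fintype.sum_prod_type] at this
  rw [this, sum_comm]
  simp [dblk]

def povmA : POVM (Fin n → a) (Fin Pr.dY) where
  elem y := ∑ i, ∑ g, Matrix.of fun x x' => star (isoA Pr ((i, y), g) x) * isoA Pr ((i, y), g) x'
  pos y := by
    refine posSemidef_sum _ fun i _ => posSemidef_sum _ fun g _ => ?_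
    have := posSemidef_vecMulVec_star_self (isoA Pr ((i, y), g))
    exact this
  sum_eq := by
    rw [← isoA_iso Pr]
    ext x x'
    simp only [Matrix.sum_apply, Matrix.mul_apply, Fintype.sum_prod_type, of_apply,
      conjTranspose_apply]
    rw [sum_comm]

lemma condB_povmA (y : Fin Pr.dY) :
    condB (tpowAB ρ n) ((povmA Pr).elem y) =
      ∑ i, ∑ g, Matrix.of fun u u' => stateAfterUA ρ Pr (((i, y), g), u) (((i, y), g), u') := by
  unfold povmA
  simp only [condB_sum]
  refine sum_congr rfl fun i _ => sum_congr rfl fun g _ => ?_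
  ext u u'
  simp only [condB, of_apply, stateA_apply]
  rw [sum_comm]
  refine sum_congr rfl fun x _ => sum_congr rfl fun x' _ => ?_
  ring

lemma out_sumA (k k' : Fin Pr.dBp) :
    ∑ i, outputReduced ρ Pr (i, k) (i, k') =
      ∑ h, (Pr.UB * (blk fun y => condB (tpowAB ρ n) ((povmA Pr).elem y)).submatrix
        Prod.swap Prod.swap * Pr.UBᴴ) (k, h) (k', h) := by
  have : (blk fun y => condB (tpowAB ρ n) ((povmA Pr).elem y)).submatrix Prod.swap Prod.swap =
      ∑ i, ∑ g, dblk Pr ρ i i g g := by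
    ext ⟨u, y⟩ ⟨u', y'⟩
    simp only [condB_povmA, submatrix_apply, blk, Prod.swap, Matrix.sum_apply, dblk, of_apply]
    by_cases h : y = y'
    · subst h; simp
    · simp [h]
  rw [this]
  simp_rw [out_apply, Matrix.mul_sum, Matrix.sum_mul, Matrix.sum_apply]
  rw [sum_comm (s := (univ : Finset (Fin Pr.dBg)))]
  refine sum_congr rfl fun i _ => ?_
  rw [sum_comm]

lemma out_trace (h : IsDensity ρ) : (outputReduced ρ Pr).trace = 1 := by
  have e : (outputReduced ρ Pr).trace = ∑ k, ∑ i, outputReduced ρ Pr (i, k) (i, k) := by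
    simp only [Matrix.trace, Matrix.diag, Fintype.sum_prod_type]
    rw [sum_comm]
  rw [e]
  simp_rw [out_sumA]
  have := trace_unitary_conj Pr.UB_unitary.1
    ((blk fun y => condB (tpowAB ρ n) ((povmA Pr).elem y)).submatrix Prod.swap Prod.swap)
  have e2 := trace_submatrix_equiv (Equiv.prodComm _ _)
    (blk fun y => condB (tpowAB ρ n) ((povmA Pr).elem y))
  rw [Equiv.coe_prodComm] at e2
  rw [e2] at this
  simp only [Matrix.trace, Matrix.diag, Fintype.sum_prod_type] at this
  rw [this]
  have h3 : ∑ y, condB (tpowAB ρ n) ((povmA Pr).elem y) = ptraceLeft (tpowAB ρ n) := by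
    rw [← condB_sum, (povmA Pr).sum_eq, condB_one]
  have h4 := congrArg Matrix.trace h3
  rw [ptraceLeft_trace, (tpowAB_density h n).2, Matrix.trace_sum] at h4
  rw [← h4]
  simp [blk, Matrix.trace]

end proto

lemma entropy_split {r ι : Type*} [Fintype r] [DecidableEq r] [Fintype ι] [DecidableEq ι]
    {N : Matrix ι ι ℂ} (hN : IsDensity N) (W : Matrix r ι ℂ) (hW : Wᴴ * W = 1) (s : Finset r) :
    entropy N ≤ ∑ i ∈ s, Real.negMulLog ((W * N * Wᴴ) i i).re
      + (1 - ∑ i ∈ s, ((W * N * Wᴴ) i i).re) * Real.log (Fintype.card ι)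
      + Real.negMulLog (1 - ∑ i ∈ s, ((W * N * Wᴴ) i i).re) := by
  obtain ⟨C', hC'⟩ := exists_factor hN.1
  obtain ⟨C, hC⟩ : ∃ C, C = C'ᴴ := ⟨_, rfl⟩
  have hN2 : N = C * Cᴴ := by rw [hC, conjTranspose_conjTranspose, hC']
  set P : Matrix r r ℂ := diagonal (fun i => if i ∈ s then 1 else 0) with hP
  set Q : Matrix r r ℂ := diagonal (fun i => if i ∈ s then 0 else 1) with hQ
  have hPH : Pᴴ = P := by
    rw [hP, diagonal_conjTranspose]; congr 1; ext i
    by_cases h : i ∈ s <;> simp [h]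
  have hQH : Qᴴ = Q := by
    rw [hQ, diagonal_conjTranspose]; congr 1; ext i
    by_cases h : i ∈ s <;> simp [h]
  have hPP : P * P + Q * Q = 1 := by
    rw [hP, hQ, diagonal_mul_diagonal, diagonal_mul_diagonal, diagonal_add, ← diagonal_one]
    congr 1; ext i; by_cases h : i ∈ s <;> simp [h]
  have e1 : Cᴴ * C = (P * W * C)ᴴ * (P * W * C) + (Q * W * C)ᴴ * (Q * W * C) := by
    simp only [conjTranspose_mul, hPH, hQH]
    have : Cᴴ * C = Cᴴ * (Wᴴ * (P * P + Q * Q) * W) * C := by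
      rw [hPP, Matrix.mul_one, hW, Matrix.mul_one]
    rw [this]
    simp only [Matrix.mul_add, Matrix.add_mul, Matrix.mul_assoc]
  have e2 : entropy N = entropy (Cᴴ * C) := by rw [hN2, entropy_conj_comm]
  have hdiag : ∀ i, ((P * W * C) * (P * W * C)ᴴ) i i = if i ∈ s then (W * N * Wᴴ) i i else 0 := by
    intro i
    have : (P * W * C) * (P * W * C)ᴴ = P * (W * N * Wᴴ) * P := by
      rw [hN2]; simp only [conjTranspose_mul, hPH, Matrix.mul_assoc]
    rw [this, hP, Matrix.mul_diagonal, Matrix.diagonal_mul]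
    split_ifs <;> simp
  have htr : ((P * W * C)ᴴ * (P * W * C)).trace.re = ∑ i ∈ s, ((W * N * Wᴴ) i i).re := by
    rw [Matrix.trace_mul_comm, Matrix.trace]
    simp only [Matrix.diag, hdiag, Complex.re_sum, apply_ite Complex.re, Complex.zero_re]
    simp
  have htr1 : (Cᴴ * C).trace.re = 1 := by
    rw [Matrix.trace_mul_comm, ← hN2, hN.2]; simp
  have htr2 : ((Q * W * C)ᴴ * (Q * W * C)).trace.re = 1 - ∑ i ∈ s, ((W * N * Wᴴ) i i).re := by
    rw [e1, Matrix.trace_add, Complex.add_re, htr] at htr1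
    linarith
  have h1 := entropy_add_le (posSemidef_conjTranspose_mul_self (P * W * C))
    (posSemidef_conjTranspose_mul_self (Q * W * C))
  have h2 := entropy_le_log (posSemidef_conjTranspose_mul_self (Q * W * C))
  have h3 := entropy_le_diag (posSemidef_self_mul_conjTranspose (P * W * C))
  rw [← entropy_conj_comm] at h3
  have h4 : ∑ i, Real.negMulLog (((P * W * C) * (P * W * C)ᴴ) i i).re =
      ∑ i ∈ s, Real.negMulLog ((W * N * Wᴴ) i i).re := by
    simp only [hdiag, apply_ite Complex.re, Complex.zero_re, apply_ite Real.negMulLog,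
      Real.negMulLog_zero]
    simp
  rw [h4] at h3
  rw [htr2] at h2
  rw [e2, e1]
  linarith

lemma negMulLog_le_one {x : ℝ} (h0 : 0 ≤ x) : Real.negMulLog x ≤ 1 := by
  rcases h0.eq_or_lt with h | h
  · rw [← h]; simp
  · have := Real.one_sub_inv_le_log_of_pos h
    have h2 : x * (1 - x⁻¹) ≤ x * Real.log x := mul_le_mul_of_nonneg_left this h0
    rw [mul_sub, mul_one, mul_inv_cancel₀ h.ne'] at h2
    rw [Real.negMulLog]; linarith

lemma logsum {κ : Type*} [Fintype κ] (p q : κ → ℝ) (hq : ∀ y, 0 ≤ q y) (hqp : ∀ y, q y ≤ p y)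
    (hp : ∑ y, p y = 1) :
    ∑ y, Real.negMulLog (q y) ≤ ∑ y, Real.negMulLog (p y) + Real.negMulLog (∑ y, q y) := by
  set t := ∑ y, q y with ht
  have ht0 : 0 ≤ t := sum_nonneg fun y _ => hq y
  have hp0 : ∀ y, 0 ≤ p y := fun y => (hq y).trans (hqp y)
  have hp1 : ∀ y, p y ≤ 1 := fun y => by
    rw [← hp]; exact single_le_sum (fun y _ => hp0 y) (mem_univ y)
  have key : ∀ y, Real.negMulLog (q y) ≤ (p y * t - q y) + Real.negMulLog (p y) - q y * Real.log t := by
    intro y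
    rcases (hq y).eq_or_lt with h | h
    · rw [← h]; simp
      have := Real.negMulLog_nonneg (hp0 y) (hp1 y)
      have := mul_nonneg (hp0 y) ht0
      linarith
    · have hpy : 0 < p y := h.trans_le (hqp y)
      have hty : 0 < t := h.trans_le (by rw [ht]; exact single_le_sum (fun y _ => hq y) (mem_univ y))
      have h1 := Real.log_le_sub_one_of_pos (show 0 < p y * t / q y by positivity)
      rw [Real.log_div (by positivity) h.ne', Real.log_mul hpy.ne' hty.ne'] at h1
      have h2 := mul_le_mul_of_nonneg_left h1 h.le
      have h3 : q y * (p y * t / q y - 1) = p y * t - q y := by field_simp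
      rw [h3] at h2
      have h4 : q y * (-Real.log (p y)) ≤ p y * (-Real.log (p y)) :=
        mul_le_mul_of_nonneg_right (hqp y) (by linarith [Real.log_nonpos (hp0 y) (hp1 y)])
      simp only [Real.negMulLog] at *
      nlinarith
  refine (sum_le_sum fun y _ => key y).trans (le_of_eq ?_)
  rw [sum_sub_distrib, sum_add_distrib, sum_sub_distrib, ← sum_mul,
    ← sum_mul, hp, ← ht, Real.negMulLog]
  ring

section conv
variable {a b : Type*} [Fintype a] [DecidableEq a] [Fintype b] [DecidableEq b]
  {ρ : Matrix (a × b) (a × b) ℂ}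

lemma pz_nonneg {κ : Type*} [Fintype κ] (h : IsDensity ρ) (Λ : POVM a κ) (x : κ) :
    0 ≤ (condB ρ (Λ.elem x)).trace.re :=
  (Complex.nonneg_iff.mp (condB_psd h.1 (Λ.pos x)).trace_nonneg).1

lemma HY_le {m : ℕ} (h : IsDensity ρ) (Λ : POVM a (Fin m)) :
    ∑ x, Real.negMulLog (condB ρ (Λ.elem x)).trace.re ≤ Real.log m := by
  have := sum_negMulLog_le _ (pz_nonneg h Λ)
  rw [povm_sum_p h Λ] at this
  simpa using this

lemma JB_le_log {m : ℕ} (h : IsDensity ρ) (Λ : POVM a (Fin m)) : JB ρ Λ.elem ≤ Real.log m := by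
  have h1 := HY_le h Λ
  have h2 := entropy_sum_le fun x => condB_psd h.1 (Λ.pos x)
  rw [← condB_sum, Λ.sum_eq, condB_one] at h2
  unfold JB; linarith

lemma JE_le_log {m : ℕ} (h : IsDensity ρ) (Λ : POVM a (Fin m)) {d : Type*} [Fintype d]
    [DecidableEq d] (D : Matrix a d ℂ) (hD : D * Dᴴ = ptraceRight ρ) :
    JE ρ D Λ.elem ≤ Real.log m := by
  have h1 := HY_le h Λ
  have h2 := entropy_sum_le fun x => (Λ.pos x).conjTranspose_mul_mul_same D
  rw [← Matrix.sum_mul, ← Matrix.mul_sum, Λ.sum_eq, Matrix.mul_one, entropy_conj_comm, hD] at h2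
  unfold JE; linarith

variable {n : ℕ}

set_option maxHeartbeats 2000000 in
lemma converse_oneshot (h : IsDensity ρ) (Pr : Protocol a b n) {ε : ℝ} (hε : protocolError ρ Pr ≤ ε) :
    Real.log (Pr.dAp * Pr.dBp) - Real.log Pr.dC ≤ n * kappa (ptraceRight ρ) + n * kappa (ptraceLeft ρ)
      + JB (tpowAB ρ n) (povmA Pr).elem + 4
      + ε * (n * Real.log (Fintype.card a) + n * Real.log (Fintype.card b) + Real.log Pr.dY) := by
  have hn := tpowAB_density h n
  have hps := out_psd Pr h.1
  set i0 : Fin Pr.dAp := ⟨0, Pr.dAp_pos⟩ with hi0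
  set k0 : Fin Pr.dBp := ⟨0, Pr.dBp_pos⟩ with hk0
  have hdiag : ∀ p, 0 ≤ (outputReduced ρ Pr p p).re := fun p =>
    (Complex.nonneg_iff.mp hps.diag_nonneg).1
  have hq : 1 - ε ≤ (outputReduced ρ Pr (i0, k0) (i0, k0)).re := by
    have h1 := entry_le_traceNorm (outputReduced ρ Pr - pureZero Pr.dAp ⊗ₖ pureZero Pr.dBp)
      (i0, k0) (i0, k0)
    have h2 : (outputReduced ρ Pr - pureZero Pr.dAp ⊗ₖ pureZero Pr.dBp) (i0, k0) (i0, k0) =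
      outputReduced ρ Pr (i0, k0) (i0, k0) - 1 := by
      simp [Matrix.sub_apply, kroneckerMap_apply, pureZero, hi0, hk0]
    rw [h2] at h1
    have h3 := (Complex.abs_re_le_norm _).trans (h1.trans hε)
    rw [Complex.sub_re, Complex.one_re, abs_le] at h3
    linarith [h3.1]
  have hε0 : 0 ≤ ε := (traceNorm_nonneg _).trans hε
  have htr : ∑ p, (outputReduced ρ Pr p p).re = 1 := by
    have := out_trace Pr h
    rw [← Complex.re_sum]
    rw [Matrix.trace] at this
    simp only [Matrix.diag] at this
    rw [this]; simp
  set N := ptraceRight (tpowAB ρ n) with hN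
  have hNd : IsDensity N := hn.right
  have hdA : ∀ p, ∑ u, stateAfterUA ρ Pr (p, u) (p, u) = (isoA Pr * N * (isoA Pr)ᴴ) p p := by
    intro p
    simp only [stateA_apply, Matrix.mul_apply, conjTranspose_apply, hN, ptraceRight, sum_mul,
      mul_sum]
    rw [sum_comm]
    conv_rhs => rw [sum_comm]
    refine sum_congr rfl fun x _ => ?_
    rw [sum_comm]
  set w : Fin Pr.dAp → Fin Pr.dY → Fin Pr.dAg → ℝ := fun i y g =>
    ((isoA Pr * N * (isoA Pr)ᴴ) ((i, y), g) ((i, y), g)).re with hw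
  have hw0 : ∀ i y g, 0 ≤ w i y g := fun i y g =>
    (Complex.nonneg_iff.mp (hNd.1.mul_mul_conjTranspose_same (isoA Pr)).diag_nonneg).1
  have hpy : ∀ y, (condB (tpowAB ρ n) ((povmA Pr).elem y)).trace.re = ∑ i, ∑ g, w i y g := by
    intro y
    rw [condB_povmA]
    simp only [Matrix.trace_sum, Complex.re_sum, hw, ← hdA]
    simp [Matrix.trace]
  set t := ∑ y, ∑ g, w i0 y g with ht
  have ht1 : t = ∑ k, (outputReduced ρ Pr (i0, k) (i0, k)).re := by
    rw [← Complex.re_sum, out_sumB]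
    simp only [Complex.re_sum, ht, hw, ← hdA]
  have htε : 1 - ε ≤ t := by
    rw [ht1]
    exact hq.trans (single_le_sum (f := fun k => (outputReduced ρ Pr (i0, k) (i0, k)).re)
      (fun k _ => hdiag _) (mem_univ k0))
  have htle : t ≤ 1 := by
    rw [ht1, ← htr, Fintype.sum_prod_type]
    exact single_le_sum (f := fun i => ∑ k, (outputReduced ρ Pr (i, k) (i, k)).re)
      (fun i _ => sum_nonneg fun k _ => hdiag _) (mem_univ i0)
  have ht0 : 0 ≤ t := sum_nonneg fun y _ => sum_nonneg fun g _ => hw0 _ _ _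
  have hsumf : ∀ f : ((Fin Pr.dAp × Fin Pr.dY) × Fin Pr.dAg) → ℝ,
      ∑ p ∈ univ.filter (fun p : (Fin Pr.dAp × Fin Pr.dY) × Fin Pr.dAg => p.1.1 = i0), f p
      = ∑ y, ∑ g, f ((i0, y), g) := by
    intro f
    rw [sum_filter, Fintype.sum_prod_type, Fintype.sum_prod_type]
    rw [sum_eq_single i0]
    · simp
    · intro i _ hi; simp [hi]
    · simp
  have A1 := entropy_split hNd (isoA Pr) (isoA_iso Pr)
    (univ.filter (fun p : (Fin Pr.dAp × Fin Pr.dY) × Fin Pr.dAg => p.1.1 = i0))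
  rw [hsumf, hsumf] at A1
  change entropy N ≤ ∑ y, ∑ g, Real.negMulLog (w i0 y g) + (1 - t) * _ + Real.negMulLog (1 - t) at A1
  have A2 : ∑ y, ∑ g, Real.negMulLog (w i0 y g) ≤ t * Real.log Pr.dAg
      + ∑ y, Real.negMulLog (∑ g, w i0 y g) := by
    have : ∀ y, ∑ g, Real.negMulLog (w i0 y g) ≤ (∑ g, w i0 y g) * Real.log Pr.dAg
        + Real.negMulLog (∑ g, w i0 y g) := fun y => by
      have := sum_negMulLog_le _ (hw0 i0 y)
      simpa using this
    refine (sum_le_sum fun y _ => this y).trans (le_of_eq ?_)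
    rw [sum_add_distrib, ← sum_mul]
  have A3 := logsum (fun y => (condB (tpowAB ρ n) ((povmA Pr).elem y)).trace.re)
    (fun y => ∑ g, w i0 y g) (fun y => sum_nonneg fun g _ => hw0 _ _ _)
    (fun y => by
      simp only [hpy]
      exact single_le_sum (f := fun i => ∑ g, w i y g)
        (fun i _ => sum_nonneg fun g _ => hw0 _ _ _) (mem_univ i0))
    (povm_sum_p hn (povmA Pr))
  rw [← ht] at A3
  set MB := (blk fun y => condB (tpowAB ρ n) ((povmA Pr).elem y)) with hMB
  have hMBherm : ∀ y, (condB (tpowAB ρ n) ((povmA Pr).elem y)).PosSemidef :=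
    fun y => condB_psd hn.1 ((povmA Pr).pos y)
  have hMBpsd : MB.PosSemidef := by
    choose C hC using fun y => exists_factor (hMBherm y)
    have : MB = (blk C)ᴴ * blk C := by
      rw [hMB, blk_conjTranspose, blk_mul]; congr 1; ext1 y; exact hC y
    rw [this]; exact posSemidef_conjTranspose_mul_self _
  have hBd : IsDensity (MB.submatrix (Equiv.prodComm (Fin n → b) (Fin Pr.dY))
      (Equiv.prodComm (Fin n → b) (Fin Pr.dY))) := by
    refine ⟨hMBpsd.submatrix _, ?_⟩
    rw [trace_submatrix_equiv]
    have h4 : MB.trace = ∑ y, (condB (tpowAB ρ n) ((povmA Pr).elem y)).trace := by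
      simp [hMB, blk, Matrix.trace, Fintype.sum_prod_type]
    rw [h4, ← Matrix.trace_sum, ← condB_sum, (povmA Pr).sum_eq, condB_one, ptraceLeft_trace, hn.2]
  have hsumB := out_sumA (ρ := ρ) Pr k0 k0
  set t' := ∑ i, (outputReduced ρ Pr (i, k0) (i, k0)).re with ht'
  have htε' : 1 - ε ≤ t' :=
    hq.trans (single_le_sum (f := fun i => (outputReduced ρ Pr (i, k0) (i, k0)).re)
      (fun k _ => hdiag _) (mem_univ i0))
  have ht0' : 0 ≤ t' := sum_nonneg fun i _ => hdiag _
  have htle' : t' ≤ 1 := by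
    rw [← htr, Fintype.sum_prod_type, sum_comm]
    exact single_le_sum (f := fun k => ∑ i, (outputReduced ρ Pr (i, k) (i, k)).re)
      (fun i _ => sum_nonneg fun k _ => hdiag _) (mem_univ k0)
  have hsumf' : ∀ f : (Fin Pr.dBp × Fin Pr.dBg) → ℝ,
      ∑ p ∈ univ.filter (fun p : Fin Pr.dBp × Fin Pr.dBg => p.1 = k0), f p
      = ∑ h, f (k0, h) := by
    intro f
    rw [sum_filter, Fintype.sum_prod_type]
    rw [sum_eq_single k0]
    · simp
    · intro i _ hi; simp [hi]
    · simp
  have B1 := entropy_split hBd Pr.UB Pr.UB_unitary.1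
    (univ.filter (fun p : Fin Pr.dBp × Fin Pr.dBg => p.1 = k0))
  rw [hsumf', hsumf'] at B1
  have ht2 : t' = ∑ h, ((Pr.UB * MB.submatrix (Equiv.prodComm (Fin n → b) (Fin Pr.dY))
      (Equiv.prodComm (Fin n → b) (Fin Pr.dY)) * Pr.UBᴴ) (k0, h) (k0, h)).re := by
    rw [ht', ← Complex.re_sum, hsumB, Complex.re_sum]; rfl
  have B2 := sum_negMulLog_le (fun h => ((Pr.UB * MB.submatrix (Equiv.prodComm (Fin n → b) (Fin Pr.dY))
      (Equiv.prodComm (Fin n → b) (Fin Pr.dY)) * Pr.UBᴴ) (k0, h) (k0, h)).re)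
      (fun h => (Complex.nonneg_iff.mp
        (hBd.1.mul_mul_conjTranspose_same Pr.UB).diag_nonneg).1)
  rw [← ht2] at B1 B2
  rw [entropy_submatrix _ hMBpsd.1, hMB, entropy_blk fun y => (hMBherm y).1] at B1
  have hca := card_eq_of_unitary Pr.UA_unitary.1 Pr.UA_unitary.2
  have hcb := card_eq_of_unitary Pr.UB_unitary.1 Pr.UB_unitary.2
  simp only [Fintype.card_prod, Fintype.card_fin, Fintype.card_fun] at hca hcb
  have pAp : (0 : ℝ) < Pr.dAp := by exact_mod_cast Pr.dAp_pos
  have pBp : (0 : ℝ) < Pr.dBp := by exact_mod_cast Pr.dBp_pos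
  have pAg : (0 : ℝ) < Pr.dAg := by exact_mod_cast Pr.dAg_pos
  have pBg : (0 : ℝ) < Pr.dBg := by exact_mod_cast Pr.dBg_pos
  have pY : (0 : ℝ) < Pr.dY := by exact_mod_cast Pr.dY_pos
  have pC : (0 : ℝ) < Pr.dC := by exact_mod_cast Pr.dC_pos
  have pa : (0 : ℝ) < (Fintype.card a : ℝ) ^ n := by
    have : 0 < Fintype.card a ^ n * Pr.dC := by
      rw [← hca]; exact Nat.mul_pos (Nat.mul_pos Pr.dAp_pos Pr.dY_pos) Pr.dAg_pos
    exact_mod_cast Nat.pos_of_mul_pos_right this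
  have pb : (0 : ℝ) < (Fintype.card b : ℝ) ^ n := by
    have : 0 < Fintype.card b ^ n * Pr.dY := by
      rw [← hcb]; exact Nat.mul_pos Pr.dBp_pos Pr.dBg_pos
    exact_mod_cast Nat.pos_of_mul_pos_right this
  have la : Real.log Pr.dAp + Real.log Pr.dY + Real.log Pr.dAg =
      n * Real.log (Fintype.card a) + Real.log Pr.dC := by
    rw [← Real.log_pow, ← Real.log_mul pAp.ne' pY.ne', ← Real.log_mul (by positivity) pAg.ne',
      ← Real.log_mul pa.ne' pC.ne']
    exact_mod_cast congrArg (fun k : ℕ => Real.log (k : ℝ)) hca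
  have lb : Real.log Pr.dBp + Real.log Pr.dBg =
      n * Real.log (Fintype.card b) + Real.log Pr.dY := by
    rw [← Real.log_pow, ← Real.log_mul pBp.ne' pBg.ne',
      ← Real.log_mul pb.ne' pY.ne']
    exact_mod_cast congrArg (fun k : ℕ => Real.log (k : ℝ)) hcb
  have lca : Real.log (Fintype.card (Fin n → a)) = n * Real.log (Fintype.card a) := by
    rw [Fintype.card_fun, Fintype.card_fin, Nat.cast_pow, Real.log_pow]
  have lcb : Real.log (Fintype.card ((Fin n → b) × Fin Pr.dY)) =
      n * Real.log (Fintype.card b) + Real.log Pr.dY := by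
    rw [Fintype.card_prod, Fintype.card_fun, Fintype.card_fin, Fintype.card_fin, Nat.cast_mul,
      Nat.cast_pow, Real.log_mul pb.ne' pY.ne', Real.log_pow]
  have nAg : 0 ≤ Real.log Pr.dAg := Real.log_natCast_nonneg _
  have nBg : 0 ≤ Real.log Pr.dBg := Real.log_natCast_nonneg _
  have nY : 0 ≤ Real.log Pr.dY := Real.log_natCast_nonneg _
  have na : 0 ≤ n * Real.log (Fintype.card a) := mul_nonneg (by positivity) (Real.log_natCast_nonneg _)
  have nb : 0 ≤ n * Real.log (Fintype.card b) := mul_nonneg (by positivity) (Real.log_natCast_nonneg _)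
  have eN : entropy N = n * entropy (ptraceRight ρ) := by
    rw [hN, ptraceRight_tpowAB, entropy_tp_const h.right]
  have eB : entropy (ptraceLeft (tpowAB ρ n)) = n * entropy (ptraceLeft ρ) := by
    rw [ptraceLeft_tpowAB, entropy_tp_const h.left]
  rw [lca] at A1
  rw [lcb] at B1
  simp only [Fintype.card_fin] at B2
  have j1 := mul_le_mul_of_nonneg_right htle nAg
  have j2 := mul_le_mul_of_nonneg_right htle' nBg
  have j3 := mul_le_mul_of_nonneg_right (show 1 - t ≤ ε by linarith) na
  have j4 := mul_le_mul_of_nonneg_right (show 1 - t' ≤ ε by linarith) (add_nonneg nb nY)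
  have k1 := negMulLog_le_one ht0
  have k2 := negMulLog_le_one (show 0 ≤ 1 - t by linarith)
  have k3 := negMulLog_le_one ht0'
  have k4 := negMulLog_le_one (show 0 ≤ 1 - t' by linarith)
  rw [Real.log_mul pAp.ne' pBp.ne']
  unfold kappa JB
  rw [eB]
  rw [eN] at A1

  rw [hMB] at B2
  clear_value t t'
  linarith

end conv

section conv2
variable {a b : Type*} [Fintype a] [DecidableEq a] [Fintype b] [DecidableEq b]
  {ρ : Matrix (a × b) (a × b) ℂ}

lemma JB_bound (h : IsDensity ρ) {R Pinf δ : ℝ} (hR : 0 ≤ R) (h0 : 0 ≤ Pinf)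
    (hP : ∀ n : ℕ, P1 (tpowAB ρ n) (n * R) ≤ n * Pinf) (hδ : 0 < δ) {n : ℕ} (hn : 1 ≤ n * δ)
    {m : ℕ} (Λ : POVM (Fin n → a) (Fin m)) (hm : Real.log m ≤ n * (R + δ)) :
    JB (tpowAB ρ n) Λ.elem ≤ n * Pinf + n * δ * (1 + Pinf / R + Pinf) := by
  have hd := tpowAB_density h n
  have hn0 : (0:ℝ) ≤ n := by positivity
  rcases hR.eq_or_lt with hR0 | hRp
  · have := JB_le_log hd Λ
    rw [← hR0] at hm ⊢
    have h1 : 0 ≤ n * Pinf := by positivity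
    have h2 : 0 ≤ n * δ * Pinf := by positivity
    simp only [div_zero, zero_add, add_zero] at hm ⊢
    nlinarith
  · obtain ⟨D, hD⟩ := exists_D hd.1
    have h1 := P1_ge hd.1 Λ D hD ((JE_le_log hd Λ D hD).trans hm)
    set l := ⌈n * δ / R⌉₊ with hl
    have hl1 : n * δ / R ≤ l := Nat.le_ceil _
    have hl2 : (l : ℝ) < n * δ / R + 1 := Nat.ceil_lt_add_one (by positivity)
    have hl3 : n * δ ≤ l * R := by rwa [div_le_iff₀ hRp] at hl1
    have hR2 : 0 ≤ l * R - n * δ := by linarith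
    have h2 := P1_tpow_super h n l (R1 := n * (R + δ)) (R2 := l * R - n * δ) (by positivity) hR2
    have h3 := P1_nonneg (tpowAB_density h l) hR2
    have h4 := hP (n + l)
    rw [show n * (R + δ) + (l * R - n * δ) = ((n + l : ℕ) : ℝ) * R by push_cast; ring] at h2
    have h5 : ((n + l : ℕ) : ℝ) * Pinf ≤ (n + n * δ / R + 1) * Pinf := by
      apply mul_le_mul_of_nonneg_right _ h0
      push_cast; linarith
    have h6 : (n + n * δ / R + 1) * Pinf = n * Pinf + n * δ * (Pinf / R) + Pinf := by ring
    have h7 : Pinf ≤ n * δ * Pinf := le_mul_of_one_le_left h0 hn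
    nlinarith

lemma converse (h : IsDensity ρ) {R Pinf P : ℝ} (hR : 0 ≤ R) (h0 : 0 ≤ Pinf)
    (hP : ∀ n : ℕ, P1 (tpowAB ρ n) (n * R) ≤ n * Pinf) (hA : Achievable ρ P R) :
    P ≤ kappa (ptraceRight ρ) + kappa (ptraceLeft ρ) + Pinf := by
  set la := Real.log (Fintype.card a) with hla
  set lb := Real.log (Fintype.card b) with hlb
  have hla0 : 0 ≤ la := Real.log_natCast_nonneg _
  have hlb0 : 0 ≤ lb := Real.log_natCast_nonneg _
  set K := 1 + 4 + la + lb + R + 1 + (1 + Pinf / R + Pinf) with hK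
  have hK0 : 0 < K := by positivity
  have key : ∀ δ : ℝ, 0 < δ → δ ≤ 1 →
      P ≤ kappa (ptraceRight ρ) + kappa (ptraceLeft ρ) + Pinf + δ * K := by
    intro δ hδ hδ1
    obtain ⟨N, hN⟩ := hA δ hδ δ hδ
    obtain ⟨n, hn1, hn2⟩ : ∃ n ≥ N, 1 ≤ (n : ℝ) * δ := by
      refine ⟨max N ⌈1 / δ⌉₊, le_max_left _ _, ?_⟩
      rw [← div_le_iff₀ hδ]
      exact (Nat.le_ceil _).trans (by exact_mod_cast le_max_right _ _)
    obtain ⟨Pr, h1, h2, h3⟩ := hN n hn1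
    have hn0 : (0 : ℝ) < n := by
      rcases Nat.eq_zero_or_pos n with rfl | hp
      · simp at hn2; linarith
      · exact_mod_cast hp
    rw [commRate, div_le_iff₀ hn0] at h1
    rw [purityRate, le_div_iff₀ hn0] at h2
    have h4 := converse_oneshot h Pr h3
    have h5 := JB_bound h hR h0 hP hδ hn2 (povmA Pr) (by linarith)
    have h6 : δ * (n * la + n * lb + Real.log Pr.dY) ≤ n * δ * (la + lb + R + 1) := by
      have : Real.log Pr.dY ≤ n * (R + 1) := by
        refine h1.trans ?_
        rw [mul_comm]
        exact mul_le_mul_of_nonneg_left (by linarith) hn0.le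
      have := mul_le_mul_of_nonneg_left this hδ.le
      linarith
    have h7 : n * P ≤ n * (kappa (ptraceRight ρ) + kappa (ptraceLeft ρ) + Pinf + δ * K) := by
      rw [hK]
      linarith
    exact le_of_mul_le_mul_left h7 hn0
  refine le_of_forall_pos_le_add fun ε hε => ?_
  have hm : 0 < min 1 (ε / K) := by positivity
  refine (key _ hm (min_le_left _ _)).trans ?_
  have : min 1 (ε / K) * K ≤ ε := by
    rw [← le_div_iff₀ hK0]; exact min_le_right _ _
  linarith

end conv2

lemma diag_re_nonneg {ι : Type*} [Fintype ι] {A : Matrix ι ι ℂ} (h : A.PosSemidef) (i : ι) :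
    0 ≤ (A i i).re := (Complex.nonneg_iff.mp h.diag_nonneg).1

lemma trace_re_nonneg {ι : Type*} [Fintype ι] {A : Matrix ι ι ℂ} (h : A.PosSemidef) :
    0 ≤ A.trace.re := (Complex.nonneg_iff.mp h.trace_nonneg).1

lemma psd_tr_mul {ι : Type*} [Fintype ι] [DecidableEq ι] {A B : Matrix ι ι ℂ} (hA : A.PosSemidef)
    (hB : B.PosSemidef) : 0 ≤ (A * B).trace.re := by
  obtain ⟨C, rfl⟩ := exists_factor hA
  rw [Matrix.mul_assoc, Matrix.trace_mul_comm]
  exact trace_re_nonneg (hB.mul_mul_conjTranspose_same C)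

lemma tr_between {ι : Type*} [Fintype ι] [DecidableEq ι] {V X Z : Matrix ι ι ℂ} (hV : V * Vᴴ = 1)
    (h1 : (Z - X).PosSemidef) (h2 : (Z + X).PosSemidef) :
    ∑ i, |((Vᴴ * X * V) i i).re| ≤ Z.trace.re := by
  have e : Z.trace.re = ∑ i, ((Vᴴ * Z * V) i i).re := by
    rw [← Complex.re_sum]
    change _ = (Vᴴ * Z * V).trace.re
    rw [Matrix.trace_mul_comm, ← Matrix.mul_assoc, hV, Matrix.one_mul]
  rw [e]
  refine sum_le_sum fun i _ => ?_
  have a1 := diag_re_nonneg (h1.conjTranspose_mul_mul_same V) i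
  have a2 := diag_re_nonneg (h2.conjTranspose_mul_mul_same V) i
  simp only [Matrix.mul_sub, Matrix.sub_mul, Matrix.mul_add, Matrix.add_mul, Matrix.sub_apply,
    Matrix.add_apply, Complex.sub_re, Complex.add_re] at a1 a2
  rw [abs_le]; constructor <;> linarith

lemma powers_stormer {ι : Type*} [Fintype ι] [DecidableEq ι] {r s Z : Matrix ι ι ℂ}
    (hr : r.PosSemidef) (hs : s.PosSemidef)
    (h1 : (Z - (r * r - s * s)).PosSemidef) (h2 : (Z + (r * r - s * s)).PosSemidef) :
    ((r - s) * (r - s)).trace.re ≤ Z.trace.re := by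
  obtain ⟨V, d, hV1, hV2, hd⟩ := herm_diag (hr.1.sub hs.1)
  refine le_trans ?_ (tr_between hV2 h1 h2)
  set r' := Vᴴ * r * V with hr'
  set s' := Vᴴ * s * V with hs'
  have hrs : r' - s' = diagonal (fun i => (d i : ℂ)) := by
    rw [hr', hs', ← Matrix.sub_mul, ← Matrix.mul_sub, hd]
    calc Vᴴ * (V * diagonal (fun i => (d i : ℂ)) * Vᴴ) * V
        = (Vᴴ * V) * diagonal (fun i => (d i : ℂ)) * (Vᴴ * V) := by simp only [Matrix.mul_assoc]
      _ = _ := by rw [hV1, Matrix.one_mul, Matrix.mul_one]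
  have e1 : ((r - s) * (r - s)).trace.re = ∑ i, d i ^ 2 := by
    have : (r - s) * (r - s) = V * diagonal (fun i => ((d i ^ 2 : ℝ) : ℂ)) * Vᴴ := by
      rw [hd]
      calc _ = V * (diagonal (fun i => (d i : ℂ)) * (Vᴴ * V) * diagonal (fun i => (d i : ℂ))) * Vᴴ := by
            simp only [Matrix.mul_assoc]
        _ = _ := by
            rw [hV1, Matrix.mul_one, diagonal_mul_diagonal]
            congr 3; ext i; push_cast; ring
    rw [this, trace_diag _ hV1]
  rw [e1]
  refine sum_le_sum fun i _ => ?_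
  have e2 : Vᴴ * (r * r - s * s) * V = r' * r' - s' * s' := by
    rw [hr', hs']
    have : ∀ m : Matrix ι ι ℂ, Vᴴ * (m * m) * V = Vᴴ * m * V * (Vᴴ * m * V) := by
      intro m
      calc _ = Vᴴ * m * (1 * m * V) := by simp only [Matrix.mul_assoc, Matrix.one_mul]
        _ = _ := by rw [← hV2]; simp only [Matrix.mul_assoc]
    rw [Matrix.mul_sub, Matrix.sub_mul, this, this]
  have e3 : r' * r' - s' * s' = (2⁻¹ : ℂ) • (diagonal (fun i => (d i : ℂ)) * (r' + s')
      + (r' + s') * diagonal (fun i => (d i : ℂ))) := by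
    rw [← hrs]
    have : (r' - s') * (r' + s') + (r' + s') * (r' - s') = (2 : ℂ) • (r' * r' - s' * s') := by
      rw [two_smul]; noncomm_ring
    rw [this, smul_smul]; simp
  have e4 : (Vᴴ * (r * r - s * s) * V) i i = (d i : ℂ) * (r' i i + s' i i) := by
    rw [e2, e3, Matrix.smul_apply, Matrix.add_apply, Matrix.diagonal_mul, Matrix.mul_diagonal,
      Matrix.add_apply, smul_eq_mul]
    ring
  rw [e4, Complex.re_ofReal_mul, Complex.add_re]
  have e5 : d i = (r' i i).re - (s' i i).re := by
    have := congrFun (congrFun hrs i) i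
    rw [Matrix.sub_apply, diagonal_apply_eq] at this
    rw [← Complex.sub_re, this, Complex.ofReal_re]
  have p1 := diag_re_nonneg (hr.conjTranspose_mul_mul_same V) i
  have p2 := diag_re_nonneg (hs.conjTranspose_mul_mul_same V) i
  rw [← hr'] at p1
  rw [← hs'] at p2
  rw [abs_mul, abs_of_nonneg (add_nonneg p1 p2), ← sq_abs, sq]
  refine mul_le_mul_of_nonneg_left ?_ (abs_nonneg _)
  rw [e5, abs_le]; constructor <;> linarith

lemma traceNorm_between {ι : Type*} [Fintype ι] [DecidableEq ι] {X Z : Matrix ι ι ℂ}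
    (hX : X.IsHermitian) (h1 : (Z - X).PosSemidef) (h2 : (Z + X).PosSemidef) :
    traceNorm X ≤ Z.trace.re := by
  obtain ⟨V, d, hV1, hV2, hd⟩ := herm_diag hX
  set Y := V * diagonal (fun i => ((|d i| : ℝ) : ℂ)) * Vᴴ with hY
  have hYp : Y.PosSemidef := by
    refine PosSemidef.mul_mul_conjTranspose_same (PosSemidef.diagonal fun i => ?_) _
    simp
  have hYY : Y * Y = Xᴴ * X := by
    rw [hX.eq, hY, hd]
    have : ∀ f : ι → ℝ, V * diagonal (fun i => (f i : ℂ)) * Vᴴ * (V * diagonal (fun i => (f i : ℂ)) * Vᴴ)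
        = V * diagonal (fun i => ((f i * f i : ℝ) : ℂ)) * Vᴴ := by
      intro f
      calc _ = V * (diagonal (fun i => (f i : ℂ)) * (Vᴴ * V) * diagonal (fun i => (f i : ℂ))) * Vᴴ := by
            simp only [Matrix.mul_assoc]
        _ = _ := by
            rw [hV1, Matrix.mul_one, diagonal_mul_diagonal]
            congr 3; ext i; push_cast; ring
    rw [this (fun i => |d i|), this]
    simp only [abs_mul_abs_self]
  have hs := sqrt_mul_self' (posSemidef_conjTranspose_mul_self X)
  have hsp := sqrt_psd (posSemidef_conjTranspose_mul_self X)
  have hsh := sqrt_herm (posSemidef_conjTranspose_mul_self X)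
  unfold traceNorm
  set s := (posSemidef_conjTranspose_mul_self X).sqrt with hsd
  have h0 := powers_stormer hsp hYp (Z := 0) (by rw [hs, hYY]; simp [PosSemidef.zero])
    (by rw [hs, hYY]; simp [PosSemidef.zero])
  have h3 : s = Y := by
    have hh : (s - Y)ᴴ = s - Y := by rw [conjTranspose_sub, hsh, hYp.1.eq]
    have hn : ((s - Y)ᴴ * (s - Y)).trace = 0 := by
      have := Complex.nonneg_iff.mp (posSemidef_conjTranspose_mul_self (s - Y)).trace_nonneg
      apply Complex.ext
      · rw [hh] at *
        simp at h0 ⊢; linarith [this.1]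
      · exact this.2.symm
    rw [trace_conjTranspose_mul_self_eq_zero_iff] at hn
    exact sub_eq_zero.mp hn
  rw [h3, hY, trace_diag _ hV1]
  refine le_trans (le_of_eq ?_) (tr_between hV2 h1 h2)
  refine sum_congr rfl fun i _ => ?_
  have : Vᴴ * X * V = diagonal (fun i => (d i : ℂ)) := by
    rw [hd]
    calc Vᴴ * (V * diagonal (fun i => (d i : ℂ)) * Vᴴ) * V
        = (Vᴴ * V) * diagonal (fun i => (d i : ℂ)) * (Vᴴ * V) := by simp only [Matrix.mul_assoc]
      _ = _ := by rw [hV1, Matrix.one_mul, Matrix.mul_one]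
  rw [this]; simp

lemma polar {p q : Type*} [Fintype p] [DecidableEq p] [Fintype q] [DecidableEq q]
    (K : Matrix p q ℂ) {s : Matrix q q ℂ} (hs : s.PosSemidef) (h : s * s = Kᴴ * K) :
    ∃ V : Matrix p q ℂ, (1 - Vᴴ * V).PosSemidef ∧ V * s = K ∧ (Vᴴ * V) * s = s := by
  obtain ⟨U, d, hU1, hU2, hd0, hd⟩ := psd_diag hs
  set J : Matrix q q ℂ := U * diagonal (fun i => (((d i)⁻¹ : ℝ) : ℂ)) * Uᴴ with hJ
  have hmul : ∀ f g : q → ℝ, U * diagonal (fun i => (f i : ℂ)) * Uᴴ * (U * diagonal (fun i => (g i : ℂ)) * Uᴴ)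
        = U * diagonal (fun i => ((f i * g i : ℝ) : ℂ)) * Uᴴ := by
      intro f g
      calc _ = U * (diagonal (fun i => (f i : ℂ)) * (Uᴴ * U) * diagonal (fun i => (g i : ℂ))) * Uᴴ := by
            simp only [Matrix.mul_assoc]
        _ = _ := by
            rw [hU1, Matrix.mul_one, diagonal_mul_diagonal]
            congr 3; ext i; push_cast; ring
  have hJH : Jᴴ = J := isHermitian_mul_mul_conjTranspose U (rdiag_herm _)
  set P : Matrix q q ℂ := U * diagonal (fun i => (((d i)⁻¹ * d i : ℝ) : ℂ)) * Uᴴ with hP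
  have hJs : J * s = P := by rw [hJ, hd, hmul]
  have hsJ : s * J = P := by rw [hJ, hd, hmul, hP]; simp only [mul_comm]
  have hPs : P * s = s := by
    conv_rhs => rw [hd]
    rw [hP]; nth_rewrite 1 [hd]
    rw [hmul]
    congr 3; ext i
    by_cases h0 : d i = 0 <;> simp [h0]
  have hPH : Pᴴ = P := isHermitian_mul_mul_conjTranspose U (rdiag_herm _)
  have hVV : (K * J)ᴴ * (K * J) = P := by
    rw [conjTranspose_mul, hJH, Matrix.mul_assoc, ← Matrix.mul_assoc Kᴴ, ← h, Matrix.mul_assoc s,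
      hsJ, ← Matrix.mul_assoc, hJs, hP, hmul]
    congr 3; ext i
    by_cases h0 : d i = 0 <;> simp [h0]
  refine ⟨K * J, ?_, ?_, ?_⟩
  · rw [hVV]
    have : 1 - P = U * diagonal (fun i => ((1 - (d i)⁻¹ * d i : ℝ) : ℂ)) * Uᴴ := by
      have h1 : (1 : Matrix q q ℂ) = U * 1 * Uᴴ := by rw [Matrix.mul_one, hU2]
      rw [hP, h1, ← Matrix.sub_mul, ← Matrix.mul_sub, ← diagonal_one, diagonal_sub]
      congr 3; ext i; push_cast; simp
    rw [this]
    refine PosSemidef.mul_mul_conjTranspose_same (PosSemidef.diagonal fun i => ?_) _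
    by_cases h0 : d i = 0 <;> simp [h0]
  · have : K * (1 - P) = 0 := by
      rw [← conjTranspose_mul_self_eq_zero, conjTranspose_mul, Matrix.mul_assoc, ← Matrix.mul_assoc Kᴴ,
        ← h, Matrix.mul_assoc s]
      have : s * (1 - P) = 0 := by
        have := congrArg conjTranspose hPs
        rw [conjTranspose_mul, hPH, hs.1.eq] at this
        rw [Matrix.mul_sub, this, Matrix.mul_one, sub_self]
      rw [this]; simp
    rw [Matrix.mul_assoc, hJs]
    rw [Matrix.mul_sub, Matrix.mul_one, sub_eq_zero] at this
    exact this.symm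
  · rw [hVV, hPs]

section prob
variable {X : Type*} [Fintype X]

lemma sum_fin_cons {M : ℕ} (F : (Fin (M + 1) → X) → ℝ) :
    ∑ c, F c = ∑ x, ∑ c : Fin M → X, F (Fin.cons x c) := by
  rw [← Fintype.sum_prod_type' (fun x (c : Fin M → X) => F (Fin.cons x c))]
  exact (Fintype.sum_equiv (Fin.consEquiv fun _ => X) _ _ (fun _ => rfl)).symm

lemma w_sum {p : X → ℝ} (hp : ∑ x, p x = 1) (M : ℕ) : ∑ c : Fin M → X, ∏ j, p (c j) = 1 := by
  rw [sum_prod_pi (fun _ => p)]; simp [hp]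

lemma E_lin {p : X → ℝ} (hp : ∑ x, p x = 1) (f : X → ℝ) (M : ℕ) :
    ∑ c : Fin M → X, (∏ j, p (c j)) * ∑ j, f (c j) = M * ∑ x, p x * f x := by
  induction M with
  | zero => simp
  | succ M ih =>
    rw [sum_fin_cons]
    simp only [Fin.prod_univ_succ, Fin.sum_univ_succ, Fin.cons_zero, Fin.cons_succ]
    have : ∀ x, ∑ c : Fin M → X, p x * (∏ i, p (c i)) * (f x + ∑ i, f (c i)) =
        p x * f x + p x * (M * ∑ x, p x * f x) := by
      intro x
      rw [← ih, mul_sum]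
      have h1 : p x * f x = ∑ c : Fin M → X, p x * (∏ i, p (c i)) * f x := by
        rw [← sum_mul, ← mul_sum, w_sum hp, mul_one]
      rw [h1, ← sum_add_distrib]
      exact sum_congr rfl fun c _ => by ring
    rw [sum_congr rfl fun x _ => this x, sum_add_distrib, ← sum_mul, hp]
    push_cast; ring

lemma E_var {p : X → ℝ} (hp : ∑ x, p x = 1) (f : X → ℝ) (hf : ∑ x, p x * f x = 0) (M : ℕ) :
    ∑ c : Fin M → X, (∏ j, p (c j)) * (∑ j, f (c j)) ^ 2 = M * ∑ x, p x * f x ^ 2 := by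
  induction M with
  | zero => simp
  | succ M ih =>
    rw [sum_fin_cons]
    simp only [Fin.prod_univ_succ, Fin.sum_univ_succ, Fin.cons_zero, Fin.cons_succ]
    have : ∀ x, ∑ c : Fin M → X, p x * (∏ i, p (c i)) * (f x + ∑ i, f (c i)) ^ 2 =
        p x * f x ^ 2 + p x * (M * ∑ x, p x * f x ^ 2) := by
      intro x
      have h1 : p x * f x ^ 2 = ∑ c : Fin M → X, p x * (∏ i, p (c i)) * f x ^ 2 := by
        rw [← sum_mul, ← mul_sum, w_sum hp, mul_one]
      have h2 : ∑ c : Fin M → X, 2 * p x * f x * ((∏ i, p (c i)) * ∑ i, f (c i)) = 0 := by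
        rw [← mul_sum, E_lin hp, hf]; simp
      rw [← ih, mul_sum, h1, ← add_zero (_ + _), ← h2, ← sum_add_distrib,
        ← sum_add_distrib]
      exact sum_congr rfl fun c _ => by ring
    rw [sum_congr rfl fun x _ => this x, sum_add_distrib, ← sum_mul, hp]
    push_cast; ring

lemma var_le {p : X → ℝ} (hp : ∑ x, p x = 1) (f : X → ℝ) :
    ∑ x, p x * (f x - ∑ y, p y * f y) ^ 2 ≤ ∑ x, p x * f x ^ 2 := by
  obtain ⟨m, hm⟩ : ∃ m, m = ∑ y, p y * f y := ⟨_, rfl⟩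
  rw [← hm]
  have : ∑ x, p x * (f x - m) ^ 2 = ∑ x, p x * f x ^ 2 - 2 * m * ∑ x, p x * f x + m ^ 2 * ∑ x, p x := by
    rw [mul_sum, mul_sum, ← sum_sub_distrib, ← sum_add_distrib]
    exact sum_congr rfl fun c _ => by ring
  rw [this, hp, ← hm]
  nlinarith [sq_nonneg m]

lemma E_avg {p : X → ℝ} (hp : ∑ x, p x = 1) (f : X → ℝ) {M : ℕ} (hM : 0 < M) :
    ∑ c : Fin M → X, (∏ j, p (c j)) * ((M : ℝ)⁻¹ * ∑ j, f (c j) - ∑ y, p y * f y) ^ 2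
      ≤ (M : ℝ)⁻¹ * ∑ x, p x * f x ^ 2 := by
  have hM' : (M : ℝ) ≠ 0 := by positivity
  set m := ∑ y, p y * f y with hm
  have h0 : ∑ x, p x * (f x - m) = 0 := by
    simp only [mul_sub]
    rw [sum_sub_distrib, ← sum_mul, hp, ← hm]; ring
  have h1 := E_var hp (fun x => f x - m) h0 M
  have h2 : ∀ c : Fin M → X, (∏ j, p (c j)) * ((M : ℝ)⁻¹ * ∑ j, f (c j) - m) ^ 2 =
      ((M : ℝ)⁻¹) ^ 2 * ((∏ j, p (c j)) * (∑ j, (f (c j) - m)) ^ 2) := by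
    intro c
    rw [sum_sub_distrib]
    simp only [sum_const, card_univ, Fintype.card_fin, nsmul_eq_mul]
    field_simp
  rw [sum_congr rfl fun c _ => h2 c, ← mul_sum, h1]
  have h3 := var_le hp f
  rw [← hm] at h3
  have : ((M : ℝ)⁻¹) ^ 2 * (M * ∑ x, p x * (f x - m) ^ 2) = (M : ℝ)⁻¹ * ∑ x, p x * (f x - m) ^ 2 := by
    field_simp
  rw [this]
  exact mul_le_mul_of_nonneg_left h3 (by positivity)

lemma frob_eq {ι κ : Type*} [Fintype ι] [Fintype κ] (A : Matrix ι κ ℂ) :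
    (Aᴴ * A).trace.re = ∑ j, ∑ i, ((A i j).re ^ 2 + (A i j).im ^ 2) := by
  simp only [Matrix.trace, Matrix.diag, Matrix.mul_apply, conjTranspose_apply, Complex.re_sum]
  refine sum_congr rfl fun j _ => sum_congr rfl fun i _ => ?_
  simp [Complex.mul_re]; ring

lemma E_mat {ι : Type*} [Fintype ι] {p : X → ℝ} (hp : ∑ x, p x = 1)
    (ξ : X → Matrix ι ι ℂ) {M : ℕ} (hM : 0 < M) :
    ∑ c : Fin M → X, (∏ j, p (c j)) *
      ((((M : ℝ)⁻¹ : ℂ) • (∑ j, ξ (c j)) - ∑ y, (p y : ℂ) • ξ y)ᴴ *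
        (((M : ℝ)⁻¹ : ℂ) • (∑ j, ξ (c j)) - ∑ y, (p y : ℂ) • ξ y)).trace.re
      ≤ (M : ℝ)⁻¹ * ∑ x, p x * ((ξ x)ᴴ * ξ x).trace.re := by
  simp only [frob_eq, mul_sum, mul_add]
  rw [sum_comm]
  conv_rhs => rw [sum_comm]
  refine sum_le_sum fun j _ => ?_
  rw [sum_comm]
  conv_rhs => rw [sum_comm]
  refine sum_le_sum fun i _ => ?_
  rw [sum_add_distrib, sum_add_distrib]
  have a1 := E_avg hp (fun x => (ξ x i j).re) hM
  have a2 := E_avg hp (fun x => (ξ x i j).im) hM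
  rw [mul_sum] at a1 a2
  refine add_le_add (le_of_eq_of_le (sum_congr rfl fun c _ => ?_) a1)
    (le_of_eq_of_le (sum_congr rfl fun c _ => ?_) a2)
  · rw [← Complex.ofReal_inv]
    simp [Matrix.sub_apply, Matrix.sum_apply, Matrix.smul_apply, Complex.re_sum]
  · rw [← Complex.ofReal_inv]
    simp [Matrix.sub_apply, Matrix.sum_apply, Matrix.smul_apply, Complex.im_sum]

lemma exists_le_avg {Y : Type*} [Fintype Y] (w f : Y → ℝ) (hw : ∀ y, 0 ≤ w y) (h1 : ∑ y, w y = 1)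
    {B : ℝ} (hB : ∑ y, w y * f y ≤ B) : ∃ y, f y ≤ B := by
  by_contra! hc
  have h2 : ∑ y, w y * B < ∑ y, w y * f y := by
    apply sum_lt_sum
    · exact fun y _ => mul_le_mul_of_nonneg_left (hc y).le (hw y)
    · by_contra! h3
      have : ∀ y, w y = 0 := fun y => by
        by_contra h4
        have := h3 y (mem_univ _)
        have := mul_lt_mul_of_pos_left (hc y) (lt_of_le_of_ne (hw y) (Ne.symm h4))
        linarith
      simp [this] at h1
  rw [← sum_mul, h1] at h2
  linarith

end prob

lemma aep {X I : Type*} [Fintype X] [Fintype I] [DecidableEq I] (p : X → ℝ) (hp0 : ∀ x, 0 ≤ p x)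
    (hp : ∑ x, p x = 1) (lam : X → I → ℝ) (h0 : ∀ x i, 0 ≤ lam x i) (h1 : ∀ x, ∑ i, lam x i ≤ 1)
    (h2 : ∀ x, p x * ∑ i, lam x i = p x) {δ ε : ℝ} (hδ : 0 < δ) (hε : 0 < ε) :
    ∃ N : ℕ, ∀ n ≥ N, ∃ S : (Fin n → X) → Finset (Fin n → I),
      (∀ x, ((S x).card : ℝ) ≤ Real.exp (n * ((∑ x, p x * ∑ i, Real.negMulLog (lam x i)) + δ))) ∧
      (∀ x, ∀ i ∈ S x, ∏ k, lam (x k) (i k) ≤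
        Real.exp (-(n * ((∑ x, p x * ∑ i, Real.negMulLog (lam x i)) - δ)))) ∧
      ∑ x, (∏ k, p (x k)) * ∑ i ∈ (S x)ᶜ, ∏ k, lam (x k) (i k) ≤ ε := by
  classical
  set H := ∑ x, p x * ∑ i, Real.negMulLog (lam x i) with hH
  set q : X × I → ℝ := fun z => p z.1 * lam z.1 z.2 with hq
  set f : X × I → ℝ := fun z => - Real.log (lam z.1 z.2) - H with hf
  have hq0 : ∀ z, 0 ≤ q z := fun z => mul_nonneg (hp0 _) (h0 _ _)
  have hq1 : ∑ z, q z = 1 := by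
    rw [Fintype.sum_prod_type]
    simp only [hq, ← mul_sum, h2, hp]
  have hqf : ∑ z, q z * f z = 0 := by
    have : ∀ z, q z * f z = p z.1 * Real.negMulLog (lam z.1 z.2) - q z * H := by
      intro z; simp only [hq, hf, Real.negMulLog]; ring
    rw [sum_congr rfl fun z _ => this z, sum_sub_distrib, ← sum_mul, hq1,
      Fintype.sum_prod_type]
    simp only [← mul_sum]
    rw [← hH]; ring
  set C := ∑ z, q z * f z ^ 2 with hC
  have hC0 : 0 ≤ C := sum_nonneg fun z _ => mul_nonneg (hq0 z) (sq_nonneg _)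
  refine ⟨⌈C / (δ ^ 2 * ε)⌉₊ + 1, fun n hn => ?_⟩
  have hn0 : (0 : ℝ) < n := by
    have : 0 < n := by omega
    exact_mod_cast this
  have hnC : C ≤ n * (δ ^ 2 * ε) := by
    rw [← div_le_iff₀ (by positivity)]
    exact (Nat.le_ceil _).trans (by exact_mod_cast (show ⌈C / (δ ^ 2 * ε)⌉₊ ≤ n by omega))
  set S : (Fin n → X) → Finset (Fin n → I) := fun x => univ.filter fun i =>
    (∀ k, 0 < lam (x k) (i k)) ∧ |∑ k, f (x k, i k)| ≤ n * δ with hS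
  have hlog : ∀ x, ∀ i ∈ S x, ∏ k, lam (x k) (i k) = Real.exp (-(∑ k, f (x k, i k) + n * H)) := by
    intro x i hi
    obtain ⟨ha, -⟩ := (mem_filter.mp hi).2
    have : -(∑ k, f (x k, i k) + n * H) = ∑ k, Real.log (lam (x k) (i k)) := by
      simp only [hf, sum_sub_distrib, sum_neg_distrib]
      simp
    rw [this, Real.exp_sum]
    exact prod_congr rfl fun k _ => (Real.exp_log (ha k)).symm
  have hprod1 : ∀ x : Fin n → X, ∑ i : Fin n → I, ∏ k, lam (x k) (i k) ≤ 1 := by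
    intro x
    rw [sum_prod_pi (fun k => lam (x k))]
    exact prod_le_one (fun k _ => sum_nonneg fun i _ => h0 _ _) (fun k _ => h1 _)
  refine ⟨S, fun x => ?_, fun x i hi => ?_, ?_⟩
  · have e1 : ((S x).card : ℝ) * Real.exp (-(n * (H + δ))) ≤ ∑ i ∈ S x, ∏ k, lam (x k) (i k) := by
      rw [← nsmul_eq_mul]
      refine card_nsmul_le_sum _ _ _ fun i hi => ?_
      rw [hlog x i hi]
      apply Real.exp_le_exp.mpr
      have := (abs_le.mp (mem_filter.mp hi).2.2).2
      linarith
    have e2 : ∑ i ∈ S x, ∏ k, lam (x k) (i k) ≤ 1 :=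
      (sum_le_univ_sum_of_nonneg fun i => prod_nonneg fun k _ => h0 _ _).trans (hprod1 x)
    have e3 := e1.trans e2
    rw [Real.exp_neg, ← div_eq_mul_inv, div_le_one (Real.exp_pos _)] at e3
    exact e3
  · rw [hlog x i hi]
    apply Real.exp_le_exp.mpr
    have := (abs_le.mp (mem_filter.mp hi).2.2).1
    linarith
  · have key : ∀ x : Fin n → X, ∀ i ∈ (S x)ᶜ, (∏ k, p (x k)) * ∏ k, lam (x k) (i k) ≤
        ((n * δ) ^ 2)⁻¹ * ((∏ k, q (x k, i k)) * (∑ k, f (x k, i k)) ^ 2) := by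
      intro x i hi
      have hqq : (∏ k, p (x k)) * ∏ k, lam (x k) (i k) = ∏ k, q (x k, i k) := by
        simp only [hq, prod_mul_distrib]
      rw [hqq]
      have hqn : 0 ≤ ∏ k, q (x k, i k) := prod_nonneg fun k _ => hq0 _
      have hnd : 0 < (n * δ) ^ 2 := by positivity
      simp only [hS, mem_compl, mem_filter, mem_univ, true_and, not_and_or] at hi
      rcases hi with hi | hi
      · push Not at hi
        obtain ⟨k, hk⟩ := hi
        have : ∏ k, q (x k, i k) = 0 := by
          refine prod_eq_zero (mem_univ k) ?_
          simp only [hq, le_antisymm hk (h0 _ _), mul_zero]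
        rw [this]; simp
      · push Not at hi
        have hsq : (n * δ) ^ 2 ≤ (∑ k, f (x k, i k)) ^ 2 := by
          rw [← sq_abs (∑ k, f (x k, i k))]
          exact pow_le_pow_left₀ (by positivity) hi.le 2
        rw [← mul_assoc, mul_comm _ (∏ k, q (x k, i k)), mul_assoc]
        refine le_mul_of_one_le_right hqn ?_
        rw [← div_eq_inv_mul, one_le_div hnd]; exact hsq
    calc ∑ x, (∏ k, p (x k)) * ∑ i ∈ (S x)ᶜ, ∏ k, lam (x k) (i k)
        ≤ ∑ x, ∑ i ∈ (S x)ᶜ, ((n * δ) ^ 2)⁻¹ * ((∏ k, q (x k, i k)) * (∑ k, f (x k, i k)) ^ 2) := by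
          refine sum_le_sum fun x _ => ?_
          rw [mul_sum]
          exact sum_le_sum fun i hi => key x i hi
      _ ≤ ∑ x : Fin n → X, ∑ i : Fin n → I, ((n * δ) ^ 2)⁻¹ * ((∏ k, q (x k, i k)) * (∑ k, f (x k, i k)) ^ 2) := by
          refine sum_le_sum fun x _ => sum_le_univ_sum_of_nonneg fun i => ?_
          have hqn : 0 ≤ ∏ k, q (x k, i k) := prod_nonneg fun k _ => hq0 _
          positivity
      _ = ((n * δ) ^ 2)⁻¹ * (n * C) := by
          rw [hC, ← E_var hq1 f hqf n, mul_sum, ← Fintype.sum_prod_type'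
            (fun (x : Fin n → X) (i : Fin n → I) => ((n * δ) ^ 2)⁻¹ * ((∏ k, q (x k, i k)) * (∑ k, f (x k, i k)) ^ 2))]
          exact (Fintype.sum_equiv (Equiv.arrowProdEquivProdArrow (Fin n) (fun _ => X) (fun _ => I)) _ _
            (fun _ => rfl)).symm
      _ ≤ ε := by
          rw [inv_mul_le_iff₀ (by positivity)]
          nlinarith

def nf {ι κ : Type*} [Fintype ι] [Fintype κ] (A : Matrix ι κ ℂ) : ℝ := (Aᴴ * A).trace.re

section nfs
variable {ι κ γ : Type*} [Fintype ι] [Fintype κ] [Fintype γ]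
  [DecidableEq ι] [DecidableEq κ] [DecidableEq γ]

lemma nf_nonneg (A : Matrix ι κ ℂ) : 0 ≤ nf A :=
  trace_re_nonneg (posSemidef_conjTranspose_mul_self A)

lemma nf_add_le (A B : Matrix ι κ ℂ) : nf (A + B) ≤ 2 * nf A + 2 * nf B := by
  have h := nf_nonneg (A - B)
  unfold nf at *
  simp only [conjTranspose_add, conjTranspose_sub, Matrix.add_mul, Matrix.mul_add, Matrix.sub_mul,
    Matrix.mul_sub, Matrix.trace_add, Matrix.trace_sub, Complex.add_re, Complex.sub_re] at *
  linarith

lemma tr_sub_le {W A : Matrix ι ι ℂ} (hW : (1 - W).PosSemidef) (hA : A.PosSemidef) :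
    (A * W).trace.re ≤ A.trace.re := by
  have := psd_tr_mul hA hW
  rw [Matrix.mul_sub, Matrix.mul_one, Matrix.trace_sub, Complex.sub_re] at this
  linarith

lemma nf_mul_right (A : Matrix ι κ ℂ) (B : Matrix κ γ ℂ) (hB : (1 - B * Bᴴ).PosSemidef) :
    nf (A * B) ≤ nf A := by
  unfold nf
  have : ((A * B)ᴴ * (A * B)).trace = (Aᴴ * A * (B * Bᴴ)).trace := by
    rw [conjTranspose_mul, Matrix.mul_assoc, Matrix.trace_mul_comm]
    simp only [Matrix.mul_assoc]
  rw [this]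
  exact tr_sub_le hB (posSemidef_conjTranspose_mul_self A)

lemma nf_eq (A : Matrix ι κ ℂ) : nf A = (A * Aᴴ).trace.re := by
  unfold nf; rw [Matrix.trace_mul_comm]

lemma nf_mul_left (V : Matrix γ ι ℂ) (A : Matrix ι κ ℂ) (hV : (1 - Vᴴ * V).PosSemidef) :
    nf (V * A) ≤ nf A := by
  have h1 : nf (V * A) = nf (Aᴴ * Vᴴ) := by
    rw [nf_eq, nf, conjTranspose_mul, conjTranspose_mul, conjTranspose_conjTranspose,
      conjTranspose_conjTranspose]
  have h2 : nf A = nf Aᴴ := by rw [nf_eq, nf, conjTranspose_conjTranspose]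
  rw [h1, h2]
  apply nf_mul_right
  rwa [conjTranspose_conjTranspose]

lemma nf_smul (c : ℝ) (A : Matrix ι κ ℂ) : nf ((c : ℂ) • A) = c ^ 2 * nf A := by
  unfold nf
  rw [conjTranspose_smul, Matrix.smul_mul, Matrix.mul_smul, smul_smul, Matrix.trace_smul]
  simp [← Complex.ofReal_mul]
  left; ring
end nfs

section condA
variable {a b : Type*} [Fintype a] [DecidableEq a] [Fintype b] [DecidableEq b]

def condA (ρ : Matrix (a × b) (a × b) ℂ) (Q : Matrix b b ℂ) : Matrix a a ℂ :=
  condB (ρ.submatrix Prod.swap Prod.swap) Q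

variable {ρ : Matrix (a × b) (a × b) ℂ}

lemma condA_psd (h : ρ.PosSemidef) {Q : Matrix b b ℂ} (hQ : Q.PosSemidef) : (condA ρ Q).PosSemidef :=
  condB_psd (h.submatrix _) hQ

lemma condA_one : condA ρ 1 = ptraceRight ρ := by
  rw [condA, condB_one]; rfl

lemma condB_tr_mul (L : Matrix a a ℂ) (Q : Matrix b b ℂ) :
    (condB ρ L * Q).trace = (L * condA ρ Q).trace := by
  simp only [condA, condB, Matrix.trace, Matrix.diag, Matrix.mul_apply, submatrix_apply, Prod.swap,
    sum_mul, mul_sum]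
  have e1 : ∀ f : b → b → a → a → ℂ, ∑ i, ∑ j, ∑ x, ∑ y, f i j x y = ∑ x, ∑ y, ∑ i, ∑ j, f i j x y := by
    intro f
    calc _ = ∑ i, ∑ x, ∑ j, ∑ y, f i j x y := sum_congr rfl fun i _ => sum_comm
      _ = ∑ x, ∑ i, ∑ j, ∑ y, f i j x y := sum_comm
      _ = ∑ x, ∑ i, ∑ y, ∑ j, f i j x y := sum_congr rfl fun i _ =>
        sum_congr rfl fun i _ => sum_comm
      _ = _ := sum_congr rfl fun i _ => sum_comm
  rw [e1]
  refine sum_congr rfl fun x _ => sum_congr rfl fun y _ => ?_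
  rw [sum_comm]
  refine sum_congr rfl fun i _ => sum_congr rfl fun j _ => ?_
  ring

lemma condB_sub_right (L : Matrix a a ℂ) (Q : Matrix b b ℂ) :
    (condB ρ L * (1 - Q)).trace.re = (L * ptraceRight ρ).trace.re - (L * condA ρ Q).trace.re := by
  rw [Matrix.mul_sub, Matrix.trace_sub, Matrix.mul_one, condB_tr_mul, condB_trace, Complex.sub_re]

lemma exists_N (h : ρ.PosSemidef) {r : Matrix a a ℂ} (hr : r.PosSemidef) (hrr : r * r = ptraceRight ρ)
    {Q : Matrix b b ℂ} (hQ : Q.PosSemidef) (hQ1 : (1 - Q).PosSemidef) :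
    ∃ n : Matrix a a ℂ, condA ρ Q = r * (nᴴ * n) * r ∧ (1 - nᴴ * n).PosSemidef := by
  obtain ⟨t, ht⟩ := exists_factor (condA_psd h hQ)
  obtain ⟨w, hw⟩ := exists_factor (condA_psd h hQ1)
  have hsum : condA ρ Q + condA ρ (1 - Q) = r * r := by
    rw [hrr, ← condA_one]
    ext i j
    simp only [condA, condB, Matrix.add_apply, Matrix.sub_apply, sub_mul, sum_sub_distrib]
    ring
  obtain ⟨V, hV1, hV2, -⟩ := polar (Matrix.fromRows t w) hr (by
    rw [conjTranspose_fromRows_eq_fromCols_conjTranspose, fromCols_mul_fromRows, ← ht, ← hw, hsum])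
  refine ⟨V.toRows₁, ?_, ?_⟩
  · have : V.toRows₁ * r = t := by
      ext i j
      have := congrFun (congrFun hV2 (Sum.inl i)) j
      simpa [Matrix.mul_apply] using this
    rw [ht, ← this, conjTranspose_mul, hr.1.eq]
    simp only [Matrix.mul_assoc]
  · have : 1 - V.toRows₁ᴴ * V.toRows₁ = (1 - Vᴴ * V) + V.toRows₂ᴴ * V.toRows₂ := by
      have : Vᴴ * V = V.toRows₁ᴴ * V.toRows₁ + V.toRows₂ᴴ * V.toRows₂ := by
        rw [← fromCols_mul_fromRows, ← conjTranspose_fromRows_eq_fromCols_conjTranspose, fromRows_toRows]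
      rw [this]; abel
    rw [this]
    exact hV1.add (posSemidef_conjTranspose_mul_self _)
end condA

section det
variable {a : Type*} [Fintype a] [DecidableEq a]

lemma code_det {M G : ℕ} (hM : 0 < M) {T r Pi : Matrix a a ℂ} (hr : r.PosSemidef) (hrr : r * r = T)
    (hT : T.trace = 1) (hPiH : Piᴴ = Pi) (hPi2 : Pi * Pi = Pi)
    (K : Fin M → Matrix (Fin G) a ℂ) (nn : Fin M → Matrix a a ℂ)
    (hnn : ∀ j, (1 - (nn j)ᴴ * nn j).PosSemidef)
    {Y : Matrix a a ℂ}
    (hY1 : (Y - (T - ((M : ℝ)⁻¹ : ℂ) • ∑ j, (K j * Pi)ᴴ * (K j * Pi))).PosSemidef)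
    (hY2 : (Y + (T - ((M : ℝ)⁻¹ : ℂ) • ∑ j, (K j * Pi)ᴴ * (K j * Pi))).PosSemidef) :
    ∃ V : Fin M → Matrix (Fin G) a ℂ, (1 - ∑ j, (V j)ᴴ * V j).PosSemidef ∧
      1 - (3 * Y.trace.re + 2 * ((M : ℝ)⁻¹ * ∑ j, (2 * nf (K j * (nn j)ᴴ) + 2 * nf (K j * (1 - Pi)))))
      ≤ ∑ j, (((V j)ᴴ * V j * T).trace.re - ((V j)ᴴ * V j * (r * ((nn j)ᴴ * nn j) * r)).trace.re) := by
  set m : ℝ := Real.sqrt ((M : ℝ)⁻¹) with hm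
  have hm2 : m * m = (M : ℝ)⁻¹ := Real.mul_self_sqrt (by positivity)
  set L : Matrix (Fin M × Fin G) a ℂ := Matrix.of fun z i => (m : ℂ) * (K z.1 * Pi) z.2 i with hL
  have stack : ∀ W : Matrix (Fin M × Fin G) a ℂ,
      Wᴴ * W = ∑ j, (Matrix.of fun g i => W (j, g) i)ᴴ * (Matrix.of fun g i => W (j, g) i) := by
    intro W
    ext i i'
    simp only [Matrix.mul_apply, Matrix.sum_apply, conjTranspose_apply, Matrix.of_apply,
      Fintype.sum_prod_type]
  have hω : ((M : ℝ)⁻¹ : ℂ) • ∑ j, (K j * Pi)ᴴ * (K j * Pi) = Lᴴ * L := by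
    rw [stack, smul_sum]
    refine sum_congr rfl fun j _ => ?_
    have : (Matrix.of fun g i => L (j, g) i) = (m : ℂ) • (K j * Pi) := by
      ext g i; simp [hL]
    rw [this, conjTranspose_smul, Matrix.smul_mul, Matrix.mul_smul, smul_smul]
    congr 1
    rw [← Complex.ofReal_inv, ← hm2]; simp
  rw [hω] at hY1 hY2
  have hωp := posSemidef_conjTranspose_mul_self L
  set s := hωp.sqrt with hs
  have hsp : s.PosSemidef := sqrt_psd hωp
  have hss : s * s = Lᴴ * L := sqrt_mul_self' hωp
  obtain ⟨V, hV1, hV2, hV3⟩ := polar L hsp hss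
  set Δ := r - s with hΔ
  have hΔH : Δᴴ = Δ := by rw [hΔ, conjTranspose_sub, hr.1.eq, hsp.1.eq]
  have hPS : nf Δ ≤ Y.trace.re := by
    rw [nf, hΔH]
    exact powers_stormer hr hsp (by rw [hrr, hss]; exact hY1) (by rw [hrr, hss]; exact hY2)
  set Vj : Fin M → Matrix (Fin G) a ℂ := fun j => Matrix.of fun g i => V (j, g) i with hVj
  have hVV : ∑ j, (Vj j)ᴴ * Vj j = Vᴴ * V := (stack V).symm
  have hVjs : ∀ j, Vj j * s = (m : ℂ) • (K j * Pi) := by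
    intro j
    ext g i
    have := congrFun (congrFun hV2 (j, g)) i
    simpa [hL, hVj, Matrix.mul_apply] using this
  refine ⟨Vj, by rw [hVV]; exact hV1, ?_⟩
  rw [sum_sub_distrib]
  have A1 : 1 - nf Δ ≤ ∑ j, ((Vj j)ᴴ * Vj j * T).trace.re := by
    rw [← Complex.re_sum, ← Matrix.trace_sum, ← Matrix.sum_mul, hVV]
    set W := 1 - Vᴴ * V with hW
    have hWs : W * s = 0 := by rw [hW, Matrix.sub_mul, hV3, Matrix.one_mul, sub_self]
    have hsW : s * W = 0 := by
      have := congrArg conjTranspose hWs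
      rwa [conjTranspose_mul, hsp.1.eq, hV1.1.eq, conjTranspose_zero] at this
    have e0 : r = Δ + s := by rw [hΔ]; abel
    have e1 : (W * T).trace = (W * (Δ * Δ)).trace := by
      have h1 : W * r = W * Δ := by rw [e0, Matrix.mul_add, hWs, add_zero]
      have h2 : r * W = Δ * W := by rw [e0, Matrix.add_mul, hsW, add_zero]
      rw [← hrr, ← Matrix.mul_assoc, Matrix.trace_mul_comm, ← Matrix.mul_assoc, h2, Matrix.mul_assoc, h1,
        Matrix.trace_mul_comm, Matrix.mul_assoc]
    have e2 : (Vᴴ * V * T).trace.re = 1 - (W * T).trace.re := by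
      rw [hW, Matrix.sub_mul, Matrix.trace_sub, Matrix.one_mul, hT]; simp
    have e3 : (W * (Δ * Δ)).trace.re ≤ nf Δ := by
      rw [Matrix.trace_mul_comm]
      refine (tr_sub_le ?_ ?_).trans (le_of_eq ?_)
      · rw [hW, sub_sub_cancel]; exact posSemidef_conjTranspose_mul_self V
      · nth_rewrite 1 [← hΔH]; exact posSemidef_conjTranspose_mul_self Δ
      · rw [nf, hΔH]
    rw [e2, e1]; linarith
  have A2 : ∀ j, ((Vj j)ᴴ * Vj j * (r * ((nn j)ᴴ * nn j) * r)).trace.re ≤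
      2 * ((M : ℝ)⁻¹ * (2 * nf (K j * (nn j)ᴴ) + 2 * nf (K j * (1 - Pi)))) + 2 * nf (Vj j * Δ) := by
    intro j
    have e1 : ((Vj j)ᴴ * Vj j * (r * ((nn j)ᴴ * nn j) * r)).trace.re = nf (Vj j * r * (nn j)ᴴ) := by
      rw [nf_eq, conjTranspose_mul, conjTranspose_mul, conjTranspose_conjTranspose, hr.1.eq,
        Matrix.mul_assoc, Matrix.trace_mul_comm]
      simp only [Matrix.mul_assoc]
    have e2 : Vj j * r * (nn j)ᴴ = Vj j * s * (nn j)ᴴ + Vj j * Δ * (nn j)ᴴ := by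
      rw [hΔ, ← Matrix.add_mul, ← Matrix.mul_add, add_sub_cancel]
    have hn : (1 - (nn j)ᴴ * (nn j)ᴴᴴ).PosSemidef := by rw [conjTranspose_conjTranspose]; exact hnn j
    have e3 : nf (Vj j * Δ * (nn j)ᴴ) ≤ nf (Vj j * Δ) := nf_mul_right _ _ hn
    have e4 : nf (Vj j * s * (nn j)ᴴ) = (M : ℝ)⁻¹ * nf (K j * Pi * (nn j)ᴴ) := by
      rw [hVjs, Matrix.smul_mul, nf_smul, sq, hm2]
    have e5 : K j * Pi * (nn j)ᴴ = K j * (nn j)ᴴ + (-(K j * (1 - Pi))) * (nn j)ᴴ := by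
      rw [Matrix.mul_sub, Matrix.mul_one, ← Matrix.add_mul]; congr 1; abel
    have e6 : nf (K j * Pi * (nn j)ᴴ) ≤ 2 * nf (K j * (nn j)ᴴ) + 2 * nf (K j * (1 - Pi)) := by
      rw [e5]
      refine (nf_add_le _ _).trans ?_
      have := nf_mul_right (-(K j * (1 - Pi))) _ hn
      have h2 : nf (-(K j * (1 - Pi))) = nf (K j * (1 - Pi)) := by simp [nf]
      linarith
    rw [e1, e2]
    refine (nf_add_le _ _).trans ?_
    rw [e4]
    have := mul_le_mul_of_nonneg_left e6 (show (0:ℝ) ≤ (M : ℝ)⁻¹ by positivity)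
    linarith
  have A3 : ∑ j, nf (Vj j * Δ) ≤ nf Δ := by
    refine le_trans (le_of_eq ?_) (nf_mul_left V Δ hV1)
    unfold nf
    rw [← Complex.re_sum, ← Matrix.trace_sum]
    congr 2
    rw [conjTranspose_mul, Matrix.mul_assoc, ← Matrix.mul_assoc Vᴴ, ← hVV, Matrix.sum_mul, Matrix.mul_sum]
    refine sum_congr rfl fun j _ => ?_
    rw [conjTranspose_mul]; simp only [Matrix.mul_assoc]
  have A4 := sum_le_sum fun j (_ : j ∈ univ) => A2 j
  rw [sum_add_distrib, ← mul_sum, ← mul_sum, ← mul_sum] at A4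
  linarith
end det

section avg
variable {a b X : Type*} [Fintype a] [DecidableEq a] [Fintype b] [DecidableEq b]
  [Fintype X]

lemma coverY {T Pi X0 Z : Matrix a a ℂ} (hT : T.PosSemidef) (hPiH : Piᴴ = Pi) (hPi2 : Pi * Pi = Pi)
    (hc : Pi * T = T * Pi) (hA2 : (Pi * T * Pi - X0).PosSemidef) (hZ : Zᴴ = Z) (hZ1 : Pi * Z = Z)
    (hZ2 : Z * Pi = Z) {c : ℝ} (hc0 : 0 < c) :
    ∃ Y : Matrix a a ℂ, (Y - (T - (X0 + Z))).PosSemidef ∧ (Y + (T - (X0 + Z))).PosSemidef ∧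
      Y.trace.re = (T * (1 - Pi)).trace.re + (Pi * T * Pi - X0).trace.re + c / 2 * Pi.trace.re
        + 1 / (2 * c) * nf Z := by
  have hA1e : T - Pi * T * Pi = (1 - Pi)ᴴ * T * (1 - Pi) := by
    rw [conjTranspose_sub, conjTranspose_one, hPiH, hc, Matrix.mul_assoc, hPi2]
    simp only [Matrix.sub_mul, Matrix.mul_sub, Matrix.one_mul, Matrix.mul_one]
    rw [hc, Matrix.mul_assoc, hPi2]; abel
  have hA1 : (T - Pi * T * Pi).PosSemidef := by
    rw [hA1e]; exact hT.conjTranspose_mul_mul_same _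
  have hcc : (c : ℂ) ≠ 0 := by exact_mod_cast hc0.ne'
  have hs : (0 : ℂ) ≤ ((1 / (2 * c) : ℝ) : ℂ) := by
    rw [Complex.zero_le_real]; positivity
  refine ⟨(T - Pi * T * Pi) + (Pi * T * Pi - X0) + ((c / 2 : ℝ) : ℂ) • Pi
    + ((1 / (2 * c) : ℝ) : ℂ) • (Z * Z), ?_, ?_, ?_⟩
  · have : (T - Pi * T * Pi) + (Pi * T * Pi - X0) + ((c / 2 : ℝ) : ℂ) • Pi
      + ((1 / (2 * c) : ℝ) : ℂ) • (Z * Z) - (T - (X0 + Z)) =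
      ((1 / (2 * c) : ℝ) : ℂ) • (((c : ℂ) • Pi + Z)ᴴ * ((c : ℂ) • Pi + Z)) := by
      have e : ((c : ℂ) • Pi + Z)ᴴ = (c : ℂ) • Pi + Z := by
        rw [conjTranspose_add, conjTranspose_smul, hPiH, hZ]; simp
      rw [e]
      simp only [Matrix.add_mul, Matrix.mul_add, Matrix.smul_mul, Matrix.mul_smul, hPi2, hZ1, hZ2,
        smul_add, smul_smul]
      ext i j
      simp only [Matrix.add_apply, Matrix.sub_apply, Matrix.smul_apply, smul_eq_mul]
      push_cast
      field_simp
      ring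
    rw [this]
    exact (posSemidef_conjTranspose_mul_self _).smul hs
  · have : (T - Pi * T * Pi) + (Pi * T * Pi - X0) + ((c / 2 : ℝ) : ℂ) • Pi
      + ((1 / (2 * c) : ℝ) : ℂ) • (Z * Z) + (T - (X0 + Z)) =
      ((T - Pi * T * Pi) + (T - Pi * T * Pi)) + ((Pi * T * Pi - X0) + (Pi * T * Pi - X0)) +
      ((1 / (2 * c) : ℝ) : ℂ) • (((c : ℂ) • Pi - Z)ᴴ * ((c : ℂ) • Pi - Z)) := by
      have e : ((c : ℂ) • Pi - Z)ᴴ = (c : ℂ) • Pi - Z := by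
        rw [conjTranspose_sub, conjTranspose_smul, hPiH, hZ]; simp
      rw [e]
      simp only [Matrix.sub_mul, Matrix.mul_sub, Matrix.smul_mul, Matrix.mul_smul, hPi2, hZ1, hZ2,
        smul_sub, smul_smul]
      ext i j
      simp only [Matrix.add_apply, Matrix.sub_apply, Matrix.smul_apply, smul_eq_mul]
      push_cast
      field_simp
      ring
    rw [this]
    exact ((hA1.add hA1).add (hA2.add hA2)).add ((posSemidef_conjTranspose_mul_self _).smul hs)
  · have e1 : (T - Pi * T * Pi).trace = (T * (1 - Pi)).trace := by
      rw [hc, Matrix.mul_assoc, hPi2, Matrix.mul_sub, Matrix.mul_one]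
    rw [Matrix.trace_add, Matrix.trace_add, Matrix.trace_add, e1, Matrix.trace_smul, Matrix.trace_smul]
    simp only [Complex.add_re, smul_eq_mul, Complex.re_ofReal_mul]
    unfold nf; rw [hZ]

lemma psd_sq_le {S : Matrix a a ℂ} {μ : ℝ} (hS : S.PosSemidef) (h : ((μ : ℂ) • 1 - S).PosSemidef) :
    nf S ≤ μ * S.trace.re := by
  have := psd_tr_mul hS h
  rw [Matrix.mul_sub, Matrix.mul_smul, Matrix.mul_one, Matrix.trace_sub, Matrix.trace_smul,
    Complex.sub_re, smul_eq_mul, Complex.re_ofReal_mul] at this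
  unfold nf; rw [hS.1.eq]; linarith

lemma proj_compl_psd {Pi : Matrix a a ℂ} (hPiH : Piᴴ = Pi) (hPi2 : Pi * Pi = Pi) :
    (1 - Pi).PosSemidef := by
  have : 1 - Pi = (1 - Pi)ᴴ * (1 - Pi) := by
    rw [conjTranspose_sub, conjTranspose_one, hPiH]
    simp only [Matrix.sub_mul, Matrix.mul_sub, Matrix.one_mul, Matrix.mul_one, hPi2]; abel
  rw [this]; exact posSemidef_conjTranspose_mul_self _

lemma oneshot_code {ρ : Matrix (a × b) (a × b) ℂ} (h : IsDensity ρ) (Λ : POVM a X)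
    {r Pi : Matrix a a ℂ} (hr : r.PosSemidef) (hrr : r * r = ptraceRight ρ)
    {p : X → ℝ} (hp0 : ∀ x, 0 ≤ p x) (hp : ∑ x, p x = 1) {σ : X → Matrix a a ℂ}
    (hσ : ∀ x, (p x : ℂ) • σ x = r * Λ.elem x * r)
    {G : ℕ} (K : X → Matrix (Fin G) a ℂ) {μ : ℝ}
    (hK1 : ∀ x, (σ x - (K x)ᴴ * K x).PosSemidef)
    (hK2 : ∀ x, ((μ : ℂ) • 1 - (K x)ᴴ * K x).PosSemidef) (hμ : 0 ≤ μ)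
    (hPiH : Piᴴ = Pi) (hPi2 : Pi * Pi = Pi) (hPiT : Pi * ptraceRight ρ = ptraceRight ρ * Pi)
    {D : ℝ} (hD : 0 < D) (hPiD : Pi.trace.re ≤ D) {Q : X → Matrix b b ℂ}
    (hQ : ∀ x, (Q x).PosSemidef) (hQ1 : ∀ x, (1 - Q x).PosSemidef) {ε : ℝ}
    (e1 : (ptraceRight ρ * (1 - Pi)).trace.re ≤ ε)
    (e2 : ∑ x, p x * (σ x - (K x)ᴴ * K x).trace.re ≤ ε)
    (e3 : ∑ x, (condB ρ (Λ.elem x) * Q x).trace.re ≤ ε)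
    {M : ℕ} (hM : 0 < M) {t : ℝ} (ht : 0 < t) (hMt : D * μ / M ≤ t ^ 2) :
    ∃ c : Fin M → X, ∃ V : Fin M → Matrix (Fin G) a ℂ, (1 - ∑ j, (V j)ᴴ * V j).PosSemidef ∧
      1 - (14 * ε + 3 * t) ≤ ∑ j, (condB ρ ((V j)ᴴ * V j) * (1 - Q (c j))).trace.re := by
  classical
  have hM' : (0 : ℝ) < M := by exact_mod_cast hM
  obtain ⟨T, hTdef⟩ : ∃ T, T = ptraceRight ρ := ⟨_, rfl⟩
  rw [← hTdef] at hrr hPiT e1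
  have hT : T.PosSemidef := by rw [hTdef]; exact ptraceRight_psd h.1
  have hT1 : T.trace = 1 := by rw [hTdef, ptraceRight_trace, h.2]
  have hTσ : T = ∑ x, (p x : ℂ) • σ x := by
    simp only [hσ]
    rw [← sum_mul, ← mul_sum, Λ.sum_eq, Matrix.mul_one, hrr]
  choose nn hn1 hn2 using fun x => exists_N h.1 hr (by rw [hrr, hTdef]) (hQ x) (hQ1 x)
  obtain ⟨ξ, hξ⟩ : ∃ ξ : X → Matrix a a ℂ, ξ = fun x => (K x * Pi)ᴴ * (K x * Pi) := ⟨_, rfl⟩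
  obtain ⟨X0, hX0⟩ : ∃ X0, X0 = ∑ y, (p y : ℂ) • ξ y := ⟨_, rfl⟩
  have hξ' : ∀ x, ξ x = Pi * ((K x)ᴴ * K x) * Pi := fun x => by
    rw [hξ]; simp only [conjTranspose_mul, hPiH, Matrix.mul_assoc]
  have hξH : ∀ x, (ξ x)ᴴ = ξ x := fun x => by
    rw [hξ]; simp only [conjTranspose_mul, conjTranspose_conjTranspose]
  have hξ1 : ∀ x, Pi * ξ x = ξ x := fun x => by
    rw [hξ', ← Matrix.mul_assoc, ← Matrix.mul_assoc, hPi2]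
  have hξ2 : ∀ x, ξ x * Pi = ξ x := fun x => by
    rw [hξ', Matrix.mul_assoc, hPi2]
  obtain ⟨Z, hZ⟩ : ∃ Z : (Fin M → X) → Matrix a a ℂ,
    Z = fun c => ((M : ℝ)⁻¹ : ℂ) • (∑ j, ξ (c j)) - X0 := ⟨_, rfl⟩
  have hX0H : X0ᴴ = X0 := by
    rw [hX0, conjTranspose_sum]
    exact sum_congr rfl fun x _ => by rw [conjTranspose_smul, hξH]; simp
  have hZH : ∀ c, (Z c)ᴴ = Z c := fun c => by
    rw [hZ]; simp only [conjTranspose_sub, conjTranspose_smul, conjTranspose_sum, hξH, hX0H]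
    simp
  have hZ1 : ∀ c, Pi * Z c = Z c := fun c => by
    rw [hZ]; simp only [Matrix.mul_sub, Matrix.mul_smul, mul_sum, hξ1, hX0]
  have hZ2 : ∀ c, Z c * Pi = Z c := fun c => by
    rw [hZ]; simp only [Matrix.sub_mul, Matrix.smul_mul, sum_mul, hξ2, hX0]
  have hA2e : Pi * T * Pi - X0 = Piᴴ * (∑ x, (p x : ℂ) • (σ x - (K x)ᴴ * K x)) * Pi := by
    rw [hTσ, hX0, hPiH]
    simp only [hξ', mul_sum, sum_mul, ← sum_sub_distrib, smul_sub, Matrix.mul_sub,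
      Matrix.sub_mul, Matrix.mul_smul, Matrix.smul_mul]
  have hsp : (∑ x, (p x : ℂ) • (σ x - (K x)ᴴ * K x)).PosSemidef :=
    Matrix.posSemidef_sum _ fun x _ => (hK1 x).smul (Complex.zero_le_real.2 (hp0 x))
  have hA2 : (Pi * T * Pi - X0).PosSemidef := by
    rw [hA2e]; exact hsp.conjTranspose_mul_mul_same _
  have hPic := proj_compl_psd hPiH hPi2
  have hA2t : (Pi * T * Pi - X0).trace.re ≤ ε := by
    rw [hA2e, Matrix.trace_mul_comm, ← Matrix.mul_assoc, hPiH, hPi2, Matrix.trace_mul_comm]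
    refine (tr_sub_le hPic hsp).trans ?_
    rw [Matrix.trace_sum, Complex.re_sum]
    refine le_of_eq_of_le (sum_congr rfl fun x _ => ?_) e2
    rw [Matrix.trace_smul, smul_eq_mul, Complex.re_ofReal_mul]
  have hct : 0 < t / D := by positivity
  choose Y hY1 hY2 hY3 using fun c => coverY hT hPiH hPi2 hPiT hA2 (hZH c) (hZ1 c) (hZ2 c) hct
  have hXZ : ∀ c, X0 + Z c = ((M : ℝ)⁻¹ : ℂ) • ∑ j, (K (c j) * Pi)ᴴ * (K (c j) * Pi) := fun c => by
    rw [hZ, hξ]; simp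
  have hnfK1 : ∀ x, nf (K x * (nn x)ᴴ) ≤ (σ x * ((nn x)ᴴ * nn x)).trace.re := fun x => by
    have e : nf (K x * (nn x)ᴴ) = ((K x)ᴴ * K x * ((nn x)ᴴ * nn x)).trace.re := by
      unfold nf
      rw [conjTranspose_mul, conjTranspose_conjTranspose, Matrix.mul_assoc, Matrix.trace_mul_comm]
      simp only [Matrix.mul_assoc]
    have := psd_tr_mul (hK1 x) (posSemidef_conjTranspose_mul_self (nn x))
    rw [Matrix.sub_mul, Matrix.trace_sub, Complex.sub_re] at this
    rw [e]; linarith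
  have hnfK2 : ∀ x, nf (K x * (1 - Pi)) ≤ (σ x * (1 - Pi)).trace.re := fun x => by
    have e : nf (K x * (1 - Pi)) = ((K x)ᴴ * K x * (1 - Pi)).trace.re := by
      unfold nf
      have e0 : (1 - Pi) * (1 - Pi) = 1 - Pi := by
        simp only [Matrix.sub_mul, Matrix.mul_sub, Matrix.one_mul, Matrix.mul_one, hPi2]; abel
      rw [conjTranspose_mul, conjTranspose_sub, conjTranspose_one, hPiH, Matrix.mul_assoc,
        Matrix.trace_mul_comm, Matrix.mul_assoc, Matrix.mul_assoc, e0, Matrix.mul_assoc]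
    have := psd_tr_mul (hK1 x) hPic
    rw [Matrix.sub_mul, Matrix.trace_sub, Complex.sub_re] at this
    rw [e]; linarith
  have hs1 : ∑ x, p x * nf (K x * (nn x)ᴴ) ≤ ε := by
    refine (sum_le_sum fun x _ => mul_le_mul_of_nonneg_left (hnfK1 x) (hp0 x)).trans
      (le_of_eq_of_le (sum_congr rfl fun x _ => ?_) e3)
    rw [condB_tr_mul, hn1, ← Complex.re_ofReal_mul, ← smul_eq_mul, ← Matrix.trace_smul,
      ← Matrix.smul_mul, hσ, ← Matrix.mul_assoc (Λ.elem x), Matrix.trace_mul_comm _ r]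
    simp only [Matrix.mul_assoc]
  have hs2 : ∑ x, p x * nf (K x * (1 - Pi)) ≤ ε := by
    refine (sum_le_sum fun x _ => mul_le_mul_of_nonneg_left (hnfK2 x) (hp0 x)).trans
      (le_of_eq_of_le ?_ e1)
    rw [hTσ, sum_mul, Matrix.trace_sum, Complex.re_sum]
    refine sum_congr rfl fun x _ => ?_
    rw [Matrix.smul_mul, Matrix.trace_smul, smul_eq_mul, Complex.re_ofReal_mul]
  have hs3 : ∑ c : Fin M → X, (∏ j, p (c j)) * nf (Z c) ≤ μ / M := by
    have h1 := E_mat hp ξ hM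
    rw [← hX0] at h1
    have h2 : ∑ x, p x * ((ξ x)ᴴ * ξ x).trace.re ≤ ∑ x, p x * (μ * (σ x).trace.re) := by
      refine sum_le_sum fun x _ => mul_le_mul_of_nonneg_left ?_ (hp0 x)
      have hKp := posSemidef_conjTranspose_mul_self (K x)
      have a1 : nf (ξ x) ≤ μ * (ξ x).trace.re := by
        apply psd_sq_le
        · rw [hξ]; exact posSemidef_conjTranspose_mul_self _
        · have : (μ : ℂ) • 1 - ξ x = (μ : ℂ) • (1 - Pi) + Piᴴ * ((μ : ℂ) • 1 - (K x)ᴴ * K x) * Pi := by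
            rw [hξ', hPiH]
            simp only [Matrix.mul_sub, Matrix.sub_mul, Matrix.mul_smul, Matrix.smul_mul, Matrix.mul_one,
              hPi2, smul_sub]
            abel
          rw [this]
          exact (hPic.smul (Complex.zero_le_real.2 hμ)).add ((hK2 x).conjTranspose_mul_mul_same _)
      have a2 : (ξ x).trace.re ≤ ((K x)ᴴ * K x).trace.re := by
        rw [hξ', Matrix.mul_assoc, Matrix.trace_mul_comm, Matrix.mul_assoc, hPi2]
        exact tr_sub_le hPic hKp
      have a3 : ((K x)ᴴ * K x).trace.re ≤ (σ x).trace.re := by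
        have := trace_re_nonneg (hK1 x)
        rw [Matrix.trace_sub, Complex.sub_re] at this; linarith
      exact a1.trans (mul_le_mul_of_nonneg_left (a2.trans a3) hμ)
    have h3 : ∑ x, p x * (μ * (σ x).trace.re) = μ := by
      have : ∑ x, p x * (σ x).trace.re = 1 := by
        have := congrArg (fun A => (Matrix.trace A).re) hTσ
        simp only [hT1, Matrix.trace_sum, Complex.re_sum, Matrix.trace_smul, smul_eq_mul,
          Complex.re_ofReal_mul, Complex.one_re] at this
        exact this.symm
      calc _ = μ * ∑ x, p x * (σ x).trace.re := by
            rw [mul_sum]; exact sum_congr rfl fun x _ => by ring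
        _ = μ := by rw [this, mul_one]
    rw [h3] at h2
    have h4 : ∑ c : Fin M → X, (∏ j, p (c j)) * nf (Z c) ≤
        (M : ℝ)⁻¹ * ∑ x, p x * ((ξ x)ᴴ * ξ x).trace.re := by rw [hZ]; exact h1
    refine h4.trans ?_
    rw [div_eq_inv_mul]
    exact mul_le_mul_of_nonneg_left h2 (by positivity)
  obtain ⟨F, hF⟩ : ∃ F : (Fin M → X) → ℝ, F = fun c => 3 * (Y c).trace.re +
    2 * ((M : ℝ)⁻¹ * ∑ j, (2 * nf (K (c j) * (nn (c j))ᴴ) + 2 * nf (K (c j) * (1 - Pi)))) := ⟨_, rfl⟩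
  have hFavg : ∑ c, (∏ j, p (c j)) * F c ≤ 14 * ε + 3 * t := by
    have hlin := E_lin hp (fun x => 2 * nf (K x * (nn x)ᴴ) + 2 * nf (K x * (1 - Pi))) M
    have hF2 : ∀ c, (∏ j, p (c j)) * F c = (∏ j, p (c j)) * (3 * ((T * (1 - Pi)).trace.re +
        (Pi * T * Pi - X0).trace.re + t / D / 2 * Pi.trace.re)) + 3 * (1 / (2 * (t / D))) *
        ((∏ j, p (c j)) * nf (Z c)) + 2 * (M : ℝ)⁻¹ * ((∏ j, p (c j)) *
        ∑ j, (2 * nf (K (c j) * (nn (c j))ᴴ) + 2 * nf (K (c j) * (1 - Pi)))) := fun c => by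
      rw [hF]; simp only [hY3]; ring
    rw [sum_congr rfl fun c _ => hF2 c, sum_add_distrib, sum_add_distrib,
      ← sum_mul, w_sum hp, ← mul_sum, ← mul_sum, hlin]
    have b1 : t / D / 2 * Pi.trace.re ≤ t / 2 := by
      calc _ ≤ t / D / 2 * D := mul_le_mul_of_nonneg_left hPiD (by positivity)
        _ = t / 2 := by field_simp
    have b2 : 1 / (2 * (t / D)) * ∑ c : Fin M → X, (∏ j, p (c j)) * nf (Z c) ≤ t / 2 := by
      calc _ ≤ 1 / (2 * (t / D)) * (μ / M) := mul_le_mul_of_nonneg_left hs3 (by positivity)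
        _ = (D * μ / M) / (2 * t) := by field_simp
        _ ≤ t ^ 2 / (2 * t) := by gcongr
        _ = t / 2 := by field_simp
    have b3 : 2 * (M : ℝ)⁻¹ * (M * ∑ x, p x * (2 * nf (K x * (nn x)ᴴ) + 2 * nf (K x * (1 - Pi)))) ≤
        8 * ε := by
      have : ∑ x, p x * (2 * nf (K x * (nn x)ᴴ) + 2 * nf (K x * (1 - Pi))) =
          2 * ∑ x, p x * nf (K x * (nn x)ᴴ) + 2 * ∑ x, p x * nf (K x * (1 - Pi)) := by
        rw [mul_sum, mul_sum, ← sum_add_distrib]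
        exact sum_congr rfl fun x _ => by ring
      have e : 2 * (M : ℝ)⁻¹ * (M * ∑ x, p x * (2 * nf (K x * (nn x)ᴴ) + 2 * nf (K x * (1 - Pi)))) =
          2 * ∑ x, p x * (2 * nf (K x * (nn x)ᴴ) + 2 * nf (K x * (1 - Pi))) := by field_simp
      rw [e, this]; linarith
    linarith
  obtain ⟨c, hc⟩ := exists_le_avg (fun c : Fin M → X => ∏ j, p (c j)) F
    (fun c => prod_nonneg fun j _ => hp0 _) (w_sum hp M) hFavg
  obtain ⟨V, hV1, hV2⟩ := code_det hM hr hrr hT1 hPiH hPi2 (fun j => K (c j)) (fun j => nn (c j))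
    (fun j => hn2 (c j)) (Y := Y c) (by rw [← hXZ]; exact hY1 c) (by rw [← hXZ]; exact hY2 c)
  refine ⟨c, V, hV1, ?_⟩
  rw [hF] at hc
  simp only at hc
  refine le_trans (by linarith) (hV2.trans (le_of_eq (sum_congr rfl fun j _ => ?_)))
  rw [condB_sub_right, hn1, hTdef]
end avg

def ud {ι : Type*} [Fintype ι] [DecidableEq ι] (U : Matrix ι ι ℂ) (d : ι → ℝ) : Matrix ι ι ℂ :=
  U * diagonal (fun i => (d i : ℂ)) * Uᴴ

section ud
variable {ι : Type*} [Fintype ι] [DecidableEq ι] {U : Matrix ι ι ℂ}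

lemma ud_psd (U : Matrix ι ι ℂ) {d : ι → ℝ} (hd : ∀ i, 0 ≤ d i) : (ud U d).PosSemidef := by
  have : (diagonal (fun i => (d i : ℂ))).PosSemidef :=
    Matrix.PosSemidef.diagonal fun i => Complex.zero_le_real.2 (hd i)
  exact this.mul_mul_conjTranspose_same U

lemma ud_sub (d e : ι → ℝ) : ud U d - ud U e = ud U (fun i => d i - e i) := by
  unfold ud
  rw [← Matrix.sub_mul, ← Matrix.mul_sub, Matrix.diagonal_sub]
  simp

lemma ud_const (hU : U * Uᴴ = 1) (c : ℝ) : ud U (fun _ => c) = (c : ℂ) • 1 := by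
  unfold ud
  rw [← hU, ← Matrix.smul_mul, ← Matrix.smul_one_eq_diagonal, Matrix.mul_smul, Matrix.mul_one]

lemma ud_one (hU : U * Uᴴ = 1) : ud U (fun _ => 1) = 1 := by
  rw [ud_const hU]; simp

lemma ud_mul (hU : Uᴴ * U = 1) (d e : ι → ℝ) : ud U d * ud U e = ud U (fun i => d i * e i) := by
  unfold ud
  calc _ = U * diagonal (fun i => (d i : ℂ)) * (Uᴴ * U) * diagonal (fun i => (e i : ℂ)) * Uᴴ := by
        simp only [Matrix.mul_assoc]
    _ = _ := by rw [hU, Matrix.mul_one, Matrix.mul_assoc U, Matrix.diagonal_mul_diagonal]; simp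

lemma ud_trace (hU : Uᴴ * U = 1) (d : ι → ℝ) : (ud U d).trace.re = ∑ i, d i := trace_diag U hU d

lemma ud_tr_ind (S : Finset ι) (A : Matrix ι ι ℂ) :
    (A * ud U (fun i => if i ∈ S then 1 else 0)).trace.re = ∑ i ∈ S, ((Uᴴ * A * U) i i).re := by
  unfold ud
  rw [← Matrix.mul_assoc, ← Matrix.mul_assoc, Matrix.trace_mul_comm, ← Matrix.mul_assoc,
    ← Matrix.mul_assoc, Matrix.trace, Complex.re_sum, ← sum_filter_add_sum_filter_not _ (· ∈ S)]
  rw [sum_eq_zero (s := univ.filter (¬ · ∈ S)), add_zero]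
  · rw [filter_mem_eq_inter, univ_inter]
    refine sum_congr rfl fun i hi => ?_
    simp [Matrix.mul_diagonal, hi]
  · intro i hi
    simp [Matrix.mul_diagonal, (mem_filter.1 hi).2]

lemma ud_factor (U : Matrix ι ι ℂ) {d : ι → ℝ} (hd : ∀ i, 0 ≤ d i) (S : Finset ι) {G : ℕ} (hS : S.card ≤ G) :
    ∃ K : Matrix (Fin G) ι ℂ, Kᴴ * K = ud U (fun i => if i ∈ S then d i else 0) := by
  obtain ⟨e⟩ : Nonempty (S ↪ Fin G) := Function.Embedding.nonempty_of_card_le (by simpa using hS)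
  let F : Matrix (Fin G) ι ℂ := Matrix.of fun g i =>
    if h : i ∈ S then (if e ⟨i, h⟩ = g then (Real.sqrt (d i) : ℂ) else 0) else 0
  have hF : Fᴴ * F = diagonal (fun i => ((if i ∈ S then d i else 0 : ℝ) : ℂ)) := by
    ext i j
    rw [Matrix.mul_apply, Matrix.diagonal_apply]
    simp only [F, conjTranspose_apply, Matrix.of_apply]
    by_cases hi : i ∈ S
    · by_cases hj : j ∈ S
      · by_cases hij : i = j
        · subst hij
          simp [hi, ← Complex.ofReal_mul, Real.mul_self_sqrt (hd i)]
        · have : ∀ g, e ⟨i, hi⟩ = g → e ⟨j, hj⟩ = g → False := fun g h1 h2 => by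
            have := e.injective (h1.trans h2.symm)
            simp at this; exact hij this
          simp only [hi, hj, dif_pos, hij, if_false]
          refine sum_eq_zero fun g _ => ?_
          by_cases h1 : e ⟨i, hi⟩ = g
          · rw [if_neg (fun h2 => this g h1 h2), mul_zero]
          · simp [h1]
      · have : i ≠ j := fun h => hj (h ▸ hi)
        simp [hj, this]
    · simp [hi]
  refine ⟨F * Uᴴ, ?_⟩
  rw [conjTranspose_mul, conjTranspose_conjTranspose, Matrix.mul_assoc, ← Matrix.mul_assoc Fᴴ, hF,
    ← Matrix.mul_assoc]; rfl

lemma tp_ud {n : ℕ} (U : Fin n → Matrix ι ι ℂ) (d : Fin n → ι → ℝ) :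
    tp (fun k => ud (U k) (d k)) = ud (tp U) (fun i => ∏ k, d k (i k)) := by
  unfold ud
  rw [← tp_mul, ← tp_mul, tp_diagonal, tp_conjTranspose]
  simp

lemma tp_smul {n : ℕ} {κ : Type*} (c : Fin n → ℝ) (f : Fin n → Matrix ι κ ℂ) :
    tp (fun k => (c k : ℂ) • f k) = ((∏ k, c k : ℝ) : ℂ) • tp f := by
  ext i j
  simp [tp_apply, prod_mul_distrib]
end ud

lemma ensemble {ι X : Type*} [Fintype ι] [DecidableEq ι] [Fintype X] {A : X → Matrix ι ι ℂ}
    (hA : ∀ x, (A x).PosSemidef) (h1 : ∑ x, (A x).trace.re = 1) :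
    ∃ (U : X → Matrix ι ι ℂ) (lam : X → ι → ℝ), (∀ x, (U x)ᴴ * U x = 1) ∧ (∀ x, U x * (U x)ᴴ = 1) ∧
      (∀ x i, 0 ≤ lam x i) ∧ (∀ x, ∑ i, lam x i ≤ 1) ∧
      (∀ x, (A x).trace.re * ∑ i, lam x i = (A x).trace.re) ∧
      (∀ x, ((A x).trace.re : ℂ) • ud (U x) (lam x) = A x) ∧
      ∑ x, entropy (A x) = ∑ x, Real.negMulLog (A x).trace.re +
        ∑ x, (A x).trace.re * ∑ i, Real.negMulLog (lam x i) ∧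
      ∑ x, (A x).trace.re * ∑ i, Real.negMulLog (lam x i) ≤ entropy (∑ x, A x) := by
  choose U d hU1 hU2 hd hAd using fun x => psd_diag (hA x)
  have hp : ∀ x, (A x).trace.re = ∑ i, d x i := fun x => by
    conv_lhs => rw [hAd x]
    exact trace_diag _ (hU1 x) _
  obtain ⟨p, hpd⟩ : ∃ p : X → ℝ, ∀ x, (A x).trace.re = p x := ⟨_, fun _ => rfl⟩
  simp only [hpd] at hp h1 ⊢
  have hp0 : ∀ x, 0 ≤ p x := fun x => by rw [hp]; exact sum_nonneg fun i _ => hd x i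
  have hz : ∀ x, p x = 0 → ∀ i, d x i = 0 := fun x h i => by
    rw [hp] at h
    exact (sum_eq_zero_iff_of_nonneg fun i _ => hd x i).1 h i (mem_univ _)
  have hpl : ∀ x i, p x * ((p x)⁻¹ * d x i) = d x i := fun x i => by
    by_cases h : p x = 0
    · rw [hz x h]; simp
    · field_simp
  have hA' : ∀ x, (p x : ℂ) • ud (U x) (fun i => (p x)⁻¹ * d x i) = A x := fun x => by
    conv_rhs => rw [hAd x]
    unfold ud
    rw [← Matrix.smul_mul, ← Matrix.mul_smul]
    congr 2
    ext i j
    rw [Matrix.smul_apply, Matrix.diagonal_apply, Matrix.diagonal_apply]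
    split_ifs with h
    · rw [smul_eq_mul, ← Complex.ofReal_mul, hpl]
    · simp
  have hls : ∀ x, ∑ i, (p x)⁻¹ * d x i = (p x)⁻¹ * p x := fun x => by rw [← mul_sum, ← hp]
  refine ⟨U, fun x i => (p x)⁻¹ * d x i, hU1, hU2, fun x i => mul_nonneg (inv_nonneg.2 (hp0 x)) (hd x i),
    fun x => ?_, fun x => ?_, hA', ?_, ?_⟩
  · rw [hls]
    by_cases h : p x = 0
    · simp [h]
    · rw [inv_mul_cancel₀ h]
  · rw [hls]
    by_cases h : p x = 0
    · simp [h]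
    · rw [inv_mul_cancel₀ h, mul_one]
  · rw [← sum_add_distrib]
    refine sum_congr rfl fun x _ => ?_
    rw [hAd x, entropy_diag _ (hU1 x)]
    have : ∀ i, Real.negMulLog (d x i) = (p x)⁻¹ * d x i * Real.negMulLog (p x) +
        p x * Real.negMulLog ((p x)⁻¹ * d x i) := fun i => by
      rw [← Real.negMulLog_mul, hpl]
    rw [sum_congr rfl fun i _ => this i, sum_add_distrib, ← sum_mul, hls,
      ← mul_sum]
    congr 1
    by_cases h : p x = 0
    · simp [h]
    · rw [inv_mul_cancel₀ h, one_mul]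
  · obtain ⟨O, τ, hO1, hO2, hτ, hT⟩ := psd_diag (Matrix.posSemidef_sum univ fun x _ => hA x)
    have e1 : entropy (∑ x, A x) = ∑ i, Real.negMulLog (∑ x, p x *
        ((Oᴴ * ud (U x) (fun i => (p x)⁻¹ * d x i) * O) i i).re) := by
      have : ∀ i, ∑ x, p x * ((Oᴴ * ud (U x) (fun i => (p x)⁻¹ * d x i) * O) i i).re = τ i := by
        intro i
        have h2 : Oᴴ * (∑ x, A x) * O = diagonal (fun i => (τ i : ℂ)) := by
          rw [hT]
          calc _ = (Oᴴ * O) * diagonal (fun i => (τ i : ℂ)) * (Oᴴ * O) := by simp only [Matrix.mul_assoc]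
            _ = _ := by rw [hO1]; simp
        have h3 := congrArg (fun M => (M i i).re) h2
        simp only [diagonal_apply_eq, Complex.ofReal_re] at h3
        rw [← h3, mul_sum, sum_mul, Matrix.sum_apply, Complex.re_sum]
        refine sum_congr rfl fun x _ => ?_
        conv_rhs => rw [← hA' x, Matrix.mul_smul, Matrix.smul_mul, Matrix.smul_apply, smul_eq_mul,
          Complex.re_ofReal_mul]
      simp only [this]
      rw [hT, entropy_diag _ hO1]
    rw [e1]
    have hps : ∀ x, (ud (U x) (fun i => (p x)⁻¹ * d x i)).PosSemidef := fun x =>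
      ud_psd _ fun i => mul_nonneg (inv_nonneg.2 (hp0 x)) (hd x i)
    have hps' : ∀ x, (Oᴴ * ud (U x) (fun i => (p x)⁻¹ * d x i) * O).PosSemidef := fun x =>
      (hps x).conjTranspose_mul_mul_same O
    have e2 : ∀ x, ∑ i, Real.negMulLog ((p x)⁻¹ * d x i) ≤
        ∑ i, Real.negMulLog ((Oᴴ * ud (U x) (fun i => (p x)⁻¹ * d x i) * O) i i).re := fun x => by
      refine le_of_eq_of_le ?_ (entropy_le_diag (hps' x))
      have : Oᴴ * ud (U x) (fun i => (p x)⁻¹ * d x i) * O =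
          (Oᴴ * U x) * diagonal (fun i => (((p x)⁻¹ * d x i : ℝ) : ℂ)) * (Oᴴ * U x)ᴴ := by
        unfold ud
        rw [conjTranspose_mul, conjTranspose_conjTranspose]; simp only [Matrix.mul_assoc]
      rw [this, entropy_diag]
      rw [conjTranspose_mul, conjTranspose_conjTranspose, Matrix.mul_assoc, ← Matrix.mul_assoc O, hO2,
        Matrix.one_mul, hU1]
    calc _ ≤ ∑ x, p x * ∑ i, Real.negMulLog ((Oᴴ * ud (U x) (fun i => (p x)⁻¹ * d x i) * O) i i).re :=
          sum_le_sum fun x _ => mul_le_mul_of_nonneg_left (e2 x) (hp0 x)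
      _ = ∑ i, ∑ x, p x • Real.negMulLog ((Oᴴ * ud (U x) (fun i => (p x)⁻¹ * d x i) * O) i i).re := by
          rw [sum_comm]; simp only [mul_sum, smul_eq_mul]
      _ ≤ _ := sum_le_sum fun i _ => by
          have := Real.concaveOn_negMulLog.le_map_sum (t := univ) (w := p)
            (p := fun x => ((Oᴴ * ud (U x) (fun i => (p x)⁻¹ * d x i) * O) i i).re)
            (fun x _ => hp0 x) h1 (fun x _ => diag_re_nonneg (hps' x) i)
          simpa only [smul_eq_mul] using this

lemma condB_tp {a b : Type*} [Fintype a] (ρ : Matrix (a × b) (a × b) ℂ) {n : ℕ}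
    (L : Fin n → Matrix a a ℂ) : condB (tpowAB ρ n) (tp L) = tp (fun k => condB ρ (L k)) := by
  ext i j
  simp only [condB, tp_apply, tpowAB_apply, ← prod_mul_distrib]
  rw [← sum_prod_pi (fun k z => ∑ x', L k z x' * ρ (x', i k) (z, j k))]
  refine sum_congr rfl fun x _ => ?_
  exact sum_prod_pi (fun k z => L k (x k) z * ρ (z, i k) (x k, j k))

def POVM.pow {a X : Type*} [Fintype a] [DecidableEq a] [Fintype X] (Λ : POVM a X) (n : ℕ) :
    POVM (Fin n → a) (Fin n → X) where
  elem x := tp (fun k => Λ.elem (x k))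
  pos x := tp_psd fun k => Λ.pos _
  sum_eq := by rw [tp_sum, Λ.sum_eq, tp_one]

def OneShot {a b : Type*} [Fintype a] [DecidableEq a] [Fintype b] [DecidableEq b]
    (ρ : Matrix (a × b) (a × b) ℂ) (M G s : ℕ) (ε : ℝ) : Prop :=
  ∃ (V : Fin M → Matrix (Fin G) a ℂ) (U : Fin M → Matrix b b ℂ) (S : Fin M → Finset b),
    (1 - ∑ j, (V j)ᴴ * V j).PosSemidef ∧ (∀ j, (U j)ᴴ * U j = 1) ∧ (∀ j, U j * (U j)ᴴ = 1) ∧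
    (∀ j, (S j).card ≤ s) ∧
    1 - ε ≤ ∑ j, ∑ i ∈ S j, (((U j)ᴴ * condB ρ ((V j)ᴴ * V j) * U j) i i).re

lemma exp_floor {y : ℝ} (hy : 0 ≤ y) : 0 < ⌊Real.exp y⌋₊ ∧ Real.log ⌊Real.exp y⌋₊ ≤ y := by
  have h1 : 1 ≤ Real.exp y := Real.one_le_exp hy
  have h2 : 0 < ⌊Real.exp y⌋₊ := Nat.floor_pos.2 h1
  refine ⟨h2, ?_⟩
  have := Nat.floor_le (Real.exp_pos y).le
  calc _ ≤ Real.log (Real.exp y) := Real.log_le_log (by exact_mod_cast h2) this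
    _ = y := Real.log_exp y

lemma exp_ceil {y : ℝ} (hy : 0 ≤ y) : 0 < ⌈Real.exp y⌉₊ ∧ Real.log ⌈Real.exp y⌉₊ ≤ y + Real.log 2 := by
  have h1 : 1 ≤ Real.exp y := Real.one_le_exp hy
  have h2 : 0 < ⌈Real.exp y⌉₊ := Nat.ceil_pos.2 (Real.exp_pos y)
  refine ⟨h2, ?_⟩
  have := Nat.ceil_lt_add_one (Real.exp_pos y).le
  calc _ ≤ Real.log (Real.exp y * 2) := Real.log_le_log (by exact_mod_cast h2) (by linarith)
    _ = y + Real.log 2 := by rw [Real.log_mul (Real.exp_pos y).ne' two_ne_zero, Real.log_exp]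

section iid
variable {a b X : Type*} [Fintype a] [DecidableEq a] [Fintype b] [DecidableEq b] [Fintype X]

lemma tp_unitary {n : ℕ} {ι : Type*} [Fintype ι] [DecidableEq ι] {U : Fin n → Matrix ι ι ℂ}
    (h : ∀ k, (U k)ᴴ * U k = 1) : (tp U)ᴴ * tp U = 1 := by
  rw [tp_conjTranspose, tp_mul]; simp only [h]; exact tp_one

lemma tp_unitary' {n : ℕ} {ι : Type*} [Fintype ι] [DecidableEq ι] {U : Fin n → Matrix ι ι ℂ}
    (h : ∀ k, U k * (U k)ᴴ = 1) : tp U * (tp U)ᴴ = 1 := by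
  rw [tp_conjTranspose, tp_mul]; simp only [h]; exact tp_one

lemma compl {ι : Type*} [Fintype ι] [DecidableEq ι] (S : Finset ι) (d : ι → ℝ) :
    ∑ i, (d i - if i ∈ S then d i else 0) = ∑ i ∈ Sᶜ, d i := by
  rw [sum_sub_distrib, ← sum_filter, filter_mem_eq_inter, univ_inter,
    ← sum_add_sum_compl S d]; ring

lemma compl_mul {ι : Type*} [Fintype ι] [DecidableEq ι] (S : Finset ι) (d : ι → ℝ) :
    ∑ i, (d i * (1 - if i ∈ S then 1 else 0)) = ∑ i ∈ Sᶜ, d i := by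
  rw [← compl S d]
  exact sum_congr rfl fun i _ => by split_ifs <;> ring

lemma cond_nonneg {ι : Type*} [Fintype ι] {p : X → ℝ} (hp0 : ∀ x, 0 ≤ p x) (lam : X → ι → ℝ)
    (h0 : ∀ x i, 0 ≤ lam x i) (h1 : ∀ x, ∑ i, lam x i ≤ 1) :
    0 ≤ ∑ x, p x * ∑ i, Real.negMulLog (lam x i) := by
  refine sum_nonneg fun x _ => mul_nonneg (hp0 x) (sum_nonneg fun i _ =>
    Real.negMulLog_nonneg (h0 x i) (le_trans ?_ (h1 x)))
  exact single_le_sum (fun i _ => h0 x i) (mem_univ i)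

lemma spectral_code {ρ : Matrix (a × b) (a × b) ℂ} (h : IsDensity ρ) (Λ : POVM a X)
    {r : Matrix a a ℂ} (hr : r.PosSemidef) (hrr : r * r = ptraceRight ρ)
    {p : X → ℝ} (hp0 : ∀ x, 0 ≤ p x) (hp : ∑ x, p x = 1)
    {U : X → Matrix a a ℂ} {lam : X → a → ℝ} (hU1 : ∀ x, (U x)ᴴ * U x = 1)
    (hU2 : ∀ x, U x * (U x)ᴴ = 1) (hl : ∀ x i, 0 ≤ lam x i)
    (hσ : ∀ x, (p x : ℂ) • ud (U x) (lam x) = r * Λ.elem x * r)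
    {W : X → Matrix b b ℂ} {nu : X → b → ℝ} (hW1 : ∀ x, (W x)ᴴ * W x = 1)
    (hW2 : ∀ x, W x * (W x)ᴴ = 1)
    (hβ : ∀ x, (p x : ℂ) • ud (W x) (nu x) = condB ρ (Λ.elem x))
    {O : Matrix a a ℂ} {tau : a → ℝ} (hO1 : Oᴴ * O = 1) (hO2 : O * Oᴴ = 1)
    (hT : ptraceRight ρ = ud O tau)
    {SA : X → Finset a} {SB : X → Finset b} {ST : Finset a} {G s M : ℕ} {D μ ε t : ℝ}
    (hD : 0 < D) (hμ : 0 ≤ μ)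
    (hSA : ∀ x, (SA x).card ≤ G) (hSAμ : ∀ x, ∀ i ∈ SA x, lam x i ≤ μ)
    (eA : ∑ x, p x * ∑ i ∈ (SA x)ᶜ, lam x i ≤ ε)
    (hSB : ∀ x, (SB x).card ≤ s) (eB : ∑ x, p x * ∑ i ∈ (SB x)ᶜ, nu x i ≤ ε)
    (hST : (ST.card : ℝ) ≤ D) (eT : ∑ i ∈ STᶜ, tau i ≤ ε)
    (hM : 0 < M) (ht : 0 < t) (hMt : D * μ / M ≤ t ^ 2) : OneShot ρ M G s (14 * ε + 3 * t) := by
  choose K hK using fun x => ud_factor (U x) (hl x) (SA x) (hSA x)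
  have hA : ∀ x, ud (U x) (lam x) - (K x)ᴴ * K x =
      ud (U x) (fun i => lam x i - if i ∈ SA x then lam x i else 0) := fun x => by rw [hK, ud_sub]
  have hB : ∀ x, ud (W x) (fun i => 1 - if i ∈ SB x then 1 else 0) =
      1 - ud (W x) (fun i => if i ∈ SB x then 1 else 0) := fun x => by
    rw [← ud_sub, ud_one (hW2 x)]
  obtain ⟨c, V, hV1, hV2⟩ := oneshot_code h Λ (Pi := ud O (fun i => if i ∈ ST then 1 else 0)) hr hrr hp0 hp
    (σ := fun x => ud (U x) (lam x)) hσ K (μ := μ) (fun x => by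
      rw [hA]; refine ud_psd _ fun i => ?_
      split_ifs
      · simp
      · simpa using hl x i) (fun x => by
      rw [hK, ← ud_const (hU2 x), ud_sub]
      refine ud_psd _ fun i => ?_
      split_ifs with hi
      · exact sub_nonneg.2 (hSAμ x i hi)
      · simpa using hμ) hμ
      (ud_psd _ fun i => by split_ifs <;> simp).1.eq
      (by rw [ud_mul hO1]; congr 1; ext i; split_ifs <;> simp)
      (by rw [hT, ud_mul hO1, ud_mul hO1]; simp only [mul_comm])
      hD (by rw [ud_trace hO1]; simpa using hST)
      (Q := fun x => ud (W x) (fun i => 1 - if i ∈ SB x then 1 else 0))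
      (fun x => ud_psd _ fun i => by split_ifs <;> simp)
      (fun x => by rw [hB, sub_sub_cancel]; exact ud_psd _ fun i => by split_ifs <;> simp)
      (ε := ε)
      (by rw [hT, ← ud_one hO2, ud_sub, ud_mul hO1, ud_trace hO1, compl_mul]; exact eT)
      (by simp only [hA, ud_trace (hU1 _), compl]; exact eA)
      (by
        refine le_of_eq_of_le (sum_congr rfl fun x _ => ?_) eB
        rw [← hβ, Matrix.smul_mul, Matrix.trace_smul, smul_eq_mul, Complex.re_ofReal_mul, ud_mul (hW1 x),
          ud_trace (hW1 x), compl_mul])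
      hM ht hMt
  refine ⟨V, fun j => W (c j), fun j => SB (c j), hV1, fun j => hW1 _, fun j => hW2 _, fun j => hSB _,
    hV2.trans (le_of_eq (sum_congr rfl fun j _ => ?_))⟩
  rw [hB, sub_sub_cancel, ud_tr_ind]

set_option maxHeartbeats 1000000 in
lemma iid_oneshot {ρ : Matrix (a × b) (a × b) ℂ} (h : IsDensity ρ) (Λ : POVM a X) {r : Matrix a a ℂ}
    (hr : r.PosSemidef) (hrr : r * r = ptraceRight ρ) :
    ∃ HA HB : ℝ, 0 ≤ HA ∧ 0 ≤ HB ∧ 0 ≤ entropy (ptraceRight ρ) - HA ∧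
      JE ρ r Λ.elem = entropy (ptraceRight ρ) - HA ∧ JB ρ Λ.elem = entropy (ptraceLeft ρ) - HB ∧
      ∀ δ > 0, ∀ ε > 0, ∃ N : ℕ, ∀ n ≥ N, ∃ M G s : ℕ, 0 < M ∧ 0 < G ∧ 0 < s ∧
        OneShot (tpowAB ρ n) M G s ε ∧
        Real.log M ≤ n * (entropy (ptraceRight ρ) - HA + 3 * δ) + Real.log 2 ∧
        Real.log G ≤ n * (HA + δ) ∧ Real.log s ≤ n * (HB + δ) := by
  have hpA : ∀ x, (r * Λ.elem x * r).trace.re = (condB ρ (Λ.elem x)).trace.re := fun x => by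
    rw [condB_trace, ← hrr, Matrix.mul_assoc, Matrix.trace_mul_comm, Matrix.mul_assoc]
  have hAp : ∀ x, (r * Λ.elem x * r).PosSemidef := fun x => by
    have := (Λ.pos x).conjTranspose_mul_mul_same r
    rwa [hr.1.eq] at this
  have hAs : ∑ x, r * Λ.elem x * r = ptraceRight ρ := by
    rw [← sum_mul, ← mul_sum, Λ.sum_eq, Matrix.mul_one, hrr]
  have hBs : ∑ x, condB ρ (Λ.elem x) = ptraceLeft ρ := by
    rw [← condB_sum, Λ.sum_eq, condB_one]
  have hp1 := povm_sum_p h Λ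
  obtain ⟨U, lam, hU1, hU2, hl, hl1, hl2, hσ, hAH, hAc⟩ := ensemble hAp (by simp only [hpA]; exact hp1)
  obtain ⟨W, nu, hW1, hW2, hn, hn1, hn2, hβ, hBH, hBc⟩ := ensemble
    (fun x => condB_psd h.1 (Λ.pos x)) hp1
  obtain ⟨O, tau, hO1, hO2, ht0, hT⟩ := psd_diag h.right.1
  change _ = ud O tau at hT
  obtain ⟨p, hpd⟩ : ∃ p : X → ℝ, ∀ x, (condB ρ (Λ.elem x)).trace.re = p x := ⟨_, fun _ => rfl⟩
  have hp0 : ∀ x, 0 ≤ p x := fun x => by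
    rw [← hpd]; exact trace_re_nonneg (condB_psd h.1 (Λ.pos x))
  have htau : ∑ i, tau i = 1 := by
    rw [← ud_trace hO1, ← hT, h.right.2]; rfl
  have hent : entropy (ptraceRight ρ) = ∑ i, Real.negMulLog (tau i) := by
    rw [hT]; exact entropy_diag O hO1 tau
  simp only [hpA, hpd, hAs, hBs] at hl2 hn2 hσ hβ hAH hBH hAc hBc hp1
  obtain ⟨HA, hHA⟩ : ∃ HA, HA = ∑ x, p x * ∑ i, Real.negMulLog (lam x i) := ⟨_, rfl⟩
  obtain ⟨HB, hHB⟩ : ∃ HB, HB = ∑ x, p x * ∑ i, Real.negMulLog (nu x i) := ⟨_, rfl⟩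
  rw [← hHA] at hAH hAc
  rw [← hHB] at hBH hBc
  have hHA0 : 0 ≤ HA := hHA ▸ cond_nonneg hp0 lam hl hl1
  have hHB0 : 0 ≤ HB := hHB ▸ cond_nonneg hp0 nu hn hn1
  refine ⟨HA, HB, hHA0, hHB0, sub_nonneg.2 hAc, ?_, ?_, ?_⟩
  · unfold JE
    simp only [hpd, hr.1.eq, hAH]; ring
  · unfold JB
    simp only [hpd, hBH]; ring
  intro δ hδ ε hε
  have hε' : 0 < ε / 28 := by positivity
  obtain ⟨N1, hN1⟩ := aep p hp0 hp1 lam hl hl1 hl2 hδ hε'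
  obtain ⟨N2, hN2⟩ := aep p hp0 hp1 nu hn hn1 hn2 hδ hε'
  obtain ⟨N3, hN3⟩ := aep (fun _ : Unit => (1 : ℝ)) (fun _ => zero_le_one) (by simp) (fun _ => tau)
    (fun _ => ht0) (fun _ => htau.le) (fun _ => by rw [htau, mul_one]) hδ hε'
  obtain ⟨N4, hN4⟩ : ∃ N4 : ℕ, ∀ n ≥ N4, Real.exp (-(n * δ / 2)) ≤ ε / 6 := by
    have h1 : Tendsto (fun n : ℕ => Real.exp (-(n * δ / 2))) atTop (nhds 0) := by
      refine Real.tendsto_exp_neg_atTop_nhds_zero.comp ?_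
      have := (tendsto_natCast_atTop_atTop (R := ℝ)).atTop_mul_const (show 0 < δ / 2 by positivity)
      refine this.congr fun n => by ring
    have := h1.eventually (gt_mem_nhds (show 0 < ε / 6 by positivity))
    obtain ⟨N, hN⟩ := eventually_atTop.1 this
    exact ⟨N, fun n hn => (hN n hn).le⟩
  refine ⟨max (max N1 N2) (max N3 N4), fun n hn => ?_⟩
  simp only [ge_iff_le, max_le_iff] at hn
  obtain ⟨SA, hSA1, hSA2, hSA3⟩ := hN1 n hn.1.1
  obtain ⟨SB, hSB1, -, hSB3⟩ := hN2 n hn.1.2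
  obtain ⟨ST, hST1, -, hST3⟩ := hN3 n hn.2.1
  have ht := hN4 n hn.2.2
  rw [← hHA] at hSA1 hSA2
  rw [← hHB] at hSB1
  simp only [univ_unique, sum_singleton, one_mul, ← hent, prod_const_one] at hST1 hST3
  have hgA := exp_floor (y := n * (HA + δ)) (by positivity)
  have hgB := exp_floor (y := n * (HB + δ)) (by positivity)
  have hgM := exp_ceil (y := n * (entropy (ptraceRight ρ) - HA + 3 * δ))
    (mul_nonneg (Nat.cast_nonneg _) (by linarith))
  refine ⟨_, _, _, hgM.1, hgA.1, hgB.1, ?_, hgM.2, hgA.2, hgB.2⟩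
  have hcode := spectral_code (tpowAB_density h n) (Λ.pow n) (r := tp fun _ => r) (tp_psd fun _ => hr)
    (by rw [tp_mul, ptraceRight_tpowAB, hrr]) (p := fun x => ∏ k, p (x k))
    (fun x => prod_nonneg fun k _ => hp0 _)
    (by rw [sum_prod_pi (fun _ => p)]; simp [hp1])
    (U := fun x => tp fun k => U (x k)) (lam := fun x i => ∏ k, lam (x k) (i k))
    (fun x => tp_unitary fun k => hU1 _) (fun x => tp_unitary' fun k => hU2 _)
    (fun x i => prod_nonneg fun k _ => hl _ _)
    (fun x => by
      rw [← tp_ud, ← tp_smul]; simp only [hσ]; rw [← tp_mul, ← tp_mul]; rfl)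
    (W := fun x => tp fun k => W (x k)) (nu := fun x i => ∏ k, nu (x k) (i k))
    (fun x => tp_unitary fun k => hW1 _) (fun x => tp_unitary' fun k => hW2 _)
    (fun x => by
      rw [← tp_ud, ← tp_smul]; simp only [hβ]; rw [← condB_tp]; rfl)
    (O := tp fun _ => O) (tau := fun i => ∏ k, tau (i k))
    (tp_unitary fun k => hO1) (tp_unitary' fun k => hO2)
    (by rw [ptraceRight_tpowAB, hT, tp_ud])
    (Real.exp_pos _) (Real.exp_pos _).le
    (fun x => Nat.le_floor (hSA1 x)) hSA2 hSA3
    (fun x => Nat.le_floor (hSB1 x)) hSB3 (hST1 default) hST3 hgM.1 (Real.exp_pos (-(n * δ / 2)))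
    (by
      have hcl := Nat.le_ceil (Real.exp (n * (entropy (ptraceRight ρ) - HA + 3 * δ)))
      rw [← Real.exp_add, ← Real.exp_nat_mul]
      calc _ ≤ Real.exp (n * (entropy (ptraceRight ρ) + δ) + -(n * (HA - δ))) /
            Real.exp (n * (entropy (ptraceRight ρ) - HA + 3 * δ)) := by gcongr
        _ = _ := by rw [← Real.exp_sub]; congr 1; push_cast; ring)
  obtain ⟨V, U', S', c1, c2, c3, c4, c5⟩ := hcode
  exact ⟨V, U', S', c1, c2, c3, c4, le_trans (by linarith) c5⟩
end iid

def blkE (a : Type*) (m k : ℕ) : (Fin (m * k) → a) ≃ (Fin m → Fin k → a) :=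
  (Equiv.arrowCongr finProdFinEquiv.symm (Equiv.refl a)).trans (Equiv.curry _ _ _)

lemma blkE_apply {a : Type*} {m k : ℕ} (x : Fin (m * k) → a) (i : Fin m) (j : Fin k) :
    blkE a m k x i j = x (finProdFinEquiv (i, j)) := rfl

lemma isProd_block {a b : Type*} [Fintype a] [DecidableEq a] [Fintype b] [DecidableEq b]
    (ρ : Matrix (a × b) (a × b) ℂ) (m k r : ℕ) :
    IsProd (tpowAB ρ (m * k + r)) (tpowAB (tpowAB ρ k) m) (tpowAB ρ r)
      ((Fin.appendEquiv (m * k) r).symm.trans (Equiv.prodCongr (blkE a m k) (Equiv.refl _)))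
      ((Fin.appendEquiv (m * k) r).symm.trans (Equiv.prodCongr (blkE b m k) (Equiv.refl _))) := by
  intro x y i j
  rw [isProd_tpowAB ρ (m * k) r x y i j]
  congr 1
  simp only [tpowAB_apply]
  rw [← Equiv.prod_comp finProdFinEquiv, Fintype.prod_prod_type]
  rfl

lemma OneShot.junk {a b a1 b1 a2 b2 : Type*} [Fintype a] [DecidableEq a] [Fintype b] [DecidableEq b]
    [Fintype a1] [DecidableEq a1] [Fintype b1] [DecidableEq b1]
    [Fintype a2] [DecidableEq a2] [Fintype b2] [DecidableEq b2]
    {ρ : Matrix (a × b) (a × b) ℂ} {ρ1 : Matrix (a1 × b1) (a1 × b1) ℂ}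
    {ρ2 : Matrix (a2 × b2) (a2 × b2) ℂ} {ea : a ≃ a1 × a2} {eb : b ≃ b1 × b2}
    (h : IsProd ρ ρ1 ρ2 ea eb) (h2 : IsDensity ρ2) {M G s : ℕ} {ε : ℝ} (hc : OneShot ρ1 M G s ε) :
    OneShot ρ M (G * Fintype.card a2) (s * Fintype.card b2) ε := by
  obtain ⟨V, U, S, hV, hU1, hU2, hS, hε⟩ := hc
  let eg : Fin (G * Fintype.card a2) ≃ Fin G × a2 :=
    finProdFinEquiv.symm.trans (Equiv.prodCongr (Equiv.refl _) (Fintype.equivFin a2).symm)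
  have hVV : ∀ j, (((V j) ⊗ₖ (1 : Matrix a2 a2 ℂ)).submatrix eg ea)ᴴ *
      (((V j) ⊗ₖ (1 : Matrix a2 a2 ℂ)).submatrix eg ea) =
      (((V j)ᴴ * V j) ⊗ₖ (1 : Matrix a2 a2 ℂ)).submatrix ea ea := fun j => by
    rw [conjTranspose_submatrix, submatrix_mul_equiv, conjTranspose_kronecker, ← mul_kronecker_mul,
      conjTranspose_one, Matrix.one_mul]
  have hUU : ∀ A B : Matrix b1 b1 ℂ, (A ⊗ₖ (1 : Matrix b2 b2 ℂ)).submatrix eb eb *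
      (B ⊗ₖ (1 : Matrix b2 b2 ℂ)).submatrix eb eb = ((A * B) ⊗ₖ (1 : Matrix b2 b2 ℂ)).submatrix eb eb :=
    fun A B => by rw [submatrix_mul_equiv, ← mul_kronecker_mul, Matrix.one_mul]
  have hUH : ∀ A : Matrix b1 b1 ℂ, ((A ⊗ₖ (1 : Matrix b2 b2 ℂ)).submatrix eb eb)ᴴ =
      (Aᴴ ⊗ₖ (1 : Matrix b2 b2 ℂ)).submatrix eb eb := fun A => by
    rw [conjTranspose_submatrix, conjTranspose_kronecker, conjTranspose_one]
  refine ⟨fun j => ((V j) ⊗ₖ (1 : Matrix a2 a2 ℂ)).submatrix eg ea,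
    fun j => ((U j) ⊗ₖ (1 : Matrix b2 b2 ℂ)).submatrix eb eb,
    fun j => ((S j) ×ˢ (univ : Finset b2)).map eb.symm.toEmbedding, ?_, fun j => ?_, fun j => ?_,
    fun j => ?_, ?_⟩
  · simp only [hVV]
    have : 1 - ∑ j, (((V j)ᴴ * V j) ⊗ₖ (1 : Matrix a2 a2 ℂ)).submatrix ea ea =
        ((1 - ∑ j, (V j)ᴴ * V j) ⊗ₖ (1 : Matrix a2 a2 ℂ)).submatrix ea ea := by
      rw [← submatrix_one_equiv ea, ← one_kronecker_one]
      ext x y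
      simp only [Matrix.sub_apply, submatrix_apply, kroneckerMap_apply, Matrix.sum_apply, sub_mul,
        sum_mul]
    rw [this]
    exact (hV.kronecker PosSemidef.one).submatrix _
  · rw [hUH, hUU, hU1, one_kronecker_one, submatrix_one_equiv]
  · rw [hUH, hUU, hU2, one_kronecker_one, submatrix_one_equiv]
  · rw [card_map, card_product, card_univ]
    exact Nat.mul_le_mul_right _ (hS j)
  · refine hε.trans (le_of_eq (sum_congr rfl fun j _ => ?_))
    rw [sum_map, sum_product, hVV, h.condB_kron, hUH, submatrix_mul_equiv, submatrix_mul_equiv,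
      ← mul_kronecker_mul, ← mul_kronecker_mul, Matrix.one_mul, Matrix.mul_one]
    refine sum_congr rfl fun i _ => ?_
    simp only [Equiv.coe_toEmbedding, submatrix_apply, Equiv.apply_symm_apply, kroneckerMap_apply]
    rw [← Complex.re_sum, ← mul_sum]
    have : ∑ k, condB ρ2 1 k k = 1 := by
      have := h2.left.2
      rw [← condB_one] at this
      exact this
    rw [this, mul_one]

lemma extend_unitary {I A R C : Type*} [Fintype I] [Fintype A] [DecidableEq A]
    [Fintype R] [DecidableEq R] [Fintype C] [DecidableEq C] (W : Matrix I A ℂ) (hW : Wᴴ * W = 1)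
    (j : I → R) (hj : Function.Injective j) (f : A → C) (hf : Function.Injective f)
    (hc : Fintype.card R = Fintype.card C) :
    ∃ U : Matrix R C ℂ, Uᴴ * U = 1 ∧ U * Uᴴ = 1 ∧ ∀ i x, U (j i) (f x) = W i x := by
  classical
  let w : A → EuclideanSpace ℂ R := fun x => WithLp.toLp 2 (Function.extend j (fun i => W i x) 0)
  have hw : ∀ x i, w x (j i) = W i x := fun x i => hj.extend_apply (fun i => W i x) 0 i
  have hw0 : ∀ x r, r ∉ Set.range j → w x r = 0 := fun x r hr => by
    have : Function.extend j (fun i => W i x) 0 r = (0 : R → ℂ) r := by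
      refine Function.extend_apply' _ _ _ ?_
      rintro ⟨i, hi⟩; exact hr ⟨i, hi⟩
    exact this
  have hin : ∀ x x', inner ℂ (w x) (w x') = if x = x' then (1 : ℂ) else 0 := by
    intro x x'
    rw [PiLp.inner_apply]
    have h1 := congrFun (congrFun hW x) x'
    rw [Matrix.mul_apply, one_apply] at h1
    rw [← h1]
    refine (Fintype.sum_of_injective j hj _ _ ?_ ?_).symm
    · intro r hr
      rw [hw0 x r hr]; simp
    · intro i
      rw [hw, hw]
      simp [conjTranspose_apply, mul_comm]
  let v : C → EuclideanSpace ℂ R := Function.extend f w 0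
  have hv : ∀ x, v (f x) = w x := fun x => hf.extend_apply _ _ x
  have hor : Orthonormal ℂ ((Set.range f).domRestrict v) := by
    rw [orthonormal_iff_ite]
    rintro ⟨_, x, rfl⟩ ⟨_, x', rfl⟩
    have : inner ℂ (v (f x)) (v (f x')) = if x = x' then (1 : ℂ) else 0 := by rw [hv, hv, hin]
    refine this.trans ?_
    simp [Subtype.ext_iff, hf.eq_iff]
  obtain ⟨bs, hbs⟩ := hor.exists_orthonormalBasis_extension_of_card_eq
    (by rw [finrank_euclideanSpace, hc])
  let U : Matrix R C ℂ := Matrix.of fun r c => bs c r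
  have h1 : Uᴴ * U = 1 := by
    ext c c'
    have := orthonormal_iff_ite.1 bs.orthonormal c c'
    rw [PiLp.inner_apply] at this
    rw [one_apply, ← this, Matrix.mul_apply]
    refine sum_congr rfl fun r _ => ?_
    simp [U, conjTranspose_apply, mul_comm]
  refine ⟨U, h1, (Matrix.mul_eq_one_comm_of_equiv (Fintype.equivOfCardEq hc.symm)).1 h1, ?_⟩
  intro i x
  have := hbs (f x) ⟨x, rfl⟩
  change bs (f x) (j i) = _
  rw [this, hv, hw]

lemma alice_unitary {A : Type*} [Fintype A] [DecidableEq A] [Nonempty A] {M G : ℕ} (hM : 0 < M)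
    (hG : 0 < G) (V : Fin M → Matrix (Fin G) A ℂ) (hV : (1 - ∑ j, (V j)ᴴ * V j).PosSemidef) :
    ∃ U : Matrix ((Fin (2 * Fintype.card A) × Fin M) × Fin G) (A × Fin (2 * M * G)) ℂ,
      Uᴴ * U = 1 ∧ U * Uᴴ = 1 ∧ ∀ (h0 : 0 < 2 * Fintype.card A) (h1 : 0 < 2 * M * G) y g x,
        U ((⟨0, h0⟩, y), g) (x, ⟨0, h1⟩) = V y g x := by
  classical
  obtain ⟨C, hC⟩ := exists_factor hV
  have hA : 0 < Fintype.card A := Fintype.card_pos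
  have h0 : 0 < 2 * Fintype.card A := by omega
  have h1 : 0 < 2 * M * G := by positivity
  let W : Matrix ((Fin M × Fin G) ⊕ A) A ℂ := Matrix.of fun i x =>
    Sum.elim (fun p : Fin M × Fin G => V p.1 p.2 x) (fun c => C c x) i
  let j : (Fin M × Fin G) ⊕ A → (Fin (2 * Fintype.card A) × Fin M) × Fin G :=
    Sum.elim (fun p => ((⟨0, h0⟩, p.1), p.2))
      (fun c => ((⟨(Fintype.equivFin A c).val + 1, by have := (Fintype.equivFin A c).2; omega⟩,
        ⟨0, hM⟩), ⟨0, hG⟩))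
  have hj : Function.Injective j := by
    rintro (⟨y, g⟩ | c) (⟨y', g'⟩ | c') h
    · simp [j] at h; simp [h]
    · simp [j] at h
    · simp [j] at h
    · simp [j, Fin.val_inj] at h; simp [h]
  have hW : Wᴴ * W = 1 := by
    have : (1 : Matrix A A ℂ) = ∑ j, (V j)ᴴ * V j + Cᴴ * C := by rw [← hC]; abel
    rw [this]
    ext x x'
    rw [Matrix.mul_apply, Fintype.sum_sum_type, Fintype.sum_prod_type, Matrix.add_apply,
      Matrix.sum_apply]
    rfl
  obtain ⟨U, u1, u2, u3⟩ := extend_unitary W hW j hj (fun x : A => (x, (⟨0, h1⟩ : Fin (2 * M * G))))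
    (fun x y h => by simpa using h) (by
      simp only [Fintype.card_prod, Fintype.card_fin]; ring)
  exact ⟨U, u1, u2, fun _ _ y g x => u3 (Sum.inl (y, g)) x⟩

lemma bob_perm {B : Type*} [Fintype B] [DecidableEq B] {p w : ℕ} (hp : 0 < p)
    (hc : Fintype.card B = p * w) (S : Finset B) (hS : S.card ≤ w) :
    ∃ π : B ≃ Fin p × Fin w, ∀ i ∈ S, (π i).1 = ⟨0, hp⟩ := by
  classical
  obtain ⟨e⟩ : Nonempty (S ↪ Fin w) := by
    apply Function.Embedding.nonempty_of_card_le; simpa using hS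
  by_cases hw : w = 0
  · subst hw
    have : S = ∅ := by simpa using hS
    subst this
    exact ⟨Fintype.equivOfCardEq (by simp [hc]), by simp⟩
  have hw' : 0 < w := Nat.pos_of_ne_zero hw
  let f : B → Fin p × Fin w := fun i => (⟨0, hp⟩, if h : i ∈ S then e ⟨i, h⟩ else ⟨0, hw'⟩)
  obtain ⟨g, hg⟩ := exists_equiv_extend_of_card_eq (s := S) (f := f)
    (t := (univ : Finset (Fin p × Fin w))) (by simp [hc]) (by simp) (by
      intro x hx y hy h
      have hx' : x ∈ S := hx
      have hy' : y ∈ S := hy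
      simpa [f, hx', hy'] using h)
  refine ⟨g.trans (Equiv.subtypeUnivEquiv (by simp)), fun i hi => ?_⟩
  have := hg i hi
  simp only [Equiv.trans_apply, Equiv.subtypeUnivEquiv_apply, this, f]

lemma traceNorm_gentle {ι : Type*} [Fintype ι] [DecidableEq ι] {Y P : Matrix ι ι ℂ} {q t : ℝ}
    (hY : Y.PosSemidef) (hY1 : Y.trace = 1) (hP : P.IsHermitian) (hPP : P * P = P)
    (hP1 : P.trace = 1) (hq : P * Y * P = (q : ℂ) • P) (hq1 : q ≤ 1) (ht : 0 < t) :
    traceNorm (Y - P) ≤ 2 * (1 - q) + t ^ 2 + (1 - q) / t ^ 2 := by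
  have hPp : P.PosSemidef := by
    have := posSemidef_conjTranspose_mul_self P
    rwa [hP.eq, hPP] at this
  set Q : Matrix ι ι ℂ := 1 - P with hQ
  have hQh : Qᴴ = Q := by rw [hQ, conjTranspose_sub, conjTranspose_one, hP.eq]
  set a := P * Y * P with ha
  set b := P * Y * Q with hb
  set c := Q * Y * P with hc
  set e := Q * Y * Q with he
  have hYs : Y = a + b + c + e := by
    rw [ha, hb, hc, he, hQ]; noncomm_ring
  have htc : (t : ℂ) ≠ 0 := by exact_mod_cast ht.ne'
  set Z : Matrix ι ι ℂ := ((1 - q : ℝ) : ℂ) • P + e + ((t : ℂ) ^ 2) • a + ((t : ℂ)⁻¹ ^ 2) • e with hZ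
  have hep : e.PosSemidef := by
    have := hY.mul_mul_conjTranspose_same Q
    rwa [hQh] at this
  have key : ∀ s : ℂ, s * s = 1 → star s = s → (((t : ℂ) ^ 2) • a + s • b + s • c + ((t : ℂ)⁻¹ ^ 2) • e).PosSemidef := by
    intro s hs hss
    have := hY.mul_mul_conjTranspose_same ((t : ℂ) • P + (s * (t : ℂ)⁻¹) • Q)
    have h2 : ((t : ℂ) • P + (s * (t : ℂ)⁻¹) • Q)ᴴ = (t : ℂ) • P + (s * (t : ℂ)⁻¹) • Q := by
      rw [conjTranspose_add, conjTranspose_smul, conjTranspose_smul, hP.eq, hQh, star_mul', hss]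
      simp
    rw [h2] at this
    convert this using 1
    simp only [ha, hb, hc, he, Matrix.add_mul, Matrix.mul_add, Matrix.smul_mul, Matrix.mul_smul,
      smul_add, smul_smul]
    have e1 : (t : ℂ) * (s * (t : ℂ)⁻¹) = s := by field_simp
    have e2 : s * (t : ℂ)⁻¹ * t = s := by field_simp
    have e3 : s * (t : ℂ)⁻¹ * (s * (t : ℂ)⁻¹) = (t : ℂ)⁻¹ ^ 2 := by linear_combination ((t : ℂ)⁻¹ ^ 2) * hs
    rw [e1, e2, e3, ← pow_two]
    abel
  have hX : (Y - P).IsHermitian := hY.1.sub hP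
  have haq : a = (q : ℂ) • P := hq
  have hpp : (((2 * (1 - q) : ℝ) : ℂ) • P).PosSemidef :=
    hPp.smul (by exact_mod_cast (by linarith : (0 : ℝ) ≤ 2 * (1 - q)))
  have h1 : (Z - (Y - P)).PosSemidef := by
    have : Z - (Y - P) = ((2 * (1 - q) : ℝ) : ℂ) • P +
        (((t : ℂ) ^ 2) • a + (-1 : ℂ) • b + (-1 : ℂ) • c + ((t : ℂ)⁻¹ ^ 2) • e) := by
      rw [hYs, hZ]
      have : P - a = ((1 - q : ℝ) : ℂ) • P := by rw [haq]; push_cast; module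
      have h3 : ((2 * (1 - q) : ℝ) : ℂ) • P = ((1 - q : ℝ) : ℂ) • P + (P - a) := by
        rw [this]; push_cast; module
      rw [h3]; module
    rw [this]
    exact hpp.add (key (-1) (by norm_num) (by simp))
  have h2 : (Z + (Y - P)).PosSemidef := by
    have : Z + (Y - P) = e + e +
        (((t : ℂ) ^ 2) • a + (1 : ℂ) • b + (1 : ℂ) • c + ((t : ℂ)⁻¹ ^ 2) • e) := by
      rw [hYs, hZ]
      have : ((1 - q : ℝ) : ℂ) • P = P - a := by rw [haq]; push_cast; module
      rw [this]; module
    rw [this]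
    exact (hep.add hep).add (key 1 (by norm_num) (by simp))
  refine (traceNorm_between hX h1 h2).trans ?_
  have ta : a.trace = q := by rw [haq, trace_smul, hP1]; simp
  have te : e.trace = 1 - q := by
    have hb0 : b.trace = 0 := by
      rw [hb, Matrix.mul_assoc, trace_mul_comm, Matrix.mul_assoc, hQ, Matrix.sub_mul, hPP]; simp
    have hc0 : c.trace = 0 := by
      rw [hc, trace_mul_comm, ← Matrix.mul_assoc, hQ, Matrix.mul_sub, hPP]; simp
    have := congrArg Matrix.trace hYs
    simp only [trace_add, hY1, ta, hb0, hc0] at this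
    linear_combination -this
  rw [hZ]
  simp only [trace_add, trace_smul, hP1, ta, te, smul_eq_mul]
  have : ((1 - q : ℝ) : ℂ) * 1 + (1 - q) + (t : ℂ) ^ 2 * q + (t : ℂ)⁻¹ ^ 2 * (1 - q) =
    (((1 - q) + (1 - q) + t ^ 2 * q + t⁻¹ ^ 2 * (1 - q) : ℝ) : ℂ) := by push_cast; ring
  rw [this, Complex.ofReal_re]
  have h3 : t⁻¹ ^ 2 * (1 - q) = (1 - q) / t ^ 2 := by rw [inv_pow, mul_comm]; rfl
  rw [h3]
  nlinarith [mul_nonneg (sq_nonneg t) (sub_nonneg.2 hq1)]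

lemma out_zero {a b : Type*} [Fintype a] [DecidableEq a] [Fintype b] [DecidableEq b]
    {ρ : Matrix (a × b) (a × b) ℂ} {n : ℕ} (Pr : Protocol a b n) (i : Fin Pr.dAp)
    (k : Fin Pr.dBp) (V : Fin Pr.dY → Matrix (Fin Pr.dAg) (Fin n → a) ℂ)
    (hV : ∀ y g x, isoA Pr ((i, y), g) x = V y g x) :
    outputReduced ρ Pr (i, k) (i, k) =
      ∑ h, (Pr.UB * (blk fun y => condB (tpowAB ρ n) ((V y)ᴴ * V y)).submatrix
        Prod.swap Prod.swap * Pr.UBᴴ) (k, h) (k, h) := by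
  have : (blk fun y => condB (tpowAB ρ n) ((V y)ᴴ * V y)).submatrix Prod.swap Prod.swap =
      ∑ g, dblk Pr ρ i i g g := by
    ext ⟨u, y⟩ ⟨u', y'⟩
    simp only [submatrix_apply, blk, Prod.swap, Matrix.sum_apply, dblk, of_apply]
    by_cases h : y = y'
    · subst h
      simp only [if_true, condB, stateA_apply, hV, Matrix.mul_apply, conjTranspose_apply,
        sum_mul]
      rw [sum_comm]
      rw [sum_comm (s := (univ : Finset (Fin Pr.dAg)))]
      refine sum_congr rfl fun x _ => ?_
      rw [sum_comm (s := (univ : Finset (Fin Pr.dAg)))]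
      refine sum_congr rfl fun x' _ => sum_congr rfl fun g _ => ?_
      ring
    · simp [h]
  rw [this, out_apply]
  simp_rw [Matrix.mul_sum, Matrix.sum_mul, Matrix.sum_apply]
  rw [sum_comm]

lemma error_le {a b : Type*} [Fintype a] [DecidableEq a] [Fintype b] [DecidableEq b]
    {ρ : Matrix (a × b) (a × b) ℂ} {n : ℕ} (h : IsDensity ρ) (Pr : Protocol a b n) {η t : ℝ}
    (ht : 0 < t) (hq2 : 1 - η ≤ (outputReduced ρ Pr (⟨0, Pr.dAp_pos⟩, ⟨0, Pr.dBp_pos⟩)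
      (⟨0, Pr.dAp_pos⟩, ⟨0, Pr.dBp_pos⟩)).re) :
    protocolError ρ Pr ≤ 2 * η + t ^ 2 + η / t ^ 2 := by
  have hpsd : (outputReduced ρ Pr).PosSemidef := out_psd Pr h.1
  have htr : (outputReduced ρ Pr).trace = 1 := out_trace Pr h
  let z : Fin Pr.dAp × Fin Pr.dBp := (⟨0, Pr.dAp_pos⟩, ⟨0, Pr.dBp_pos⟩)
  set q : ℝ := (outputReduced ρ Pr z z).re with hq
  have hP : pureZero Pr.dAp ⊗ₖ pureZero Pr.dBp =
      Matrix.of fun i j => if i = z ∧ j = z then (1 : ℂ) else 0 := by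
    ext ⟨i, k⟩ ⟨i', k'⟩
    rw [kroneckerMap_apply, pureZero_apply Pr.dAp_pos, pureZero_apply Pr.dBp_pos]
    simp only [of_apply, z, Prod.mk.injEq]
    split_ifs <;> simp_all
  set P : Matrix (Fin Pr.dAp × Fin Pr.dBp) (Fin Pr.dAp × Fin Pr.dBp) ℂ :=
    Matrix.of fun i j => if i = z ∧ j = z then (1 : ℂ) else 0 with hPd
  have hzz : outputReduced ρ Pr z z = (q : ℂ) := by
    have := hpsd.1.apply z z
    rw [hq]
    apply Complex.ext
    · simp
    · have h3 := congrArg Complex.im this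
      simp at h3
      rw [Complex.ofReal_im]; linarith
  have hPs : P = Matrix.single z z 1 := by
    ext i j
    simp only [hPd, Matrix.single_apply, of_apply, eq_comm (a := z)]
  have hq1 : q ≤ 1 := by
    have h1 : (outputReduced ρ Pr).trace.re = 1 := by rw [htr]; simp
    rw [← h1, Matrix.trace, Complex.re_sum]
    exact single_le_sum (f := fun i => ((outputReduced ρ Pr).diag i).re)
      (fun i _ => diag_re_nonneg hpsd i) (mem_univ z)
  change 1 - η ≤ q at hq2
  have hg := traceNorm_gentle (t := t) (q := q) (P := P) hpsd htr
    (by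
      ext i j
      simp only [hPd, conjTranspose_apply, of_apply]
      by_cases h1 : i = z <;> by_cases h2 : j = z <;> simp [h1, h2])
    (by rw [hPs]; simp) (by rw [hPs]; simp [Matrix.trace_single_eq_same]) (by
      rw [hPs]
      rw [Matrix.single_mul_mul_single]
      simp [hzz, Matrix.smul_single]) hq1 ht
  unfold protocolError
  rw [hP]
  refine hg.trans ?_
  have : (1 - q) / t ^ 2 ≤ η / t ^ 2 := by gcongr; linarith
  linarith

set_option maxHeartbeats 1000000 in
lemma protocol_of_oneShot {a b : Type*} [Fintype a] [DecidableEq a] [Fintype b] [DecidableEq b]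
    [Nonempty a] {ρ : Matrix (a × b) (a × b) ℂ} {n : ℕ} (h : IsDensity ρ) {M G s p w : ℕ}
    {η t : ℝ} (hM : 0 < M) (hG : 0 < G) (hOS : OneShot (tpowAB ρ n) M G s η)
    (hp : 0 < p) (hw : 0 < w) (hc : Fintype.card (Fin n → b) = p * w) (hs : s ≤ w) (ht : 0 < t) :
    ∃ Pr : Protocol a b n, Pr.dY = M ∧ Pr.dAp = 2 * Fintype.card (Fin n → a) ∧ Pr.dBp = p ∧
      Pr.dC = 2 * M * G ∧ protocolError ρ Pr ≤ 2 * η + t ^ 2 + η / t ^ 2 := by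
  obtain ⟨V, U, S, hV, hU1, hU2, hS, hsucc⟩ := hOS
  have hA : 0 < Fintype.card (Fin n → a) := Fintype.card_pos
  obtain ⟨UA, hA1, hA2, hA3⟩ := alice_unitary hM hG V hV
  choose π hπ using fun y => bob_perm hp hc (S y) ((hS y).trans hs)
  let e : Fin p × Fin (w * M) ≃ Fin M × (Fin n → b) :=
    (Equiv.prodCongr (Equiv.refl _) finProdFinEquiv.symm).trans
      ((Equiv.prodAssoc _ _ _).symm.trans ((Equiv.prodComm _ _).trans
        (Equiv.prodShear (Equiv.refl _) (fun y => (π y).symm))))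
  let B : Matrix (Fin M × (Fin n → b)) (Fin M × (Fin n → b)) ℂ := blk fun y => (U y)ᴴ
  have hB1 : Bᴴ * B = 1 := by
    simp only [B, blk_conjTranspose, blk_mul, conjTranspose_conjTranspose, hU2, blk_one]
  have hB2 : B * Bᴴ = 1 := by
    simp only [B, blk_conjTranspose, blk_mul, conjTranspose_conjTranspose, hU1, blk_one]
  let sw : (Fin n → b) × Fin M ≃ Fin M × (Fin n → b) := Equiv.prodComm _ _
  let UB : Matrix (Fin p × Fin (w * M)) ((Fin n → b) × Fin M) ℂ := B.submatrix e sw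
  let Pr : Protocol a b n :=
    { dC := 2 * M * G, dAp := 2 * Fintype.card (Fin n → a), dY := M, dAg := G, dBp := p,
      dBg := w * M, dC_pos := by positivity, dAp_pos := by omega, dY_pos := hM, dAg_pos := hG,
      dBp_pos := hp, dBg_pos := by positivity, UA := UA, UA_unitary := ⟨hA1, hA2⟩, UB := UB,
      UB_unitary := by
        constructor
        · rw [conjTranspose_submatrix, submatrix_mul_equiv, hB1, submatrix_one_equiv]
        · rw [conjTranspose_submatrix, submatrix_mul_equiv, hB2, submatrix_one_equiv] }
  refine ⟨Pr, rfl, rfl, rfl, rfl, error_le h Pr ht ?_⟩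
  have h0 : 0 < 2 * Fintype.card (Fin n → a) := by omega
  refine hsucc.trans ?_
  have hz := out_zero (ρ := ρ) Pr ⟨0, h0⟩ ⟨0, hp⟩ V (fun y g x => hA3 _ _ y g x)
  rw [show outputReduced ρ Pr (⟨0, Pr.dAp_pos⟩, ⟨0, Pr.dBp_pos⟩) (⟨0, Pr.dAp_pos⟩, ⟨0, Pr.dBp_pos⟩) = _ from hz]
  have hUB : Pr.UB * (blk fun y => condB (tpowAB ρ n) ((V y)ᴴ * V y)).submatrix
      Prod.swap Prod.swap * Pr.UBᴴ =
      (blk fun y => (U y)ᴴ * condB (tpowAB ρ n) ((V y)ᴴ * V y) * U y).submatrix e e := by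
    change B.submatrix e sw * (blk fun y => condB (tpowAB ρ n) ((V y)ᴴ * V y)).submatrix
      sw sw * (B.submatrix e sw)ᴴ = _
    rw [conjTranspose_submatrix, submatrix_mul_equiv, submatrix_mul_equiv]
    simp only [B, blk_conjTranspose, blk_mul, conjTranspose_conjTranspose]
  rw [hUB]
  have hsum : ∀ F : Fin (w * M) → ℂ, ∑ x, F x = ∑ y : Fin M, ∑ l : Fin w, F (finProdFinEquiv (l, y)) := by
    intro F
    rw [← finProdFinEquiv.sum_comp, Fintype.sum_prod_type, sum_comm]
  rw [show (∑ x : Fin Pr.dBg, _ : ℂ) = _ from hsum _, Complex.re_sum]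
  refine sum_le_sum fun y _ => ?_
  rw [Complex.re_sum]
  set D := (U y)ᴴ * condB (tpowAB ρ n) ((V y)ᴴ * V y) * U y with hD
  have hDp : D.PosSemidef :=
    (condB_psd (tpowAB_psd h.1 n) (posSemidef_conjTranspose_mul_self _)).conjTranspose_mul_mul_same _
  have he : ∀ l, e (⟨0, hp⟩, finProdFinEquiv (l, y)) = (y, (π y).symm (⟨0, hp⟩, l)) := by
    intro l
    simp [e]
  have : ∀ l, ((blk fun y => (U y)ᴴ * condB (tpowAB ρ n) ((V y)ᴴ * V y) * U y).submatrix e e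
      (⟨0, hp⟩, finProdFinEquiv (l, y)) (⟨0, hp⟩, finProdFinEquiv (l, y))) =
      D ((π y).symm (⟨0, hp⟩, l)) ((π y).symm (⟨0, hp⟩, l)) := by
    intro l
    rw [submatrix_apply, he]
    simp [blk, hD]
  refine le_trans ?_ (le_of_eq (sum_congr rfl fun l _ => (congrArg Complex.re (this l)).symm))
  have hinj : Function.Injective fun l : Fin w => (π y).symm (⟨0, hp⟩, l) := by
    intro l l' hl
    simpa using hl
  rw [← sum_image (s := univ) (g := fun l : Fin w => (π y).symm (⟨0, hp⟩, l))
    (f := fun i => (D i i).re) (fun l _ l' _ hl => hinj hl)]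
  refine sum_le_sum_of_subset_of_nonneg ?_ (fun i _ _ => diag_re_nonneg hDp i)
  intro i hi
  rw [mem_image]
  refine ⟨(π y i).2, mem_univ _, ?_⟩
  rw [Equiv.symm_apply_eq, ← hπ y i hi]

lemma OneShot.min {a b : Type*} [Fintype a] [DecidableEq a] [Fintype b] [DecidableEq b]
    {ρ : Matrix (a × b) (a × b) ℂ} {M G s : ℕ} {ε : ℝ} (h : OneShot ρ M G s ε) :
    OneShot ρ M G (min s (Fintype.card b)) ε := by
  obtain ⟨V, U, S, h1, h2, h3, h4, h5⟩ := h
  exact ⟨V, U, S, h1, h2, h3, fun j => le_min (h4 j) (card_le_univ _), h5⟩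

lemma choose_width {B n s : ℕ} (hB : 0 < B) (hs : 0 < s) (hsn : s ≤ B ^ n) :
    ∃ p w : ℕ, 0 < p ∧ 0 < w ∧ B ^ n = p * w ∧ s ≤ w ∧ w ≤ B * s := by
  classical
  have hex : ∃ k, s ≤ B ^ k := ⟨n, hsn⟩
  set k := Nat.find hex with hk
  have hk1 : s ≤ B ^ k := Nat.find_spec hex
  have hkn : k ≤ n := Nat.find_min' hex hsn
  refine ⟨B ^ (n - k), B ^ k, by positivity, by positivity, ?_, hk1, ?_⟩
  · rw [← pow_add, Nat.sub_add_cancel hkn]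
  · rcases Nat.eq_zero_or_pos k with h0 | h0
    · rw [h0, pow_zero]; exact Nat.mul_pos hB hs
    · have : ¬ s ≤ B ^ (k - 1) := Nat.find_min hex (by omega)
      have e : B ^ k = B * B ^ (k - 1) := by rw [← pow_succ', Nat.sub_add_cancel h0]
      rw [e]
      exact Nat.mul_le_mul_left _ (by omega)

lemma proto_rates {a b : Type*} [Fintype a] [DecidableEq a] [Fintype b] [DecidableEq b]
    [Nonempty a] [Nonempty b] {ρ : Matrix (a × b) (a × b) ℂ} {n : ℕ} (h : IsDensity ρ) {M G s : ℕ}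
    {η t : ℝ} (hM : 0 < M) (hG : 0 < G) (hs : 0 < s) (hOS : OneShot (tpowAB ρ n) M G s η)
    (ht : 0 < t) :
    ∃ Pr : Protocol a b n, Pr.dY = M ∧
      n * Real.log (Fintype.card a) + n * Real.log (Fintype.card b) - Real.log (Fintype.card b)
        - Real.log M - Real.log G - Real.log s ≤
        Real.log (Pr.dAp * Pr.dBp) - Real.log Pr.dC ∧
      protocolError ρ Pr ≤ 2 * η + t ^ 2 + η / t ^ 2 := by
  have hA : 0 < Fintype.card a := Fintype.card_pos
  have hB : 0 < Fintype.card b := Fintype.card_pos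
  have hcb : Fintype.card (Fin n → b) = Fintype.card b ^ n := by simp
  have hca : Fintype.card (Fin n → a) = Fintype.card a ^ n := by simp
  have hBn : 0 < Fintype.card b ^ n := by positivity
  obtain ⟨p, w, hp, hw, e1, e2, e3⟩ := choose_width (n := n) (s := Min.min s (Fintype.card b ^ n)) hB
    (lt_min hs hBn) (min_le_right _ _)
  have hOS' := hOS.min
  rw [hcb] at hOS'
  obtain ⟨Pr, r1, r2, r3, r4, r5⟩ := protocol_of_oneShot h hM hG hOS' hp hw (hcb.trans e1) e2 ht
  refine ⟨Pr, r1, ?_, r5⟩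
  rw [r2, r3, r4, hca]
  have hAr : (Fintype.card a : ℝ) ≠ 0 := by positivity
  have hBr : (Fintype.card b : ℝ) ≠ 0 := by positivity
  have hpr : (p : ℝ) ≠ 0 := by positivity
  have hwr : (w : ℝ) ≠ 0 := by positivity
  have hMr : (M : ℝ) ≠ 0 := by positivity
  have hGr : (G : ℝ) ≠ 0 := by positivity
  have hsr : (s : ℝ) ≠ 0 := by positivity
  have l1 : n * Real.log (Fintype.card b) = Real.log p + Real.log w := by
    rw [← Real.log_pow, ← Real.log_mul hpr hwr]; exact_mod_cast congrArg Real.log (by exact_mod_cast e1)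
  have l2 : Real.log w ≤ Real.log (Fintype.card b) + Real.log s := by
    rw [← Real.log_mul hBr hsr]
    refine Real.log_le_log (by positivity) ?_
    exact_mod_cast e3.trans (Nat.mul_le_mul_left _ (min_le_left _ _))
  push_cast
  rw [Real.log_mul (by positivity) hpr, Real.log_mul two_ne_zero (by positivity), Real.log_pow,
    Real.log_mul (by positivity) hGr, Real.log_mul two_ne_zero hMr]
  linarith

lemma arith_comm {x m k r E R δ C l2 : ℝ} (hm : 0 ≤ m) (hr : 0 ≤ r) (hk : 1 ≤ k) (hR : 0 ≤ R)
    (hδ : 0 < δ) (hE : E ≤ k * R) (h1 : x ≤ m * (E + 3 * (δ / 20)) + l2) (hl : l2 ≤ C)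
    (hC : C ≤ (m * k + r) * (δ / 2)) : x ≤ (R + δ) * (m * k + r) := by
  have e1 : m * E ≤ m * (k * R) := mul_le_mul_of_nonneg_left hE hm
  have e2 : 0 ≤ r * R := mul_nonneg hr hR
  have e3 : m * δ ≤ (m * k + r) * δ := by
    refine mul_le_mul_of_nonneg_right ?_ hδ.le
    have := mul_le_mul_of_nonneg_left hk hm
    linarith
  have e4 : 0 ≤ (m * k + r) * δ := le_trans (mul_nonneg hm hδ.le) e3
  have e5 : (R + δ) * (m * k + r) = m * (k * R) + r * R + (m * k + r) * δ := by ring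
  have e6 : (m * k + r) * (δ / 2) = (m * k + r) * δ / 2 := by ring
  have e7 : m * (E + 3 * (δ / 20)) = m * E + 3 * (m * δ) / 20 := by ring
  rw [e7] at h1
  rw [e6] at hC
  linarith

lemma arith_pur {m k r δ l2 LA LB SA SB HA HB J Q lM lG ls : ℝ} (hm : 0 ≤ m) (hr : 0 ≤ r)
    (hk : 1 ≤ k) (hrk : r ≤ k) (hδ : 0 < δ) (hQ : 0 ≤ Q) (hLA : 0 ≤ LA) (hLB : 0 ≤ LB)
    (h1 : lM ≤ m * (k * SA - HA + 3 * (δ / 20)) + l2) (h2 : lG ≤ m * (HA + δ / 20))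
    (h3 : ls ≤ m * (HB + δ / 20)) (hJ : J = k * SB - HB) (hJQ : (Q - δ / 4) * k < J)
    (hC : LB + k * (LA + LB) + l2 + k * Q + k * |SA| + k * |SB| ≤ (m * k + r) * (δ / 2)) :
    (LA - SA + (LB - SB) + Q - δ) * (m * k + r) ≤
      (m * k + r) * LA + (m * k + r) * LB - LB - lM - (lG + r * LA) - (ls + r * LB) := by
  have e1 : m * ((Q - δ / 4) * k) ≤ m * (k * SB - HB) :=
    mul_le_mul_of_nonneg_left (hJ ▸ hJQ.le) hm
  have a1 : -(r * SA) ≤ k * |SA| := by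
    have := mul_le_mul_of_nonneg_left (neg_le_abs SA) hr
    have := mul_le_mul_of_nonneg_right hrk (abs_nonneg SA)
    linarith
  have a2 : -(r * SB) ≤ k * |SB| := by
    have := mul_le_mul_of_nonneg_left (neg_le_abs SB) hr
    have := mul_le_mul_of_nonneg_right hrk (abs_nonneg SB)
    linarith
  have a3 : r * Q ≤ k * Q := mul_le_mul_of_nonneg_right hrk hQ
  have a4 : r * LA ≤ k * LA := mul_le_mul_of_nonneg_right hrk hLA
  have a5 : r * LB ≤ k * LB := mul_le_mul_of_nonneg_right hrk hLB
  have a6 : m * δ ≤ m * k * δ := by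
    refine mul_le_mul_of_nonneg_right ?_ hδ.le
    have := mul_le_mul_of_nonneg_left hk hm
    linarith
  have a7 : 0 ≤ r * δ := mul_nonneg hr hδ.le
  ring_nf at *
  linarith

set_option maxHeartbeats 1000000 in
lemma direct {a b : Type*} [Fintype a] [DecidableEq a] [Fintype b] [DecidableEq b]
    {ρ : Matrix (a × b) (a × b) ℂ} (h : IsDensity ρ) {R Pinf : ℝ} (hR : 0 ≤ R) (h0 : 0 ≤ Pinf)
    (hT : Filter.Tendsto (fun n : ℕ => P1 (tpowAB ρ n) (n * R) / n) Filter.atTop (nhds Pinf)) :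
    Achievable ρ (kappa (ptraceRight ρ) + kappa (ptraceLeft ρ) + Pinf) R := by
  intro ε hε δ hδ
  have hne : Nonempty (a × b) := by
    by_contra hc
    rw [not_nonempty_iff] at hc
    have := h.2
    rw [Matrix.trace, Fintype.sum_empty] at this
    exact zero_ne_one this
  obtain ⟨⟨a0, b0⟩⟩ := hne
  haveI : Nonempty a := ⟨a0⟩
  haveI : Nonempty b := ⟨b0⟩
  obtain ⟨k, hk, hk1⟩ := ((hT.eventually (lt_mem_nhds (by linarith : Pinf - δ / 4 < Pinf))).and
    (Filter.eventually_ge_atTop 1)).exists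
  have hk0 : (0 : ℝ) < k := by exact_mod_cast hk1
  have hk1' : (1 : ℝ) ≤ k := by exact_mod_cast hk1
  rw [lt_div_iff₀ hk0] at hk
  have hd := tpowAB_density h k
  have hps := hd.right.1
  obtain ⟨m0, Λ, hJE, hJB⟩ := P1_lt hd hps.sqrt (by rw [sqrt_herm, sqrt_mul_self'])
    (by positivity : 0 ≤ (k : ℝ) * R) hk
  obtain ⟨HA, HB, hHA, hHB, hdiff, eJE, eJB, hcode⟩ := iid_oneshot hd Λ (sqrt_psd hps)
    (sqrt_mul_self' hps)
  set SA := entropy (ptraceRight ρ) with hSA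
  set SB := entropy (ptraceLeft ρ) with hSB
  have eA : entropy (ptraceRight (tpowAB ρ k)) = k * SA := by
    rw [ptraceRight_tpowAB, entropy_tp_const h.right]
  have eB : entropy (ptraceLeft (tpowAB ρ k)) = k * SB := by
    rw [ptraceLeft_tpowAB, entropy_tp_const h.left]
  rw [eA] at eJE hdiff
  rw [eB] at eJB
  rw [eA] at hcode
  set LA := Real.log (Fintype.card a) with hLA
  set LB := Real.log (Fintype.card b) with hLB
  have hLA0 : 0 ≤ LA := Real.log_natCast_nonneg _
  have hLB0 : 0 ≤ LB := Real.log_natCast_nonneg _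
  have hl2 : 0 ≤ Real.log 2 := Real.log_nonneg (by norm_num)
  set η := Min.min (ε / 8) (ε ^ 2 / 8) with hη
  have hη0 : 0 < η := lt_min (by positivity) (by positivity)
  set t := Real.sqrt (ε / 2) with ht
  have ht0 : 0 < t := Real.sqrt_pos.2 (by positivity)
  have ht2 : t ^ 2 = ε / 2 := Real.sq_sqrt (by positivity)
  have herr : 2 * η + t ^ 2 + η / t ^ 2 ≤ ε := by
    have h1 : η ≤ ε / 8 := min_le_left _ _
    have h2 : η / t ^ 2 ≤ ε / 4 := by
      rw [ht2, div_le_iff₀ (by positivity)]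
      have h3 : η ≤ ε ^ 2 / 8 := min_le_right _ _
      nlinarith
    linarith
  obtain ⟨N, hN⟩ := hcode (δ / 20) (by positivity) η hη0
  set C := LB + k * (LA + LB) + Real.log 2 + k * Pinf + k * |SA| + k * |SB| with hC
  have hC0 : 0 ≤ C := by positivity
  obtain ⟨N2, hN2⟩ := exists_nat_ge (2 * C / δ)
  refine ⟨max (max (N * k) 1) N2, fun n hn => ?_⟩
  have hn1 : N * k ≤ n := (le_max_left _ _).trans ((le_max_left _ _).trans hn)
  have hn2 : 1 ≤ n := (le_max_right _ _).trans ((le_max_left _ _).trans hn)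
  have hn3 : N2 ≤ n := (le_max_right _ _).trans hn
  have hnC : C ≤ n * (δ / 2) := by
    have : 2 * C / δ ≤ n := hN2.trans (by exact_mod_cast hn3)
    rw [div_le_iff₀ hδ] at this
    linarith
  have hm : N ≤ n / k := (Nat.le_div_iff_mul_le hk1).2 hn1
  have hr : n % k < k := Nat.mod_lt _ hk1
  obtain ⟨m, r, hmN, hrk, rfl⟩ : ∃ m r, N ≤ m ∧ r < k ∧ n = m * k + r :=
    ⟨n / k, n % k, hm, hr, (Nat.div_add_mod' n k).symm⟩
  obtain ⟨M, G, s, hM, hG, hs, hOS, lM, lG, ls⟩ := hN m hmN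
  have hOS2 := OneShot.junk (isProd_block ρ m k r) (tpowAB_density h r) hOS
  have cA : Fintype.card (Fin r → a) = Fintype.card a ^ r := by simp
  have cB : Fintype.card (Fin r → b) = Fintype.card b ^ r := by simp
  rw [cA, cB] at hOS2
  have hA : 0 < Fintype.card a := Fintype.card_pos
  have hB : 0 < Fintype.card b := Fintype.card_pos
  obtain ⟨Pr, p1, p2, p3⟩ := proto_rates h hM (by positivity) (by positivity) hOS2 ht0
  have hnpos : (0 : ℝ) < ((m * k + r : ℕ) : ℝ) := by exact_mod_cast hn2
  have hrr : (r : ℝ) ≤ k := by exact_mod_cast hrk.le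
  have hr0 : (0 : ℝ) ≤ r := by positivity
  have hm0 : (0 : ℝ) ≤ m := by positivity
  have hnn : ((m * k + r : ℕ) : ℝ) = m * k + r := by push_cast; ring
  have eG : Real.log ((G * Fintype.card a ^ r : ℕ) : ℝ) = Real.log G + r * LA := by
    push_cast
    rw [Real.log_mul (by positivity) (by positivity), Real.log_pow]
  have es : Real.log ((s * Fintype.card b ^ r : ℕ) : ℝ) = Real.log s + r * LB := by
    push_cast
    rw [Real.log_mul (by positivity) (by positivity), Real.log_pow]
  rw [eG, es] at p2
  refine ⟨Pr, ?_, ?_, p3.trans herr⟩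
  · unfold commRate
    rw [p1, div_le_iff₀ hnpos]
    have hl2C : Real.log 2 ≤ C := by
      have h1 : 0 ≤ k * (LA + LB) := by positivity
      have h2 : 0 ≤ k * Pinf := by positivity
      have h3 : 0 ≤ k * |SA| := by positivity
      have h4 : 0 ≤ k * |SB| := by positivity
      linarith
    rw [hnn] at hnC ⊢
    exact arith_comm hm0 hr0 hk1' hR hδ (eJE ▸ hJE) lM hl2C hnC
  · unfold purityRate
    rw [le_div_iff₀ hnpos]
    rw [hnn] at p2 hnC ⊢
    refine le_trans ?_ p2
    unfold kappa
    exact arith_pur hm0 hr0 hk1' hrr hδ h0 hLA0 hLB0 lM lG ls eJB hJB hnC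

/-- **Main theorem.** The 1-way distillable local purity of `ρ^{AB}` at communication
rate `R` is `κ_→(ρ^{AB},R) = κ(ρ^A) + κ(ρ^B) + P_→(ρ^{AB},R)`, where
`P_→(ρ^{AB},R) = lim_{n→∞} (1/n) P^{(1)}_→((ρ^{AB})^{⊗n}, nR)`. -/
theorem main_theorem {α β : Type*} [Fintype α] [DecidableEq α] [Fintype β] [DecidableEq β]
    (ρ : Matrix (α × β) (α × β) ℂ) (hρ : IsDensity ρ) (R : ℝ) (hR : 0 ≤ R) :
    ∃ Pinf : ℝ,
      Filter.Tendsto (fun n : ℕ => P1 (tpowAB ρ n) (n * R) / n) Filter.atTop (nhds Pinf) ∧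
      kappaArrow ρ R = kappa (ptraceRight ρ) + kappa (ptraceLeft ρ) + Pinf := by
  obtain ⟨Pinf, hT, h0, hP⟩ := exists_limit hρ hR
  refine ⟨Pinf, hT, ?_⟩
  exact IsGreatest.csSup_eq ⟨direct hρ hR h0 hT, fun P hA => converse hρ hR h0 hP hA⟩

end LPD
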